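/- Let X be a nonempty metric space that is locally compact, geodesic, isometrically homogeneous, and admits a dilation of factor λ > 1. Then for every μ > 0 there exists a homeomorphism f : X → X with d(f p, f q) = μ d(p, q) for all p, q ∈ X; that is, X admits dilations of every positive factor. -/

import Mathlib

/-- `X` is isometrically homogeneous: for all `p q` there is a surjective
isometry sending `p` to `q`. -/
def IsometricallyHomogeneous (X : Type*) [MetricSpace X] : Prop :=
  ∀ p q : X, ∃ f : X → X, Isometry f ∧ Function.Surjective f ∧ f p = q

/-- `X` is a geodesic metric space: any two points are joined by an isometric
image of a real interval `[0, T]`. -/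
def IsGeodesicSpace (X : Type*) [MetricSpace X] : Prop :=
  ∀ p q : X, ∃ T : ℝ, 0 ≤ T ∧ ∃ ι : ℝ → X,
    (∀ s ∈ Set.Icc (0 : ℝ) T, ∀ t ∈ Set.Icc (0 : ℝ) T,
      dist (ι s) (ι t) = dist s t) ∧ ι 0 = p ∧ ι T = q

/-- `f` is a dilation of factor `λ` on `X`: a homeomorphism multiplying all
distances by `λ`. -/
def IsDilation {X : Type*} [MetricSpace X] (f : X ≃ₜ X) (lam : ℝ) : Prop :=
  ∀ p q : X, dist (f p) (f q) = lam * dist p q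

set_option linter.unusedSectionVars false
open Filter Topology

/-- A group with a proper length function and a dilating automorphism. -/
structure LenData (M : Type*) [Group M] [TopologicalSpace M] (lam : ℝ) where
  two_le : 2 ≤ lam
  len : M → ℝ
  δ : MulAut M
  len_one : len 1 = 0
  len_inv : ∀ x, len x⁻¹ = len x
  len_mul : ∀ x y, len (x * y) ≤ len x + len y
  len_cont : Continuous len
  len_proper : ∀ r, IsCompact {x | len x ≤ r}
  δ_cont : Continuous (fun x => δ x)
  δ_symm_cont : Continuous (fun x => δ⁻¹ x)
  len_δ : ∀ x, len (δ x) = lam * len x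

namespace LenData

section basic
variable {M : Type*} [Group M] [TopologicalSpace M] {lam : ℝ} (L : LenData M lam)

theorem lam_pos (L : LenData M lam) : 0 < lam := by linarith [L.two_le]

theorem len_nonneg (x : M) : 0 ≤ L.len x := by
  have h := L.len_mul x x⁻¹
  rw [mul_inv_cancel, L.len_one, L.len_inv] at h
  linarith

theorem len_δ_inv (x : M) : L.len (L.δ⁻¹ x) = lam⁻¹ * L.len x := by
  have h := L.len_δ (L.δ⁻¹ x)
  rw [MulAut.apply_inv_self] at h
  rw [h, ← mul_assoc, inv_mul_cancel₀ L.lam_pos.ne', one_mul]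

/-- powers of the dilation -/
def sc (k : ℤ) : MulAut M := L.δ ^ k

theorem sc_zero (x : M) : L.sc 0 x = x := by simp [sc]

theorem sc_add (j k : ℤ) (x : M) : L.sc (j + k) x = L.sc j (L.sc k x) := by
  simp [sc, zpow_add]

theorem sc_one (x : M) : L.sc 1 x = L.δ x := by simp [sc]

theorem sc_neg_one (x : M) : L.sc (-1) x = L.δ⁻¹ x := by simp [sc]

theorem len_sc (k : ℤ) (x : M) : L.len (L.sc k x) = lam ^ k * L.len x := by
  induction k using Int.induction_on with
  | zero => simp [sc]
  | succ n ih =>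
    rw [add_comm, sc_add, sc_one, L.len_δ, ih, zpow_add₀ L.lam_pos.ne', zpow_one, mul_assoc]
  | pred n ih =>
    rw [sub_eq_add_neg, add_comm, sc_add, sc_neg_one, L.len_δ_inv, ih,
      zpow_add₀ L.lam_pos.ne', zpow_neg_one, mul_assoc]

theorem sc_cont (k : ℤ) : Continuous (fun x => L.sc k x) := by
  induction k using Int.induction_on with
  | zero => simp only [sc_zero]; exact continuous_id
  | succ n ih =>
    have : (fun x => L.sc ((n : ℤ) + 1) x) = fun x => L.δ (L.sc n x) := by
      funext x; rw [add_comm, sc_add, sc_one]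
    rw [this]; exact L.δ_cont.comp ih
  | pred n ih =>
    have : (fun x => L.sc (-(n : ℤ) - 1) x) = fun x => L.δ⁻¹ (L.sc (-n) x) := by
      funext x; rw [sub_eq_add_neg, add_comm, sc_add, sc_neg_one]
    rw [this]; exact L.δ_symm_cont.comp ih

theorem sc_neg_sc (k : ℤ) (x : M) : L.sc (-k) (L.sc k x) = x := by
  rw [← sc_add, neg_add_cancel, sc_zero]

theorem sc_sc_neg (k : ℤ) (x : M) : L.sc k (L.sc (-k) x) = x := by
  rw [← sc_add, add_neg_cancel, sc_zero]

theorem len_conj_le (g x : M) : L.len (g * x * g⁻¹) ≤ L.len x + 2 * L.len g := by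
  have h1 := L.len_mul (g * x) g⁻¹
  have h2 := L.len_mul g x
  rw [L.len_inv] at h1
  linarith

theorem abs_len_sub (x y : M) : |L.len (x * y) - L.len y| ≤ L.len x := by
  rw [abs_le]
  constructor
  · have := L.len_mul x⁻¹ (x * y)
    rw [inv_mul_cancel_left, L.len_inv] at this
    linarith
  · linarith [L.len_mul x y]

theorem len_pow_le (x : M) (n : ℕ) : L.len (x ^ n) ≤ n * L.len x := by
  induction n with
  | zero => simp [L.len_one]
  | succ n ih =>
    rw [pow_succ]
    have := L.len_mul (x ^ n) x
    push_cast; linarith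

theorem len_zpow_le (x : M) (n : ℤ) : L.len (x ^ n) ≤ |(n : ℝ)| * L.len x := by
  rcases n with n | n
  · simpa using L.len_pow_le x n
  · rw [zpow_negSucc, L.len_inv]
    have := L.len_pow_le x (n + 1)
    have h : |((Int.negSucc n : ℤ) : ℝ)| = ((n + 1 : ℕ) : ℝ) := by
      rw [Int.cast_negSucc, abs_neg, abs_of_nonneg (by positivity)]
    rw [h]; exact this

theorem lam_zpow_tendsto (L : LenData M lam) : Tendsto (fun n : ℕ => lam ^ (-(n : ℤ))) atTop (𝓝 0) := by
  have : (fun n : ℕ => lam ^ (-(n : ℤ))) = fun n : ℕ => (lam⁻¹) ^ n := by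
    funext n; rw [zpow_neg, zpow_natCast, inv_pow]
  rw [this]
  apply tendsto_pow_atTop_nhds_zero_of_lt_one
  · exact inv_nonneg.mpr L.lam_pos.le
  · apply inv_lt_one_of_one_lt₀; linarith [L.two_le]

/-- products of `n` elements of `H` of length at most `r`. -/
def BP (H : Subgroup M) (r : ℝ) : ℕ → Set M
  | 0 => {1}
  | n + 1 => {x | ∃ y ∈ BP H r n, ∃ g ∈ H, L.len g ≤ r ∧ x = y * g}

theorem BP_mem {H : Subgroup M} {r : ℝ} {n : ℕ} {x : M} (h : x ∈ L.BP H r n) : x ∈ H := by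
  induction n generalizing x with
  | zero => rw [BP, Set.mem_singleton_iff] at h; rw [h]; exact H.one_mem
  | succ n ih => obtain ⟨y, hy, g, hg, _, rfl⟩ := h; exact H.mul_mem (ih hy) hg

theorem BP_one_mem {H : Subgroup M} {r : ℝ} (hr : 0 ≤ r) (n : ℕ) : (1 : M) ∈ L.BP H r n := by
  induction n with
  | zero => rfl
  | succ n ih => exact ⟨1, ih, 1, H.one_mem, by rw [L.len_one]; exact hr, by simp⟩

theorem BP_mul {H : Subgroup M} {r : ℝ} {m n : ℕ} {x y : M} (hx : x ∈ L.BP H r m)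
    (hy : y ∈ L.BP H r n) : x * y ∈ L.BP H r (m + n) := by
  induction n generalizing y with
  | zero => rw [BP, Set.mem_singleton_iff] at hy; simpa [hy] using hx
  | succ n ih =>
    obtain ⟨z, hz, g, hg, hgr, rfl⟩ := hy
    exact ⟨x * z, ih hz, g, hg, hgr, by rw [mul_assoc]⟩

theorem BP_single {H : Subgroup M} {r : ℝ} {x : M} (hx : x ∈ H) (h : L.len x ≤ r) :
    x ∈ L.BP H r 1 := ⟨1, rfl, x, hx, h, by simp⟩

theorem BP_inv {H : Subgroup M} {r : ℝ} {n : ℕ} {x : M} (hx : x ∈ L.BP H r n) :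
    x⁻¹ ∈ L.BP H r n := by
  induction n generalizing x with
  | zero => rw [BP, Set.mem_singleton_iff] at hx ⊢; simp [hx]
  | succ n ih =>
    obtain ⟨z, hz, g, hg, hgr, rfl⟩ := hx
    rw [mul_inv_rev, add_comm]
    exact L.BP_mul (L.BP_single (H.inv_mem hg) (by rwa [L.len_inv])) (ih hz)

theorem BP_mono {H : Subgroup M} {r : ℝ} (hr : 0 ≤ r) {m n : ℕ} (hmn : m ≤ n) :
    L.BP H r m ⊆ L.BP H r n := by
  intro x hx
  obtain ⟨k, rfl⟩ := Nat.exists_eq_add_of_le hmn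
  simpa using L.BP_mul hx (L.BP_one_mem hr k)

theorem BP_sc {H : Subgroup M} (k : ℤ) (hH : ∀ x ∈ H, L.sc k x ∈ H) {r : ℝ} {n : ℕ} {x : M}
    (hx : x ∈ L.BP H r n) : L.sc k x ∈ L.BP H (lam ^ k * r) n := by
  induction n generalizing x with
  | zero => rw [BP, Set.mem_singleton_iff] at hx ⊢; simp [hx]
  | succ n ih =>
    obtain ⟨z, hz, g, hg, hgr, rfl⟩ := hx
    refine ⟨L.sc k z, ih hz, L.sc k g, hH g hg, ?_, by simp⟩
    rw [len_sc]
    exact mul_le_mul_of_nonneg_left hgr (zpow_nonneg L.lam_pos.le k)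

theorem BP_len {H : Subgroup M} {r : ℝ} {n : ℕ} {x : M} (hx : x ∈ L.BP H r n) :
    L.len x ≤ n * r := by
  induction n generalizing x with
  | zero => rw [BP, Set.mem_singleton_iff] at hx; simp [hx, L.len_one]
  | succ n ih =>
    obtain ⟨z, hz, g, hg, hgr, rfl⟩ := hx
    have := L.len_mul z g
    have := ih hz
    push_cast; linarith

/-- chain condition -/
def Chain (H : Subgroup M) : Prop := ∀ R : ℝ, ∃ n : ℕ, ∀ x ∈ H, L.len x ≤ R → x ∈ L.BP H 1 n

end basic

section top
variable {M : Type*} [Group M] [TopologicalSpace M] [IsTopologicalGroup M] {lam : ℝ}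
  (L : LenData M lam)

theorem isOpen_ball (r : ℝ) : IsOpen {x | L.len x < r} := isOpen_lt L.len_cont continuous_const

theorem ball_mem_nhds {r : ℝ} (hr : 0 < r) : {x | L.len x < r} ∈ 𝓝 (1 : M) :=
  (L.isOpen_ball r).mem_nhds (by simpa [L.len_one] using hr)

theorem chain_top_of_connected [ConnectedSpace M] : L.Chain ⊤ := by
  let S : Subgroup M :=
    { carrier := {x | ∃ n, x ∈ L.BP ⊤ 1 n}
      one_mem' := ⟨0, rfl⟩
      mul_mem' := by rintro x y ⟨m, hm⟩ ⟨n, hn⟩; exact ⟨m + n, L.BP_mul hm hn⟩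
      inv_mem' := by rintro x ⟨n, hn⟩; exact ⟨n, L.BP_inv hn⟩ }
  have hS : IsOpen (S : Set M) := by
    apply Subgroup.isOpen_of_mem_nhds S (g := 1)
    refine Filter.mem_of_superset (L.ball_mem_nhds one_pos) ?_
    intro x hx
    exact ⟨1, L.BP_single trivial (le_of_lt hx)⟩
  have hcl : IsClopen (S : Set M) := ⟨Subgroup.isClosed_of_isOpen S hS, hS⟩
  have huniv : (S : Set M) = Set.univ := hcl.eq_univ ⟨1, S.one_mem⟩
  intro R
  let O : ℕ → Set M := fun n => {x | ∃ y ∈ L.BP ⊤ 1 n, L.len (y⁻¹ * x) < 1}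
  have hO : ∀ n, IsOpen (O n) := by
    intro n
    have : O n = ⋃ y ∈ L.BP ⊤ 1 n, {x | L.len (y⁻¹ * x) < 1} := by
      ext x; simp [O]
    rw [this]
    refine isOpen_biUnion fun y _ => ?_
    exact _root_.isOpen_lt (L.len_cont.comp (continuous_const.mul continuous_id)) continuous_const
  have hmono : Monotone O := by
    intro m n hmn x hx
    obtain ⟨y, hy, h⟩ := hx
    exact ⟨y, L.BP_mono zero_le_one hmn hy, h⟩
  obtain ⟨n, hn⟩ := (L.len_proper R).elim_directed_cover O hO (by
    intro x _
    have : x ∈ (S : Set M) := by rw [huniv]; trivial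
    obtain ⟨n, hn⟩ := this
    exact Set.mem_iUnion.2 ⟨n, x, hn, by simp [L.len_one]⟩) hmono.directed_le
  refine ⟨n + 1, fun x _ hx => ?_⟩
  obtain ⟨y, hy, h⟩ := hn hx
  exact ⟨y, hy, y⁻¹ * x, trivial, h.le, by simp⟩

theorem conj_small {r η : ℝ} (hη : 0 < η) :
    ∃ U ∈ 𝓝 (1 : M), ∀ a ∈ U, ∀ y, L.len y ≤ r → L.len (y⁻¹ * a * y) < η := by
  have hK := L.len_proper r
  have hopen : IsOpen {p : M × M | L.len (p.2⁻¹ * p.1 * p.2) < η} :=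
    _root_.isOpen_lt (L.len_cont.comp (by fun_prop)) continuous_const
  obtain ⟨u, v, hu, hv, hu1, hv1, huv⟩ := generalized_tube_lemma
    (isCompact_singleton (x := (1 : M))) hK hopen (by
      rintro ⟨a, y⟩ ⟨ha, hy⟩
      simp only [Set.mem_singleton_iff] at ha
      simp [ha, L.len_one, hη])
  refine ⟨u, hu.mem_nhds (hu1 rfl), fun a ha y hy => ?_⟩
  exact huv (Set.mk_mem_prod ha (hv1 hy))

end top
end LenData

open Filter Topology MeasureTheory BoundedContinuousFunction

namespace LenData
section lemA
variable {M : Type*} [Group M] [TopologicalSpace M] [IsTopologicalGroup M] {lam : ℝ}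
  (L : LenData M lam)

theorem locallyCompact (L : LenData M lam) : LocallyCompactSpace M :=
  (L.len_proper 1).locallyCompactSpace_of_mem_nhds_of_group
    (Filter.mem_of_superset (L.ball_mem_nhds one_pos) fun _ h => le_of_lt (Set.mem_setOf.1 h))

/-- left translation of functions -/
def tr (g : M) (f : M →ᵇ ℝ) : M →ᵇ ℝ := f.compContinuous ⟨fun y => g * y, by fun_prop⟩

@[simp] theorem tr_apply (g : M) (f : M →ᵇ ℝ) (y : M) : tr g f y = f (g * y) := rfl

theorem tr_mul (g h : M) (f : M →ᵇ ℝ) : tr (g * h) f = tr h (tr g f) := by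
  ext y; simp [mul_assoc]

theorem tr_one (f : M →ᵇ ℝ) : tr (1 : M) f = f := by ext y; simp

theorem tr_norm (g : M) (f : M →ᵇ ℝ) : ‖tr g f‖ ≤ ‖f‖ :=
  (BoundedContinuousFunction.norm_le (norm_nonneg _)).2 fun y => f.norm_coe_le_norm _

theorem tr_sub (g : M) (f h : M →ᵇ ℝ) : tr g (f - h) = tr g f - tr g h := by ext; simp
theorem tr_add (g : M) (f h : M →ᵇ ℝ) : tr g (f + h) = tr g f + tr g h := by ext; simp
theorem tr_smul (g : M) (c : ℝ) (f : M →ᵇ ℝ) : tr g (c • f) = c • tr g f := by ext; simp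

/-- Existence of a nicely varying state. -/
theorem exists_chi : ∃ (χ : (M →ᵇ ℝ) →ₗ[ℝ] ℝ) (C : ℝ), 0 ≤ C ∧ (∀ f, |χ f| ≤ ‖f‖) ∧
    χ (BoundedContinuousFunction.const M 1) = 1 ∧
    (∀ f : M →ᵇ ℝ, (∀ y, L.len y ≤ 1 → f y = 0) → χ f = 0) ∧
    ∀ u f, |χ (tr u f) - χ f| ≤ C * L.len u * ‖f‖ := by
  haveI := L.locallyCompact
  letI : MeasurableSpace M := borel M
  haveI : BorelSpace M := ⟨rfl⟩
  let μ : Measure M := Measure.haar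
  let ψ : M → ℝ := fun y => max 0 (1 - L.len y)
  have hψc : Continuous ψ := by
    have := L.len_cont
    fun_prop
  have hψ0 : ∀ y, 0 ≤ ψ y := fun y => le_max_left _ _
  have hψz : ∀ y, 1 ≤ L.len y → ψ y = 0 := fun y hy => max_eq_left (by linarith)
  have hψs : HasCompactSupport ψ := by
    refine HasCompactSupport.of_support_subset_isCompact (L.len_proper 1) ?_
    intro y hy
    by_contra h
    exact hy (hψz y (le_of_lt (not_le.1 h)))
  have hψi : ∀ f : M →ᵇ ℝ, Integrable (fun y => ψ y * f y) μ := fun f =>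
    (hψc.mul f.continuous).integrable_of_hasCompactSupport hψs.mul_right
  have hψI : Integrable ψ μ := hψc.integrable_of_hasCompactSupport hψs
  have hI : 0 < ∫ y, ψ y ∂μ := by
    refine hψc.integral_pos_of_hasCompactSupport_nonneg_nonzero hψs (fun y => hψ0 y) (x := 1) ?_
    simp [ψ, L.len_one]
  set I := ∫ y, ψ y ∂μ with hIdef
  let V : ℝ := μ.real {x | L.len x ≤ 2}
  have hV : 0 ≤ V := measureReal_nonneg
  let χ : (M →ᵇ ℝ) →ₗ[ℝ] ℝ :=
    { toFun := fun f => (∫ y, ψ y * f y ∂μ) / I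
      map_add' := by
        intro f g
        rw [← add_div, ← integral_add (hψi f) (hψi g)]
        congr 2; funext y; simp [mul_add]
      map_smul' := by
        intro c f
        simp only [RingHom.id_apply, smul_eq_mul]
        rw [← mul_div_assoc, ← integral_const_mul]
        congr 2; funext y; simp; ring }
  have hχ : ∀ f, χ f = (∫ y, ψ y * f y ∂μ) / I := fun f => rfl
  have hb : ∀ f, |χ f| ≤ ‖f‖ := by
    intro f
    rw [hχ, abs_div, abs_of_pos hI, div_le_iff₀ hI]
    calc |∫ y, ψ y * f y ∂μ| ≤ ∫ y, |ψ y * f y| ∂μ := abs_integral_le_integral_abs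
      _ ≤ ∫ y, ‖f‖ * ψ y ∂μ := by
        refine integral_mono (hψi f).abs (hψI.const_mul _) fun y => ?_
        simp only [abs_mul, abs_of_nonneg (hψ0 y)]
        rw [mul_comm]
        exact mul_le_mul_of_nonneg_right (f.norm_coe_le_norm y) (hψ0 y)
      _ = ‖f‖ * I := by rw [integral_const_mul]
  refine ⟨χ, max 2 (V / I), by positivity, hb, ?_, ?_, ?_⟩
  · rw [hχ]; simp [← hIdef, hI.ne']
  · intro f hf
    rw [hχ]
    have : (fun y => ψ y * f y) = 0 := by
      funext y
      by_cases h : L.len y ≤ 1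
      · simp [hf y h]
      · simp [hψz y (le_of_lt (not_le.1 h))]
    rw [this]; simp
  · intro u f
    by_cases hu : 1 ≤ L.len u
    · have h1 := hb (tr u f)
      have h2 := hb f
      have h3 := tr_norm u f
      have h4 : |χ (tr u f) - χ f| ≤ |χ (tr u f)| + |χ f| := abs_sub _ _
      have h5 : 2 * 1 * ‖f‖ ≤ max 2 (V / I) * L.len u * ‖f‖ := by
        gcongr
        exact le_max_left _ _
      linarith
    · push Not at hu
      have e1 : ∫ y, ψ y * (tr u f) y ∂μ = ∫ y, ψ (u⁻¹ * y) * f y ∂μ := by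
        rw [← integral_mul_left_eq_self (fun y => ψ (u⁻¹ * y) * f y) u]
        simp
      have hS : ∀ y, |ψ (u⁻¹ * y) - ψ y| ≤ Set.indicator {x | L.len x ≤ 2} (fun _ => L.len u) y := by
        intro y
        have hab := L.abs_len_sub u⁻¹ y
        rw [L.len_inv] at hab
        by_cases hy : L.len y ≤ 2
        · rw [Set.indicator_of_mem (by exact hy)]
          refine le_trans ?_ hab
          have := abs_max_sub_max_le_abs (1 - L.len (u⁻¹ * y)) (1 - L.len y) 0
          simp only [ψ]
          rw [max_comm 0, max_comm 0]
          refine this.trans (le_of_eq ?_)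
          rw [← abs_neg]; congr 1; ring
        · push Not at hy
          rw [Set.indicator_of_notMem (by simpa using hy)]
          have h1 := (abs_le.1 hab).1
          rw [hψz y (by linarith), hψz _ (by linarith)]; simp
      have hmeas : MeasurableSet {x | L.len x ≤ 2} :=
        (isClosed_le L.len_cont continuous_const).measurableSet
      have hfin : μ {x | L.len x ≤ 2} < ⊤ := (L.len_proper 2).measure_lt_top
      have hint2 : Integrable (fun y => ψ (u⁻¹ * y) * f y) μ := by
        have := (hψi (tr u f)).comp_mul_left u⁻¹
        simpa using this
      have e2 : |∫ y, ψ (u⁻¹ * y) * f y ∂μ - ∫ y, ψ y * f y ∂μ| ≤ L.len u * V * ‖f‖ := by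
        rw [← integral_sub hint2 (hψi f)]
        calc _ ≤ ∫ y, |ψ (u⁻¹ * y) * f y - ψ y * f y| ∂μ := abs_integral_le_integral_abs
          _ ≤ ∫ y, (Set.indicator {x | L.len x ≤ 2} (fun _ => L.len u) y) * ‖f‖ ∂μ := by
            refine integral_mono (hint2.sub (hψi f)).abs ?_ fun y => ?_
            · refine Integrable.mul_const ?_ _
              exact (integrable_indicator_iff hmeas).2 (integrableOn_const hfin.ne)
            · simp only [← sub_mul, abs_mul]
              exact mul_le_mul (hS y) (f.norm_coe_le_norm y) (abs_nonneg _)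
                ((abs_nonneg _).trans (hS y))
          _ = L.len u * V * ‖f‖ := by
            rw [integral_mul_const, integral_indicator_const _ hmeas]
            simp [V, mul_comm]
      rw [hχ, hχ, e1, ← sub_div, abs_div, abs_of_pos hI, div_le_iff₀ hI]
      refine e2.trans ?_
      have : V ≤ max 2 (V / I) * I := by
        calc V = V / I * I := by field_simp
          _ ≤ _ := by gcongr; exact le_max_right _ _
      calc L.len u * V * ‖f‖ ≤ L.len u * (max 2 (V / I) * I) * ‖f‖ := by
            have := L.len_nonneg u
            gcongr
        _ = _ := by ring
end lemA
end LenData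

open Filter Topology MeasureTheory BoundedContinuousFunction
set_option linter.unusedSectionVars false

namespace LenData
section lemA
variable {M : Type*} [Group M] [TopologicalSpace M] [IsTopologicalGroup M] {lam : ℝ}
  (L : LenData M lam)

structure IsState (m : (M →ᵇ ℝ) →ₗ[ℝ] ℝ) : Prop where
  bd : ∀ f, |m f| ≤ ‖f‖
  one : m (BoundedContinuousFunction.const M 1) = 1
  supp : ∀ f : M →ᵇ ℝ, (∀ y, L.len y ≤ 1 → f y = 0) → m f = 0
  inv : ∀ k, L.len k = 0 → ∀ f, m (tr k f) = m f

def Var (m : (M →ᵇ ℝ) →ₗ[ℝ] ℝ) (n : ℕ) (c : ℝ) : Prop :=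
  ∀ g, L.len g ≤ lam ^ (-(n : ℤ)) → ∀ f, |m (tr g f) - m f| ≤ c * ‖f‖

theorem exists_clamp (f : M →ᵇ ℝ) {c : ℝ} (hc : 0 ≤ c) : ∃ f' : M →ᵇ ℝ, ‖f'‖ ≤ c ∧
    ∀ y, |f y| ≤ c → f' y = f y := by
  refine ⟨BoundedContinuousFunction.ofNormedAddCommGroup (fun y => max (-c) (min c (f y)))
    (by fun_prop) c ?_, BoundedContinuousFunction.norm_ofNormedAddCommGroup_le _ hc _, ?_⟩
  · intro y
    rw [Real.norm_eq_abs, abs_le]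
    exact ⟨le_max_left _ _, max_le (by linarith) (min_le_left _ _)⟩
  · intro y hy
    obtain ⟨h1, h2⟩ := abs_le.1 hy
    simp [h1, h2]

variable {L}
theorem IsState.le_of_unit {m : (M →ᵇ ℝ) →ₗ[ℝ] ℝ} (hm : L.IsState m) {f : M →ᵇ ℝ} {c : ℝ}
    (hc : 0 ≤ c) (hf : ∀ y, L.len y ≤ 1 → |f y| ≤ c) : |m f| ≤ c := by
  obtain ⟨f', h1, h2⟩ := exists_clamp f hc
  have : m (f - f') = 0 := hm.supp _ fun y hy => by simp [h2 y (hf y hy)]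
  rw [map_sub, sub_eq_zero] at this
  rw [this]
  exact (hm.bd f').trans h1

theorem Var.BP {m : (M →ᵇ ℝ) →ₗ[ℝ] ℝ} {n : ℕ} {c : ℝ} (hc : 0 ≤ c) (hm : L.Var m n c) {k : ℕ}
    {g : M} (hg : g ∈ L.BP ⊤ (lam ^ (-(n : ℤ))) k) (f : M →ᵇ ℝ) :
    |m (tr g f) - m f| ≤ k * c * ‖f‖ := by
  induction k generalizing g with
  | zero =>
    rw [LenData.BP, Set.mem_singleton_iff] at hg
    subst hg; rw [tr_one]; simp
  | succ k ih =>
    obtain ⟨y, hy, h, _, hh, rfl⟩ := hg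
    rw [tr_mul]
    have h1 := hm h hh (tr y f)
    have h2 := ih hy
    have h3 : c * ‖tr y f‖ ≤ c * ‖f‖ := mul_le_mul_of_nonneg_left (tr_norm y f) hc
    have h4 := abs_sub_le (m (tr h (tr y f))) (m (tr y f)) (m f)
    push_cast
    nlinarith
variable (L)

theorem chain_scaled (hch : L.Chain ⊤) (R : ℝ) : ∃ k : ℕ, ∀ n : ℤ, ∀ g : M,
    L.len g ≤ lam ^ n * R → g ∈ L.BP ⊤ (lam ^ n) k := by
  obtain ⟨k, hk⟩ := hch R
  refine ⟨k, fun n g hg => ?_⟩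
  have h1 : L.sc (-n) g ∈ L.BP ⊤ 1 k := by
    refine hk _ trivial ?_
    rw [len_sc, zpow_neg, inv_mul_le_iff₀ (zpow_pos L.lam_pos n)]
    exact hg
  have := L.BP_sc n (H := ⊤) (fun _ _ => trivial) h1
  rwa [sc_sc_neg, mul_one] at this

noncomputable def tau (n : ℕ) : ℝ := sInf {c | 0 ≤ c ∧ ∃ m, L.IsState m ∧ L.Var m n c}

theorem exists_state : ∃ m, L.IsState m := by
  obtain ⟨χ, C, hC, h1, h2, h3, h4⟩ := L.exists_chi
  refine ⟨χ, h1, h2, h3, fun k hk f => ?_⟩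
  have := h4 k f
  rw [hk, mul_zero, zero_mul] at this
  exact sub_eq_zero.1 (abs_nonpos_iff.1 this)

theorem tau_bdd (n : ℕ) : BddBelow {c | 0 ≤ c ∧ ∃ m, L.IsState m ∧ L.Var m n c} :=
  ⟨0, fun _ h => h.1⟩

theorem tau_ne (n : ℕ) : {c | 0 ≤ c ∧ ∃ m, L.IsState m ∧ L.Var m n c}.Nonempty := by
  obtain ⟨m, hm⟩ := L.exists_state
  refine ⟨2, by norm_num, m, hm, fun g _ f => ?_⟩
  have h1 := hm.bd (tr g f)
  have h2 := hm.bd f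
  have h3 := tr_norm g f
  have h4 : |m (tr g f) - m f| ≤ |m (tr g f)| + |m f| := abs_sub _ _
  linarith

theorem tau_pos (hch : L.Chain ⊤) {z : M} (hz : L.len z ≠ 0) (n : ℕ) : 0 < L.tau n := by
  have hz0 : 0 < L.len z := lt_of_le_of_ne (L.len_nonneg z) hz.symm
  obtain ⟨z, hz⟩ : ∃ z, 3 ≤ L.len z := by
    have h2 : 1 < lam := by linarith [L.two_le]
    obtain ⟨k, hk⟩ := pow_unbounded_of_one_lt (3 / L.len z) h2
    refine ⟨L.sc k z, ?_⟩
    rw [len_sc, zpow_natCast]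
    rw [div_lt_iff₀ hz0] at hk
    exact hk.le
  obtain ⟨k, hk⟩ := L.chain_scaled hch (lam ^ n * L.len z)
  have hzk := hk (-(n : ℤ)) z (by
    rw [← mul_assoc, zpow_neg, zpow_natCast, inv_mul_cancel₀ (pow_pos L.lam_pos n).ne', one_mul])
  let f : M →ᵇ ℝ := BoundedContinuousFunction.ofNormedAddCommGroup
    (fun y => max 0 (min 1 (L.len y - 1))) (by have := L.len_cont; fun_prop) 1 (by
      intro y
      rw [Real.norm_eq_abs, abs_le]
      exact ⟨by linarith [le_max_left 0 (min 1 (L.len y - 1))],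
        max_le zero_le_one (min_le_left _ _)⟩)
  have hfa : ∀ y, f y = max 0 (min 1 (L.len y - 1)) := fun y => rfl
  have hfn : ‖f‖ ≤ 1 := BoundedContinuousFunction.norm_ofNormedAddCommGroup_le _ zero_le_one _
  have key : ∀ c ∈ {c | 0 ≤ c ∧ ∃ m, L.IsState m ∧ L.Var m n c}, 1 / (k + 1 : ℝ) ≤ c := by
    rintro c ⟨hc, m, hm, hv⟩
    have h1 := hv.BP hc hzk f
    have h2 : m f = 0 := hm.supp f fun y hy => by
      rw [hfa]; exact max_eq_left ((min_le_right _ _).trans (by linarith))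
    have h3 : m (tr z f) = 1 := by
      have : m (tr z f - BoundedContinuousFunction.const M 1) = 0 := hm.supp _ fun y hy => by
        have := L.len_mul (z * y) y⁻¹
        rw [mul_inv_cancel_right, L.len_inv] at this
        simp [hfa]
        rw [min_eq_left (by linarith)]; simp
      rw [map_sub, hm.one] at this
      linarith
    rw [h2, h3] at h1
    have h4 : (k : ℝ) * c * ‖f‖ ≤ k * c * 1 := by gcongr
    rw [div_le_iff₀ (by positivity)]
    simp at h1
    nlinarith
  exact lt_of_lt_of_le (by positivity) (le_csInf (L.tau_ne n) key)

theorem core (hch : L.Chain ⊤) {z : M} (hz : L.len z ≠ 0) : ∃ c₀ C : ℝ, 0 < c₀ ∧ 0 ≤ C ∧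
    ∀ n : ℕ, ∃ (Φ : M → ℝ) (g : M), L.len g ≤ 1 ∧ c₀ ≤ |Φ g| ∧
      (∀ k x, x ∈ L.BP ⊤ 1 k → |Φ x| ≤ 2 * k) ∧
      (∀ x κ, L.len κ = 0 → Φ (x * κ) = Φ x) ∧
      ∀ x h k η, h ∈ L.BP ⊤ 1 k → L.len h ≤ lam ^ n → 0 ≤ η →
        (∀ y, L.len y ≤ 2 → L.len (y⁻¹ * L.sc (-n) x * y) ≤ η) →
        |Φ (x * h) - Φ x - Φ h| ≤ k * C * η := by
  obtain ⟨χ, C, hC, hχb, hχ1, hχs, hχv⟩ := L.exists_chi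
  obtain ⟨m, hm⟩ := hch lam
  have hpos := L.tau_pos hch hz
  have hlam := L.lam_pos
  have htau : ∀ n, L.tau n ≤ m * L.tau (n + 1) := by
    intro n
    have hst : ∀ c ∈ {c | 0 ≤ c ∧ ∃ m, L.IsState m ∧ L.Var m (n + 1) c}, L.tau n ≤ m * c := by
      rintro c ⟨hc, s, hs, hv⟩
      refine csInf_le (L.tau_bdd n) ⟨by positivity, s, hs, fun g hg f => hv.BP hc ?_ f⟩
      have h1 : L.sc ((n + 1 : ℕ) : ℤ) g ∈ L.BP ⊤ 1 m := by
        refine hm _ trivial ?_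
        rw [len_sc]
        calc lam ^ ((n + 1 : ℕ) : ℤ) * L.len g ≤ lam ^ ((n + 1 : ℕ) : ℤ) * lam ^ (-(n : ℤ)) := by
              gcongr
          _ = lam := by rw [← zpow_add₀ hlam.ne']; push_cast; simp
      have := L.BP_sc (-((n + 1 : ℕ) : ℤ)) (H := ⊤) (fun _ _ => trivial) h1
      rwa [sc_neg_sc, mul_one] at this
    by_cases hm0 : (m : ℝ) = 0
    · obtain ⟨c, hc⟩ := L.tau_ne (n + 1)
      have := hst c hc
      rw [hm0, zero_mul] at *
      exact this
    · have hmp : (0 : ℝ) < m := lt_of_le_of_ne (by positivity) (Ne.symm hm0)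
      have : L.tau n / m ≤ L.tau (n + 1) := le_csInf (L.tau_ne _) fun c hc => by
        rw [div_le_iff₀ hmp]; linarith [hst c hc]
      rw [div_le_iff₀ hmp] at this; linarith
  have hmp : (0 : ℝ) < m := by
    have := htau 0
    have h1 := hpos 0
    have h2 := hpos (0 + 1)
    by_contra h
    nlinarith
  refine ⟨1 / (2 * m), 2 * C, by positivity, by positivity, fun n => ?_⟩
  obtain ⟨c, ⟨hc0, s, hs, hv⟩, hc2⟩ := exists_lt_of_csInf_lt (L.tau_ne n)
    (show L.tau n < 2 * L.tau n by linarith [hpos n])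
  have hv' : L.Var s n (2 * L.tau n) := fun g hg f => (hv g hg f).trans (by gcongr)
  -- smoothing operator
  let hat : (M →ᵇ ℝ) →ₗ[ℝ] (M →ᵇ ℝ) :=
    { toFun := fun f => BoundedContinuousFunction.ofNormedAddCommGroup (fun y => χ (tr y f)) (by
          rw [continuous_iff_continuousAt]
          intro y
          rw [ContinuousAt, tendsto_iff_norm_sub_tendsto_zero]
          have h1 : Tendsto (fun x => C * L.len (y⁻¹ * x) * ‖f‖) (𝓝 y) (𝓝 0) := by
            have : Continuous fun x => C * L.len (y⁻¹ * x) * ‖f‖ := by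
              have := L.len_cont; fun_prop
            simpa [L.len_one] using this.tendsto y
          refine squeeze_zero (fun _ => norm_nonneg _) (fun x => ?_) h1
          have h2 := hχv (y⁻¹ * x) (tr y f)
          rw [← tr_mul, mul_inv_cancel_left] at h2
          refine h2.trans ?_
          have := L.len_nonneg (y⁻¹ * x)
          gcongr
          exact tr_norm _ _) ‖f‖ (fun y => (hχb _).trans (tr_norm _ _))
      map_add' := fun f g => by ext y; simp [tr_add]
      map_smul' := fun c f => by ext y; simp [tr_smul] }
  have hhat : ∀ f y, hat f y = χ (tr y f) := fun f y => rfl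
  have hhatn : ∀ f, ‖hat f‖ ≤ ‖f‖ := fun f =>
    (BoundedContinuousFunction.norm_le (norm_nonneg _)).2 fun y => by
      rw [hhat]; exact (hχb _).trans (tr_norm _ _)
  have hhattr : ∀ g f, hat (tr g f) = tr g (hat f) := by
    intro g f; ext y; rw [hhat, tr_apply, hhat, tr_mul]
  let μ : (M →ᵇ ℝ) →ₗ[ℝ] ℝ := s.comp hat
  have hμ : ∀ f, μ f = s (hat f) := fun f => rfl
  have hμb : ∀ f, |μ f| ≤ ‖f‖ := fun f => (hs.bd _).trans (hhatn f)
  have hμK : ∀ k, L.len k = 0 → ∀ f, μ (tr k f) = μ f := fun k hk f => by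
    rw [hμ, hhattr, hs.inv k hk, hμ]
  have hμsupp : ∀ f : M →ᵇ ℝ, (∀ y, L.len y ≤ 2 → f y = 0) → μ f = 0 := by
    intro f hf
    refine hs.supp _ fun y hy => hχs _ fun x hx => hf _ ?_
    have := L.len_mul y x
    change L.len (y * x) ≤ 2
    linarith
  have hμ1 : μ (BoundedContinuousFunction.const M 1) = 1 := by
    refine Eq.trans ?_ hs.one; rw [hμ]; congr 1; ext y
    rw [hhat]
    have : tr y (BoundedContinuousFunction.const M (1 : ℝ)) = BoundedContinuousFunction.const M 1 := by
      ext; simp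
    rw [this, hχ1]; rfl
  have hμvar : ∀ g k f, g ∈ L.BP ⊤ (lam ^ (-(n : ℤ))) k →
      |μ (tr g f) - μ f| ≤ 2 * k * L.tau n * ‖f‖ := by
    intro g k f hg
    rw [hμ, hμ, hhattr]
    refine (hv'.BP (by linarith [hpos n]) hg (hat f)).trans ?_
    have h1 := hpos n
    calc _ ≤ k * (2 * L.tau n) * ‖f‖ := by gcongr; exact hhatn f
      _ = _ := by ring
  -- push forward by the contraction
  let pb : (M →ᵇ ℝ) →ₗ[ℝ] (M →ᵇ ℝ) :=
    { toFun := fun f => f.compContinuous ⟨fun y => L.δ⁻¹ y, L.δ_symm_cont⟩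
      map_add' := fun f g => by ext; simp
      map_smul' := fun c f => by ext; simp }
  have hpb : ∀ f y, pb f y = f (L.δ⁻¹ y) := fun f y => rfl
  have hpbn : ∀ f, ‖pb f‖ ≤ ‖f‖ := fun f =>
    (BoundedContinuousFunction.norm_le (norm_nonneg _)).2 fun y => f.norm_coe_le_norm _
  have hpbtr : ∀ g f, pb (tr g f) = tr (L.δ g) (pb f) := by
    intro g f; ext y; rw [hpb, tr_apply, tr_apply, hpb, map_mul L.δ⁻¹, MulAut.inv_apply_self]
  have hst' : L.IsState (μ.comp pb) := by
    refine ⟨fun f => (hμb _).trans (hpbn f), ?_, ?_, ?_⟩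
    · have : pb (BoundedContinuousFunction.const M 1) = BoundedContinuousFunction.const M 1 := by
        ext y; rfl
      rw [LinearMap.comp_apply, this, hμ1]
    · intro f hf
      refine hμsupp _ fun y hy => hf _ ?_
      change L.len (L.δ⁻¹ y) ≤ 1
      rw [L.len_δ_inv, inv_mul_le_iff₀ hlam]
      linarith [L.two_le]
    · intro k hk f
      rw [LinearMap.comp_apply, hpbtr, hμK _ (by rw [L.len_δ, hk, mul_zero])]; rfl
  have hnv : ¬ L.Var (μ.comp pb) (n + 1) (L.tau (n + 1) / 2) := by
    intro h
    have := csInf_le (L.tau_bdd (n + 1)) ⟨by linarith [hpos (n + 1)], _, hst', h⟩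
    change L.tau (n + 1) ≤ _ at this
    linarith [hpos (n + 1)]
  unfold Var at hnv
  push Not at hnv
  obtain ⟨g, hg, f, hgf⟩ := hnv
  rw [LinearMap.comp_apply, LinearMap.comp_apply, hpbtr] at hgf
  have hf0 : 0 < ‖f‖ := by
    by_contra h
    have : ‖f‖ = 0 := le_antisymm (not_lt.1 h) (norm_nonneg _)
    rw [norm_eq_zero] at this
    rw [this] at hgf
    have e : tr (L.δ g) (pb 0) = 0 := by ext; simp [hpb]
    rw [e] at hgf
    simp at hgf
  let F : M →ᵇ ℝ := ‖f‖⁻¹ • pb f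
  have hF : ‖F‖ ≤ 1 := by
    rw [norm_smul, norm_inv, norm_norm, inv_mul_le_iff₀ hf0, mul_one]; exact hpbn f
  have ht := hpos n
  let Φ : M → ℝ := fun x => (μ (tr (L.sc (-n) x) F) - μ F) / L.tau n
  have hΦ : ∀ x, Φ x = (μ (tr (L.sc (-n) x) F) - μ F) / L.tau n := fun x => rfl
  have hscBP : ∀ k x, x ∈ L.BP ⊤ 1 k → L.sc (-n) x ∈ L.BP ⊤ (lam ^ (-(n : ℤ))) k := by
    intro k x hx
    have := L.BP_sc (-n) (H := ⊤) (fun _ _ => trivial) hx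
    rwa [mul_one] at this
  refine ⟨Φ, L.sc n (L.δ g), ?_, ?_, ?_, ?_, ?_⟩
  · rw [len_sc, L.len_δ]
    calc lam ^ (n : ℤ) * (lam * L.len g) ≤ lam ^ (n : ℤ) * (lam * lam ^ (-((n + 1 : ℕ) : ℤ))) := by
          gcongr
      _ = 1 := by
        rw [← mul_assoc, ← zpow_add_one₀ hlam.ne', ← zpow_add₀ hlam.ne']; push_cast; simp
  · rw [hΦ, sc_neg_sc, abs_div, abs_of_pos ht, le_div_iff₀ ht, tr_smul, map_smul, map_smul,
      ← smul_sub, smul_eq_mul, abs_mul, abs_inv, abs_norm, inv_mul_eq_div, le_div_iff₀ hf0]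
    refine le_trans ?_ hgf.le
    gcongr
    rw [div_mul_eq_mul_div, div_le_div_iff₀ (by positivity) (by positivity)]
    linarith [htau n]
  · intro k x hx
    rw [hΦ, abs_div, abs_of_pos ht, div_le_iff₀ ht]
    refine (hμvar _ k F (hscBP k x hx)).trans ?_
    calc 2 * k * L.tau n * ‖F‖ ≤ 2 * k * L.tau n * 1 := by gcongr
      _ = _ := by ring
  · intro x κ hκ
    rw [hΦ, hΦ, map_mul, tr_mul, hμK]
    rw [len_sc, hκ, mul_zero]
  · intro x h k η hh hlen hη hy
    set a := L.sc (-n) x with ha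
    set b := L.sc (-n) h with hb
    have hb1 : L.len b ≤ 1 := by
      rw [hb, len_sc, zpow_neg, zpow_natCast, inv_mul_le_iff₀ (pow_pos hlam n), mul_one]
      exact hlen
    have e : Φ (x * h) - Φ x - Φ h = (s (tr b (hat (tr a F - F))) - s (hat (tr a F - F))) / L.tau n := by
      rw [← hhattr, ← hμ, ← hμ, hΦ, hΦ, hΦ, map_mul, ← ha, ← hb, tr_mul, tr_sub, map_sub, map_sub]
      ring
    set v := hat (tr a F - F) with hvdef
    have hvb : ∀ y, L.len y ≤ 2 → |v y| ≤ C * η := by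
      intro y hy2
      have h1 := hχv (y⁻¹ * a * y) (tr y F)
      rw [← tr_mul] at h1
      have h2 : y * (y⁻¹ * a * y) = a * y := by group
      rw [h2, tr_mul] at h1
      rw [hvdef, hhat, tr_sub, map_sub]
      refine h1.trans ?_
      have h3 := hy y hy2
      have h4 := L.len_nonneg (y⁻¹ * a * y)
      calc _ ≤ C * η * 1 := by gcongr; exact (tr_norm _ _).trans hF
        _ = _ := mul_one _
    obtain ⟨v', hv1, hv2⟩ := exists_clamp v (show 0 ≤ C * η by positivity)
    have e1 : s v = s v' := by
      have : s (v - v') = 0 := hs.supp _ fun y hy => by simp [hv2 y (hvb y (by linarith))]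
      rw [map_sub] at this; linarith
    have e2 : s (tr b v) = s (tr b v') := by
      have : s (tr b v - tr b v') = 0 := hs.supp _ fun y hy => by
        have hby : L.len (b * y) ≤ 2 := by linarith [L.len_mul b y]
        simp [hv2 _ (hvb _ hby)]
      rw [map_sub] at this; linarith
    rw [e, e1, e2, abs_div, abs_of_pos ht, div_le_iff₀ ht]
    refine (hv'.BP (by linarith) (hscBP k h hh) v').trans ?_
    calc k * (2 * L.tau n) * ‖v'‖ ≤ k * (2 * L.tau n) * (C * η) := by gcongr
      _ = _ := by ring
end lemA
end LenData

open Filter Topology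
set_option linter.unusedSectionVars false

theorem exists_ulim {ι X : Type*} [TopologicalSpace X] {s : Set X} (hs : IsCompact s)
    (p : Ultrafilter ι) (u : ι → X) (hu : ∀ᶠ n in (p : Filter ι), u n ∈ s) :
    ∃ x ∈ s, Tendsto u p (𝓝 x) := by
  obtain ⟨x, hx, h⟩ := hs.ultrafilter_le_nhds (p.map u) (by
    rw [Filter.le_principal_iff]; exact hu)
  exact ⟨x, hx, h⟩

theorem exists_ulim_real {ι : Type*} (p : Ultrafilter ι) (u : ι → ℝ) (B : ℝ)
    (hu : ∀ᶠ n in (p : Filter ι), |u n| ≤ B) : ∃ x, |x| ≤ B ∧ Tendsto u p (𝓝 x) := by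
  obtain ⟨x, hx, h⟩ := exists_ulim (isCompact_Icc (a := -B) (b := B)) p u
    (hu.mono fun n hn => abs_le.1 hn)
  exact ⟨x, abs_le.2 hx, h⟩

namespace LenData
section lemA
variable {M : Type*} [Group M] [TopologicalSpace M] [IsTopologicalGroup M] {lam : ℝ}
  (L : LenData M lam)

theorem lemmaA (hch : L.Chain ⊤) {z : M} (hz : L.len z ≠ 0) (p : Ultrafilter ℕ)
    (hp : (p : Filter ℕ) ≤ atTop) (N : Subgroup M)
    (N1 : ∀ h ∈ N, Tendsto (fun n : ℕ => L.sc (-n) h) p (𝓝 1))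
    (N2 : ∀ g, ∃ h ∈ N, L.len (h⁻¹ * g) = 0) :
    ∃ Φ : M → ℝ, (∀ x ∈ N, ∀ y ∈ N, Φ (x * y) = Φ x + Φ y) ∧
      (∃ B, ∀ x, L.len x ≤ 1 → |Φ x| ≤ B) ∧ ∃ w ∈ N, Φ w ≠ 0 := by
  obtain ⟨c₀, C, hc₀, hC, hcore⟩ := L.core hch hz
  choose Φ w hw1 hwc hbd hK hqa using hcore
  have hlam := L.lam_pos
  -- eventual quasi additivity
  have qa : ∀ (x h : ℕ → M) (k : ℕ) (R : ℝ), Tendsto (fun n : ℕ => L.sc (-n) (x n)) p (𝓝 1) →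
      (∀ᶠ n in (p : Filter ℕ), h n ∈ L.BP ⊤ 1 k) → (∀ᶠ n in (p : Filter ℕ), L.len (h n) ≤ R) →
      Tendsto (fun n => Φ n (x n * h n) - Φ n (x n) - Φ n (h n)) p (𝓝 0) := by
    intro x h k R hx hh hR
    rw [Metric.tendsto_nhds]
    intro ε hε
    obtain ⟨U, hU, hconj⟩ := L.conj_small (r := 2) (η := ε / (k * C + 1)) (by positivity)
    have hRn : ∀ᶠ n : ℕ in (p : Filter ℕ), R ≤ lam ^ n :=
      hp ((tendsto_pow_atTop_atTop_of_one_lt (by linarith [L.two_le])).eventually_ge_atTop R)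
    filter_upwards [hx hU, hh, hR, hRn] with n h1 h2 h3 h4
    have := hqa n (x n) (h n) k (ε / (k * C + 1)) h2 (h3.trans h4) (by positivity)
      (fun y hy => (hconj _ h1 y hy).le)
    rw [Real.dist_eq, sub_zero]
    refine lt_of_le_of_lt this ?_
    rw [mul_div_assoc', div_lt_iff₀ (by positivity)]
    nlinarith
  have hbd1 : ∀ n x, L.len x ≤ 1 → |Φ n x| ≤ 2 := fun n x hx => by
    simpa using hbd n 1 x (L.BP_single trivial hx)
  -- the limit function
  have hlim : ∀ x, ∃ y, Tendsto (fun n => Φ n x) p (𝓝 y) := by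
    intro x
    obtain ⟨k, hk⟩ := hch (L.len x)
    obtain ⟨y, _, hy⟩ := exists_ulim_real p (fun n => Φ n x) (2 * k)
      (Eventually.of_forall fun n => hbd n k x (hk x trivial le_rfl))
    exact ⟨y, hy⟩
  choose Ψ hΨ using hlim
  refine ⟨Ψ, ?_, ⟨2, fun x hx => ?_⟩, ?_⟩
  · intro x hx y _
    obtain ⟨k, hk⟩ := hch (L.len y)
    have h1 := qa (fun _ => x) (fun _ => y) k (L.len y) (N1 x hx)
      (Eventually.of_forall fun _ => hk y trivial le_rfl) (Eventually.of_forall fun _ => le_rfl)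
    have h2 := ((hΨ (x * y)).sub (hΨ x)).sub (hΨ y)
    have := tendsto_nhds_unique h1 h2
    linarith
  · have := (hΨ x).abs
    exact le_of_tendsto this (Eventually.of_forall fun n => hbd1 n x hx)
  · -- non vanishing
    obtain ⟨κ, hκc, hκ⟩ := exists_ulim (L.len_proper 1) p (fun n : ℕ => L.sc (-n) (w n))
      (Eventually.of_forall fun n => by
        change L.len _ ≤ 1
        rw [len_sc, zpow_neg, zpow_natCast, inv_mul_le_iff₀ (pow_pos hlam n), mul_one]
        exact (hw1 n).trans (one_le_pow₀ (by linarith [L.two_le])))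
    have hκ0 : L.len κ = 0 := by
      have h1 : Tendsto (fun n : ℕ => L.len (L.sc (-n) (w n))) p (𝓝 (L.len κ)) :=
        (L.len_cont.tendsto κ).comp hκ
      refine le_antisymm ?_ (L.len_nonneg κ)
      refine le_of_tendsto_of_tendsto h1 (L.lam_zpow_tendsto.mono_left hp)
        (Eventually.of_forall fun n => ?_)
      change L.len (L.sc (-n) (w n)) ≤ lam ^ (-(n : ℤ))
      rw [len_sc]
      exact mul_le_of_le_one_right (zpow_nonneg hlam.le _) (hw1 n)
    let w₁ : ℕ → M := fun n => w n * L.sc n κ⁻¹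
    have hκs : ∀ k : ℤ, L.len (L.sc k κ⁻¹) = 0 := fun k => by
      rw [len_sc, L.len_inv, hκ0, mul_zero]
    have hw₁ : ∀ n, L.len (w₁ n) ≤ 1 := fun n => by
      have := L.len_mul (w n) (L.sc n κ⁻¹)
      rw [hκs] at this
      linarith [hw1 n]
    have hΦw₁ : ∀ n, Φ n (w₁ n) = Φ n (w n) := fun n => hK n _ _ (hκs n)
    have hw₁t : Tendsto (fun n : ℕ => L.sc (-n) (w₁ n)) p (𝓝 1) := by
      have : (fun n : ℕ => L.sc (-n) (w₁ n)) = fun n : ℕ => L.sc (-n) (w n) * κ⁻¹ := by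
        funext n; simp only [w₁]; rw [map_mul, sc_neg_sc]
      rw [this]
      simpa using hκ.mul_const κ⁻¹
    obtain ⟨v, _, hv⟩ := exists_ulim (L.len_proper 1) p w₁ (Eventually.of_forall hw₁)
    obtain ⟨v', hv'N, hv'⟩ := N2 v
    let u : ℕ → M := fun n => v'⁻¹ * w₁ n
    have hulen : Tendsto (fun n => L.len (u n)) p (𝓝 0) := by
      rw [← hv']
      exact (L.len_cont.tendsto _).comp (hv.const_mul v'⁻¹)
    have hut : Tendsto (fun n : ℕ => L.sc (-n) (u n)) p (𝓝 1) := by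
      have : (fun n : ℕ => L.sc (-n) (u n)) =
          fun n : ℕ => (L.sc (-n) v')⁻¹ * L.sc (-n) (w₁ n) := by
        funext n; simp only [u]; rw [map_mul, map_inv]
      rw [this]
      simpa using (N1 v' hv'N).inv.mul hw₁t
    have husmall : ∀ a : ℕ, ∀ᶠ n in (p : Filter ℕ), L.len (u n ^ a) ≤ 1 := by
      intro a
      have : ∀ᶠ n in (p : Filter ℕ), L.len (u n) < 1 / (a + 1) :=
        hulen.eventually_lt_const (by positivity)
      filter_upwards [this] with n hn
      rw [lt_div_iff₀ (by positivity)] at hn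
      have := L.len_pow_le (u n) a
      nlinarith [L.len_nonneg (u n)]
    have hpow : ∀ a : ℕ, Tendsto (fun n => Φ n (u n ^ (a + 1)) - (a + 1) * Φ n (u n)) p (𝓝 0) := by
      intro a
      induction a with
      | zero => simp
      | succ a ih =>
        have h1 := qa u (fun n => u n ^ (a + 1)) 1 1 hut
          ((husmall (a + 1)).mono fun n hn => L.BP_single trivial hn) (husmall (a + 1))
        have h2 := h1.add ih
        rw [add_zero] at h2
        refine h2.congr fun n => ?_
        rw [← pow_succ']
        push_cast; ring
    have hΦu : Tendsto (fun n => Φ n (u n)) p (𝓝 0) := by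
      rw [Metric.tendsto_nhds]
      intro ε hε
      obtain ⟨a, ha⟩ := exists_nat_gt (3 / ε)
      have h1 := (hpow a).eventually (Metric.ball_mem_nhds 0 one_pos)
      filter_upwards [h1, husmall (a + 1)] with n h1 h2
      rw [Real.dist_eq, sub_zero] at h1
      have h3 := hbd1 n _ h2
      rw [Real.dist_eq, sub_zero]
      have h4 : |((a : ℝ) + 1) * Φ n (u n)| < 3 := by
        rw [abs_lt] at h1 ⊢
        rw [abs_le] at h3
        constructor <;> linarith
      rw [abs_mul, abs_of_nonneg (by positivity)] at h4
      rw [div_lt_iff₀ hε] at ha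
      by_contra hcon
      push Not at hcon
      nlinarith [abs_nonneg (Φ n (u n))]
    have h1 := qa (fun _ => v') u 1 1 (N1 v' hv'N)
      ((husmall 1).mono fun n hn => L.BP_single trivial (by simpa using hn))
      ((husmall 1).mono fun n hn => by simpa using hn)
    have h2 : Tendsto (fun n => Φ n (w₁ n)) p (𝓝 (Ψ v')) := by
      have h3 := (h1.add (hΨ v')).add hΦu
      rw [zero_add, add_zero] at h3
      refine h3.congr fun n => ?_
      have : v' * u n = w₁ n := by simp [u]
      rw [this]; ring
    refine ⟨v', hv'N, fun h0 => ?_⟩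
    have h3 : c₀ ≤ |Ψ v'| :=
      ge_of_tendsto h2.abs (Eventually.of_forall fun n => by rw [hΦw₁]; exact hwc n)
    rw [h0, abs_zero] at h3
    linarith
end lemA
end LenData

open Filter Topology
set_option linter.unusedSectionVars false

namespace LenData
section sub
variable {M : Type*} [Group M] [TopologicalSpace M] {lam : ℝ} (L : LenData M lam)

/-- invariance of a subgroup under all powers of the dilation -/
def Inv (D : Subgroup M) : Prop := ∀ k : ℤ, ∀ x ∈ D, L.sc k x ∈ D

/-- restricted dilation -/
def subδ (D : Subgroup M) (hD : L.Inv D) : MulAut D where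
  toFun := fun x => ⟨L.δ x, by simpa [sc_one] using hD 1 x x.2⟩
  invFun := fun x => ⟨L.δ⁻¹ x, by simpa [sc_neg_one] using hD (-1) x x.2⟩
  left_inv := fun x => by ext; simp
  right_inv := fun x => by ext; simp
  map_mul' := fun x y => by ext; simp

/-- restriction to a closed invariant subgroup -/
def sub (D : Subgroup M) (hD : L.Inv D) (hc : IsClosed (D : Set M)) : LenData D lam where
  two_le := L.two_le
  len x := L.len x
  δ := L.subδ D hD
  len_one := L.len_one
  len_inv x := L.len_inv x
  len_mul x y := L.len_mul x y
  len_cont := L.len_cont.comp continuous_subtype_val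
  len_proper r := by
    have := hc.isClosedEmbedding_subtypeVal.isCompact_preimage (L.len_proper r)
    exact this
  δ_cont := Continuous.subtype_mk (L.δ_cont.comp continuous_subtype_val) _
  δ_symm_cont := Continuous.subtype_mk (L.δ_symm_cont.comp continuous_subtype_val) _
  len_δ x := L.len_δ x

variable {L} {D : Subgroup M} (hD : L.Inv D) (hc : IsClosed (D : Set M))

@[simp] theorem sub_len (x : D) : (L.sub D hD hc).len x = L.len x := rfl

theorem sub_sc (k : ℤ) (x : D) : ((L.sub D hD hc).sc k x : M) = L.sc k x := by
  induction k using Int.induction_on with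
  | zero => simp [sc_zero]
  | succ n ih =>
    rw [add_comm, sc_add, sc_add, sc_one, sc_one, ← ih]; rfl
  | pred n ih =>
    rw [sub_eq_add_neg, add_comm, sc_add, sc_add, sc_neg_one, sc_neg_one, ← ih]; rfl

theorem sub_BP {r : ℝ} {n : ℕ} {x : D} (h : (x : M) ∈ L.BP D r n) :
    x ∈ (L.sub D hD hc).BP ⊤ r n := by
  induction n generalizing x with
  | zero =>
    simp only [BP, Set.mem_singleton_iff] at h ⊢; exact Subtype.ext h
  | succ n ih =>
    obtain ⟨y, hy, g, hg, hgr, e⟩ := h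
    refine ⟨⟨y, L.BP_mem hy⟩, ih hy, ⟨g, hg⟩, trivial, hgr, Subtype.ext e⟩

theorem BP_sub {r : ℝ} {n : ℕ} {x : D} (h : x ∈ (L.sub D hD hc).BP ⊤ r n) :
    (x : M) ∈ L.BP D r n := by
  induction n generalizing x with
  | zero =>
    simp only [BP, Set.mem_singleton_iff] at h ⊢; simp [h]
  | succ n ih =>
    obtain ⟨y, hy, g, hg, hgr, rfl⟩ := h
    exact ⟨y, ih hy, g, g.2, hgr, rfl⟩

theorem sub_chain (h : L.Chain D) : (L.sub D hD hc).Chain ⊤ := by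
  intro R
  obtain ⟨n, hn⟩ := h R
  exact ⟨n, fun x _ hx => sub_BP hD hc (hn x x.2 hx)⟩

theorem chain_sub (h : (L.sub D hD hc).Chain ⊤) : L.Chain D := by
  intro R
  obtain ⟨n, hn⟩ := h R
  exact ⟨n, fun x hx hl => BP_sub hD hc (x := ⟨x, hx⟩) (hn _ trivial hl)⟩
end sub

section homs
variable {M : Type*} [Group M] [TopologicalSpace M] [IsTopologicalGroup M] {lam : ℝ}
  (L : LenData M lam)

/-- bounded additive functions on `H` -/
def W0 (H : Subgroup M) : Submodule ℝ (M → ℝ) where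
  carrier := {l | (∀ x ∈ H, ∀ y ∈ H, l (x * y) = l x + l y) ∧
    (∃ B, ∀ x ∈ H, L.len x ≤ 1 → |l x| ≤ B) ∧ ∀ x, x ∉ H → l x = 0}
  add_mem' := by
    rintro a b ⟨ha, ⟨A, hA⟩, ha0⟩ ⟨hb, ⟨B, hB⟩, hb0⟩
    refine ⟨fun x hx y hy => ?_, ⟨A + B, fun x hx h => ?_⟩, fun x hx => ?_⟩
    · simp only [Pi.add_apply, ha x hx y hy, hb x hx y hy]; ring
    · exact (abs_add_le _ _).trans (add_le_add (hA x hx h) (hB x hx h))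
    · simp [ha0 x hx, hb0 x hx]
  zero_mem' := ⟨by simp, ⟨0, by simp⟩, by simp⟩
  smul_mem' := by
    rintro c a ⟨ha, ⟨A, hA⟩, ha0⟩
    refine ⟨fun x hx y hy => ?_, ⟨|c| * A, fun x hx h => ?_⟩, fun x hx => ?_⟩
    · simp only [Pi.smul_apply, smul_eq_mul, ha x hx y hy]; ring
    · simp only [Pi.smul_apply, smul_eq_mul, abs_mul]
      exact mul_le_mul_of_nonneg_left (hA x hx h) (abs_nonneg _)
    · simp [ha0 x hx]

variable {L} {H : Subgroup M} {l : M → ℝ}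

theorem W0_mul (hl : l ∈ L.W0 H) {x y : M} (hx : x ∈ H) (hy : y ∈ H) : l (x * y) = l x + l y :=
  hl.1 x hx y hy
theorem W0_out (hl : l ∈ L.W0 H) {x : M} (hx : x ∉ H) : l x = 0 := hl.2.2 x hx
theorem W0_one (hl : l ∈ L.W0 H) : l 1 = 0 := by
  have := W0_mul hl H.one_mem H.one_mem
  rw [mul_one] at this; linarith
theorem W0_inv (hl : l ∈ L.W0 H) {x : M} (hx : x ∈ H) : l x⁻¹ = - l x := by
  have := W0_mul hl hx (H.inv_mem hx)
  rw [mul_inv_cancel, W0_one hl] at this; linarith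
theorem W0_pow (hl : l ∈ L.W0 H) {x : M} (hx : x ∈ H) (n : ℕ) : l (x ^ n) = n * l x := by
  induction n with
  | zero => simp [W0_one hl]
  | succ n ih => rw [pow_succ, W0_mul hl (H.pow_mem hx n) hx, ih]; push_cast; ring
theorem W0_BP (hl : l ∈ L.W0 H) {r B : ℝ} (hB : ∀ x ∈ H, L.len x ≤ r → |l x| ≤ B) {n : ℕ}
    {x : M} (hx : x ∈ L.BP H r n) : |l x| ≤ n * B := by
  induction n generalizing x with
  | zero => rw [BP, Set.mem_singleton_iff] at hx; simp [hx, W0_one hl]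
  | succ n ih =>
    obtain ⟨y, hy, g, hg, hgr, rfl⟩ := hx
    rw [W0_mul hl (L.BP_mem hy) hg]
    have := abs_add_le (l y) (l g)
    have := ih hy
    have := hB g hg hgr
    push_cast; linarith

theorem W0_lip (hl : l ∈ L.W0 H) {r B : ℝ} (hr : 0 < r)
    (hB : ∀ x ∈ H, L.len x ≤ r → |l x| ≤ B) {x : M} (hx : x ∈ H)
    (hxr : L.len x ≤ r) : |l x| ≤ 2 * B * (L.len x / r) := by
  have hB0 : 0 ≤ B := (abs_nonneg _).trans (hB 1 H.one_mem (by rw [L.len_one]; exact hr.le))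
  have key : ∀ a : ℕ, a * L.len x ≤ r → a * |l x| ≤ B := by
    intro a ha
    have := hB (x ^ a) (H.pow_mem hx a) ((L.len_pow_le x a).trans ha)
    rwa [W0_pow hl hx, abs_mul, abs_of_nonneg (by positivity)] at this
  rcases (L.len_nonneg x).eq_or_lt with h0 | h0
  · rw [← h0, zero_div, mul_zero]
    by_contra hcon
    push Not at hcon
    obtain ⟨a, ha⟩ := exists_nat_gt (B / |l x|)
    rw [div_lt_iff₀ hcon] at ha
    have := key a (by rw [← h0, mul_zero]; exact hr.le)
    linarith
  · set q := r / L.len x with hq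
    have hq1 : 1 ≤ q := by rw [hq, le_div_iff₀ h0]; linarith
    have h1 : (⌊q⌋₊ : ℝ) ≤ q := Nat.floor_le (by linarith)
    have h2 : q < ⌊q⌋₊ + 1 := Nat.lt_floor_add_one q
    have h3 : (1 : ℝ) ≤ ⌊q⌋₊ := by exact_mod_cast Nat.le_floor (by simpa using hq1)
    have h4 := key ⌊q⌋₊ (by
      calc (⌊q⌋₊ : ℝ) * L.len x ≤ q * L.len x := by gcongr
        _ = r := by rw [hq]; field_simp)
    have h5 : L.len x / r = 1 / q := by rw [hq]; field_simp
    rw [h5, mul_one_div, le_div_iff₀ (by linarith)]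
    nlinarith [abs_nonneg (l x)]

theorem W0_bdd (hch : L.Chain H) (hl : l ∈ L.W0 H) (R : ℝ) :
    ∃ B, 0 ≤ B ∧ ∀ x ∈ H, L.len x ≤ R → |l x| ≤ B := by
  obtain ⟨B, hB⟩ := hl.2.1
  obtain ⟨n, hn⟩ := hch R
  have hB0 : 0 ≤ B := (abs_nonneg _).trans (hB 1 H.one_mem (by rw [L.len_one]; norm_num))
  exact ⟨n * B, by positivity, fun x hx hxr => W0_BP hl hB (hn x hx hxr)⟩

/-- values converge -/
theorem W0_tendsto {ι : Type*} {F : Filter ι} (hl : l ∈ L.W0 H) {u : ι → M} {x : M} (hx : x ∈ H)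
    (hu : ∀ᶠ i in F, u i ∈ H)
    (ht : Tendsto (fun i => L.len (x⁻¹ * u i)) F (𝓝 0)) : Tendsto (fun i => l (u i)) F (𝓝 (l x)) := by
  obtain ⟨B, hB⟩ := hl.2.1
  rw [tendsto_iff_norm_sub_tendsto_zero]
  have h1 : Tendsto (fun i => 2 * B * (L.len (x⁻¹ * u i) / 1)) F (𝓝 0) := by
    simpa using ht.const_mul (2 * B)
  refine squeeze_zero' (Eventually.of_forall fun _ => norm_nonneg _) ?_ h1
  filter_upwards [hu, ht.eventually_le_const one_pos] with i hi hi1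
  have h2 : l (u i) - l x = l (x⁻¹ * u i) := by
    rw [W0_mul hl (H.inv_mem hx) hi, W0_inv hl hx]; ring
  rw [h2]
  exact W0_lip hl one_pos hB (H.mul_mem (H.inv_mem hx) hi) hi1

theorem W0_tendsto' {ι : Type*} {F : Filter ι} (hl : l ∈ L.W0 H) {u : ι → M} {x : M} (hx : x ∈ H)
    (hu : ∀ᶠ i in F, u i ∈ H) (ht : Tendsto u F (𝓝 x)) :
    Tendsto (fun i => l (u i)) F (𝓝 (l x)) := by
  refine W0_tendsto hl hx hu ?_
  have h : Continuous fun y => L.len (x⁻¹ * y) := L.len_cont.comp (by fun_prop)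
  have := (h.tendsto x).comp ht
  simpa [L.len_one, Function.comp_def] using this

theorem W0_contOn (hl : l ∈ L.W0 H) : ContinuousOn l H := by
  intro x hx
  exact W0_tendsto' hl hx (eventually_mem_nhdsWithin) (tendsto_nhdsWithin_of_tendsto_nhds tendsto_id)

theorem exists_net (H : Subgroup M) : ∃ F : Finset M, (∀ f ∈ F, f ∈ H) ∧
    ∀ x ∈ H, L.len x ≤ 1 → ∃ f ∈ F, L.len (f⁻¹ * x) ≤ 1 / 4 := by
  classical
  obtain ⟨t, _, ht⟩ := (L.len_proper 1).elim_nhds_subcover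
    (fun y => {x | L.len (y⁻¹ * x) < 1 / 8}) (fun y _ => by
      refine IsOpen.mem_nhds (isOpen_lt (L.len_cont.comp (by fun_prop)) continuous_const) ?_
      simp [L.len_one])
  let c : M → M := fun y => if h : ∃ x ∈ H, L.len (y⁻¹ * x) < 1 / 8 then h.choose else 1
  refine ⟨t.image c, ?_, ?_⟩
  · intro f hf
    obtain ⟨y, _, rfl⟩ := Finset.mem_image.1 hf
    by_cases h : ∃ x ∈ H, L.len (y⁻¹ * x) < 1 / 8
    · simp only [c, dif_pos h]; exact h.choose_spec.1
    · simp only [c, dif_neg h]; exact H.one_mem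
  · intro x hx hx1
    obtain ⟨y, hy, hxy⟩ := Set.mem_iUnion₂.1 (ht hx1)
    refine ⟨c y, Finset.mem_image_of_mem c hy, ?_⟩
    have h : ∃ x ∈ H, L.len (y⁻¹ * x) < 1 / 8 := ⟨x, hx, hxy⟩
    have h1 : L.len (y⁻¹ * c y) < 1 / 8 := by
      simp only [c, dif_pos h]; exact h.choose_spec.2
    have e : (c y)⁻¹ * x = (y⁻¹ * c y)⁻¹ * (y⁻¹ * x) := by group
    rw [e]
    have := L.len_mul (y⁻¹ * c y)⁻¹ (y⁻¹ * x)
    rw [L.len_inv] at this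
    have h3 : L.len (y⁻¹ * x) < 1 / 8 := hxy
    linarith

theorem W0_eq_zero_of_unit (hch : L.Chain H) (hl : l ∈ L.W0 H)
    (h : ∀ x ∈ H, L.len x ≤ 1 → l x = 0) : l = 0 := by
  funext x
  by_cases hx : x ∈ H
  · obtain ⟨n, hn⟩ := hch (L.len x)
    have := W0_BP hl (B := 0) (fun y hy h1 => by rw [h y hy h1, abs_zero]) (hn x hx le_rfl)
    rw [mul_zero] at this
    exact abs_nonpos_iff.1 this
  · exact W0_out hl hx

theorem W0_finite (hch : L.Chain H) : FiniteDimensional ℝ (L.W0 H) := by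
  obtain ⟨F, hFH, hF⟩ := L.exists_net H
  let ev : L.W0 H →ₗ[ℝ] (F → ℝ) :=
    { toFun := fun l f => (l : M → ℝ) f
      map_add' := fun _ _ => rfl
      map_smul' := fun _ _ => rfl }
  refine FiniteDimensional.of_injective ev ?_
  rw [← LinearMap.ker_eq_bot, LinearMap.ker_eq_bot']
  rintro ⟨l, hl⟩ h0
  have h0' : ∀ f ∈ F, l f = 0 := fun f hf => congrFun h0 ⟨f, hf⟩
  obtain ⟨B, hB⟩ := hl.2.1
  have key : ∀ n : ℕ, ∀ x ∈ H, L.len x ≤ 1 → |l x| ≤ B * (1 / 2) ^ n := by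
    intro n
    induction n with
    | zero => simpa using hB
    | succ n ih =>
      intro x hx hx1
      obtain ⟨f, hf, hfx⟩ := hF x hx hx1
      have hfx' := H.mul_mem (H.inv_mem (hFH f hf)) hx
      have e : l x = l (f⁻¹ * x) := by
        rw [W0_mul hl (H.inv_mem (hFH f hf)) hx, W0_inv hl (hFH f hf), h0' f hf]; simp
      have := W0_lip hl one_pos ih hfx' (by linarith)
      have hB0 : 0 ≤ B * (1 / 2) ^ n := (abs_nonneg _).trans (ih x hx hx1)
      rw [e, pow_succ]
      nlinarith
  have : l = 0 := W0_eq_zero_of_unit hch hl fun x hx hx1 => by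
    have h1 : Tendsto (fun n : ℕ => B * (1 / 2 : ℝ) ^ n) atTop (𝓝 (B * 0)) :=
      (tendsto_pow_atTop_nhds_zero_of_lt_one (by norm_num) (by norm_num)).const_mul B
    rw [mul_zero] at h1
    exact abs_nonpos_iff.1 (ge_of_tendsto h1 (Eventually.of_forall fun n => key n x hx hx1))
  exact Subtype.ext this

end homs
end LenData

open Filter Topology
set_option linter.unusedSectionVars false

namespace LenData
section strick
variable {M : Type*} [Group M] [TopologicalSpace M] [IsTopologicalGroup M] {lam : ℝ}
  {L : LenData M lam} {H : Subgroup M} {l l' : M → ℝ}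

variable (L H) in
noncomputable def nn (l : M → ℝ) (n : ℕ) : ℝ :=
  sSup ((fun x => |l x|) '' {x | x ∈ H ∧ L.len x ≤ lam ^ n})

theorem le_nn (hch : L.Chain H) (hl : l ∈ L.W0 H) {n : ℕ} {x : M} (hx : x ∈ H)
    (hxn : L.len x ≤ lam ^ n) : |l x| ≤ L.nn H l n := by
  obtain ⟨B, _, hB⟩ := W0_bdd hch hl (lam ^ n)
  refine le_csSup ⟨B, ?_⟩ ⟨x, ⟨hx, hxn⟩, rfl⟩
  rintro _ ⟨y, ⟨hy, hyn⟩, rfl⟩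
  exact hB y hy hyn

theorem nn_le {n : ℕ} {B : ℝ} (h : ∀ x ∈ H, L.len x ≤ lam ^ n → |l x| ≤ B) : L.nn H l n ≤ B := by
  refine csSup_le ⟨_, 1, ⟨H.one_mem, ?_⟩, rfl⟩ ?_
  · rw [L.len_one]; exact pow_nonneg L.lam_pos.le n
  · rintro _ ⟨y, ⟨hy, hyn⟩, rfl⟩
    exact h y hy hyn

theorem nn_nonneg (hch : L.Chain H) (hl : l ∈ L.W0 H) (n : ℕ) : 0 ≤ L.nn H l n :=
  (abs_nonneg _).trans (le_nn hch hl H.one_mem (by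
    rw [L.len_one]; exact pow_nonneg L.lam_pos.le n))

theorem nn_pos (hch : L.Chain H) (hl : l ∈ L.W0 H) (h0 : l ≠ 0) (n : ℕ) : 0 < L.nn H l n := by
  by_contra hcon
  apply h0
  refine W0_eq_zero_of_unit hch hl fun x hx hx1 => ?_
  have := le_nn hch hl (n := n) hx (hx1.trans (one_le_pow₀ (by linarith [L.two_le])))
  exact abs_nonpos_iff.1 (this.trans (not_lt.1 hcon))

/-- functions growing more slowly than `l` along `p` -/
def Sm (hch : L.Chain H) (p : Ultrafilter ℕ) (hl : l ∈ L.W0 H) : Submodule ℝ (L.W0 H) where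
  carrier := {a | ∀ ε > 0, ∀ᶠ n in (p : Filter ℕ), L.nn H (a : M → ℝ) n ≤ ε * L.nn H l n}
  zero_mem' := by
    intro ε hε
    refine Eventually.of_forall fun n => ?_
    refine (nn_le (B := 0) (by simp)).trans ?_
    have := nn_nonneg hch hl n
    positivity
  add_mem' := by
    rintro ⟨a, ha⟩ ⟨b, hb⟩ h1 h2 ε hε
    filter_upwards [h1 (ε / 2) (by positivity), h2 (ε / 2) (by positivity)] with n h3 h4
    refine nn_le fun x hx hxn => ?_
    have h5 := le_nn hch ha hx hxn
    have h6 := le_nn hch hb hx hxn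
    have h7 := abs_add_le (a x) (b x)
    change |a x + b x| ≤ _
    linarith
  smul_mem' := by
    rintro c ⟨a, ha⟩ h1 ε hε
    filter_upwards [h1 (ε / (|c| + 1)) (by positivity)] with n h3
    refine nn_le fun x hx hxn => ?_
    have h5 := le_nn hch ha hx hxn
    change |c * a x| ≤ _
    rw [abs_mul]
    have h6 := nn_nonneg hch hl n
    have h7 : |c| * |a x| ≤ (|c| + 1) * (ε / (|c| + 1) * L.nn H l n) := by
      have := abs_nonneg c
      gcongr
      · linarith
      · linarith
    refine h7.trans (le_of_eq ?_)
    field_simp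

theorem exists_Sm_bot (hch : L.Chain H) (p : Ultrafilter ℕ) (h0 : ∃ l ∈ L.W0 H, l ≠ 0) :
    ∃ (l : M → ℝ) (hl : l ∈ L.W0 H), l ≠ 0 ∧ Sm hch p hl = ⊥ := by
  haveI := W0_finite hch
  let S : Set ℕ := {d | ∃ (l : M → ℝ) (hl : l ∈ L.W0 H), l ≠ 0 ∧ d = Module.finrank ℝ (Sm hch p hl)}
  have hS : S.Nonempty := by
    obtain ⟨l, hl, h⟩ := h0
    exact ⟨_, l, hl, h, rfl⟩
  obtain ⟨l, hl, hl0, hd⟩ := Nat.sInf_mem hS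
  refine ⟨l, hl, hl0, ?_⟩
  by_contra hbot
  obtain ⟨⟨a, ha⟩, haS, ha0⟩ := Submodule.exists_mem_ne_zero_of_ne_bot hbot
  have ha0' : a ≠ 0 := fun h => ha0 (Subtype.ext h)
  have hlt : Sm hch p ha < Sm hch p hl := by
    refine lt_of_le_of_ne ?_ ?_
    · intro b hb ε hε
      filter_upwards [hb ε hε, haS 1 one_pos] with n h1 h2
      refine h1.trans ?_
      gcongr
      linarith
    · intro heq
      have h1 : (⟨a, ha⟩ : L.W0 H) ∈ Sm hch p ha := heq ▸ haS
      obtain ⟨n, hn⟩ := (h1 (1 / 2) (by norm_num)).exists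
      have := nn_pos hch ha ha0' n
      simp only at hn
      linarith
  have h1 := Submodule.finrank_lt_finrank_of_lt hlt
  have h2 : sInf S ≤ Module.finrank ℝ (Sm hch p ha) := Nat.sInf_le ⟨a, ha, ha0', rfl⟩
  omega

open Classical in
theorem exists_inv (hch : L.Chain H) (p : Ultrafilter ℕ) (h0 : ∃ l ∈ L.W0 H, l ≠ 0) :
    ∃ l ∈ L.W0 H, l ≠ 0 ∧ ∀ h : M, (∀ x ∈ H, h * x * h⁻¹ ∈ H) →
      Tendsto (fun n : ℕ => L.sc (-n) h) p (𝓝 1) → ∀ x ∈ H, l (h * x * h⁻¹) = l x := by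
  obtain ⟨l, hl, hl0, hbot⟩ := exists_Sm_bot hch p h0
  refine ⟨l, hl, hl0, fun h hn ht x hx => ?_⟩
  let a : M → ℝ := fun x => if x ∈ H then l (h * x * h⁻¹) - l x else 0
  have haH : ∀ x ∈ H, a x = l (h * x * h⁻¹) - l x := fun x hx => if_pos hx
  have ha : a ∈ L.W0 H := by
    refine ⟨fun x hx y hy => ?_, ?_, fun x hx => if_neg hx⟩
    · rw [haH _ (H.mul_mem hx hy), haH x hx, haH y hy, W0_mul hl hx hy]
      have : h * (x * y) * h⁻¹ = (h * x * h⁻¹) * (h * y * h⁻¹) := by group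
      rw [this, W0_mul hl (hn x hx) (hn y hy)]; ring
    · obtain ⟨B, hB0, hB⟩ := W0_bdd hch hl (1 + 2 * L.len h)
      refine ⟨B + B, fun x hx hx1 => ?_⟩
      rw [haH x hx]
      refine (abs_sub _ _).trans (add_le_add (hB _ (hn x hx) ?_) (hB x hx ?_))
      · have := L.len_conj_le h x; linarith
      · linarith [L.len_nonneg h]
  have haS : (⟨a, ha⟩ : L.W0 H) ∈ Sm hch p hl := by
    intro ε hε
    obtain ⟨U, hU, hc⟩ := L.conj_small (r := 1) (η := min (ε / 4) (1 / 2)) (by positivity)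
    have hη1 : min (ε / 4) (1 / 2) ≤ ε / 4 := min_le_left _ _
    have hη2 : min (ε / 4) (1 / 2) ≤ 1 / 2 := min_le_right _ _
    set η := min (ε / 4) (1 / 2)
    have hU' : U⁻¹ ∈ 𝓝 (1 : M) := inv_mem_nhds_one M hU
    filter_upwards [ht hU, ht hU'] with n h1 h2
    refine nn_le fun x hx hxn => ?_
    have hlp : 0 < lam ^ n := pow_pos L.lam_pos n
    rw [haH x hx]
    have hmem : h * x * h⁻¹ * x⁻¹ ∈ H := H.mul_mem (hn x hx) (H.inv_mem hx)
    have e : l (h * x * h⁻¹) - l x = l (h * x * h⁻¹ * x⁻¹) := by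
      rw [W0_mul hl (hn x hx) (H.inv_mem hx), W0_inv hl hx]; ring
    set b := L.sc (-n) h with hb
    set y := L.sc (-n) x with hy
    have hyl : L.len y⁻¹ ≤ 1 := by
      rw [L.len_inv, hy, len_sc, zpow_neg, zpow_natCast, inv_mul_le_iff₀ hlp, mul_one]; exact hxn
    have e2 : h * x * h⁻¹ * x⁻¹ = L.sc n (b * (y * b⁻¹ * y⁻¹)) := by
      simp only [map_mul, map_inv, hb, hy, sc_sc_neg]; group
    have h3 : L.len b ≤ η := by
      have := hc b h1 1 (by rw [L.len_one]; norm_num)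
      simpa using this.le
    have h4 : L.len (y * b⁻¹ * y⁻¹) ≤ η := by
      have := hc b⁻¹ h2 y⁻¹ hyl
      rw [inv_inv] at this; exact this.le
    have h5 : L.len (h * x * h⁻¹ * x⁻¹) ≤ lam ^ n * (2 * η) := by
      rw [e2, len_sc, zpow_natCast]
      have := L.len_mul b (y * b⁻¹ * y⁻¹)
      gcongr; linarith
    have h6 := W0_lip hl hlp (fun x hx hxn => le_nn hch hl hx hxn) hmem
      (by nlinarith)
    rw [e]
    refine h6.trans ?_
    have h7 : L.len (h * x * h⁻¹ * x⁻¹) / lam ^ n ≤ 2 * η := by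
      rw [div_le_iff₀ hlp]; linarith
    have h8 := nn_nonneg hch hl n
    nlinarith
  rw [hbot, Submodule.mem_bot] at haS
  have : a x = 0 := congrFun (congrArg Subtype.val haS) x
  rw [haH x hx] at this
  linarith

theorem chain_of_N2 {D : Subgroup M} (hHD : H ≤ D) (hD : L.Chain D)
    (N2 : ∀ g ∈ D, ∃ h ∈ H, L.len (h⁻¹ * g) = 0) : L.Chain H := by
  have key : ∀ n x, x ∈ L.BP D 1 n → ∃ h ∈ L.BP H 1 n, L.len (h⁻¹ * x) = 0 := by
    intro n
    induction n with
    | zero =>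
      intro x hx
      rw [BP, Set.mem_singleton_iff] at hx
      exact ⟨1, rfl, by simp [hx, L.len_one]⟩
    | succ n ih =>
      rintro _ ⟨y, hy, g, hg, hg1, rfl⟩
      obtain ⟨h, hh, hh0⟩ := ih y hy
      obtain ⟨k, hk, hk0⟩ := N2 (y * g) (D.mul_mem (L.BP_mem hy) hg)
      refine ⟨k, ⟨h, hh, h⁻¹ * k, H.mul_mem (H.inv_mem (L.BP_mem hh)) hk, ?_, by group⟩, hk0⟩
      have e : h⁻¹ * k = (h⁻¹ * y) * g * (k⁻¹ * (y * g))⁻¹ := by group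
      rw [e]
      have h1 := L.len_mul ((h⁻¹ * y) * g) (k⁻¹ * (y * g))⁻¹
      have h2 := L.len_mul (h⁻¹ * y) g
      rw [L.len_inv, hk0] at h1
      linarith
  intro R
  obtain ⟨n, hn⟩ := hD R
  refine ⟨n + 1, fun x hx hxR => ?_⟩
  obtain ⟨h, hh, h0⟩ := key n x (hn x (hHD hx) hxR)
  exact ⟨h, hh, h⁻¹ * x, H.mul_mem (H.inv_mem (L.BP_mem hh)) hx, by rw [h0]; norm_num, by group⟩

open Classical in
/-- main existence result for invariant additive functions -/
theorem exists_invHom {D : Subgroup M} (hDinv : L.Inv D) (hDc : IsClosed (D : Set M))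
    (hD : L.Chain D) {z : M} (hzD : z ∈ D) (hz : L.len z ≠ 0) (p : Ultrafilter ℕ)
    (hp : (p : Filter ℕ) ≤ atTop) (hHD : H ≤ D)
    (N1 : ∀ h ∈ H, Tendsto (fun n : ℕ => L.sc (-n) h) p (𝓝 1))
    (N2 : ∀ g ∈ D, ∃ h ∈ H, L.len (h⁻¹ * g) = 0) :
    L.Chain H ∧ ∃ l ∈ L.W0 H, l ≠ 0 ∧ ∀ h : M, (∀ x ∈ H, h * x * h⁻¹ ∈ H) →
      Tendsto (fun n : ℕ => L.sc (-n) h) p (𝓝 1) → ∀ x ∈ H, l (h * x * h⁻¹) = l x := by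
  have hch := chain_of_N2 hHD hD N2
  refine ⟨hch, exists_inv hch p ?_⟩
  obtain ⟨Φ, h1, ⟨B, h2⟩, w, hwN, hw⟩ := (L.sub D hDinv hDc).lemmaA (sub_chain hDinv hDc hD)
    (z := ⟨z, hzD⟩) hz p hp (H.subgroupOf D)
    (fun h hh => by
      rw [tendsto_subtype_rng]
      have := N1 h hh
      refine this.congr fun n => ?_
      rw [sub_sc])
    (fun g => by
      obtain ⟨h, hh, h0⟩ := N2 g g.2
      exact ⟨⟨h, hHD hh⟩, hh, h0⟩)
  let l : M → ℝ := fun x => if hx : x ∈ H then Φ ⟨x, hHD hx⟩ else 0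
  have hlH : ∀ x (hx : x ∈ H), l x = Φ ⟨x, hHD hx⟩ := fun x hx => dif_pos hx
  refine ⟨l, ⟨fun x hx y hy => ?_, ⟨B, fun x hx hx1 => ?_⟩, fun x hx => dif_neg hx⟩, fun h0 => ?_⟩
  · rw [hlH _ (H.mul_mem hx hy), hlH x hx, hlH y hy]
    exact h1 ⟨x, hHD hx⟩ hx ⟨y, hHD hy⟩ hy
  · rw [hlH x hx]; exact h2 _ hx1
  · have := congrFun h0 (w : M)
    rw [hlH (w : M) hwN] at this
    exact hw this
end strick
end LenData

open Filter Topology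
open scoped commutatorElement
set_option linter.unusedSectionVars false

namespace LenData
section ladder
variable {M : Type*} [Group M] [TopologicalSpace M] [IsTopologicalGroup M] {lam : ℝ}
  (L : LenData M lam)

/-- conjugation invariant bounded additive functions -/
def WI (D : Subgroup M) : Submodule ℝ (M → ℝ) where
  carrier := {l | l ∈ L.W0 D ∧ ∀ g, ∀ x ∈ D, l (g * x * g⁻¹) = l x}
  add_mem' := by
    rintro a b ⟨ha, ha'⟩ ⟨hb, hb'⟩
    refine ⟨(L.W0 D).add_mem ha hb, fun g x hx => ?_⟩
    simp only [Pi.add_apply, ha' g x hx, hb' g x hx]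
  zero_mem' := ⟨(L.W0 D).zero_mem, by simp⟩
  smul_mem' := by
    rintro c a ⟨ha, ha'⟩
    refine ⟨(L.W0 D).smul_mem c ha, fun g x hx => ?_⟩
    simp only [Pi.smul_apply, ha' g x hx]

/-- joint kernel -/
def KI (D : Subgroup M) : Subgroup M where
  carrier := {x | x ∈ D ∧ ∀ l ∈ L.WI D, l x = 0}
  one_mem' := ⟨D.one_mem, fun l hl => W0_one hl.1⟩
  mul_mem' := by
    rintro x y ⟨hx, hx'⟩ ⟨hy, hy'⟩
    exact ⟨D.mul_mem hx hy, fun l hl => by rw [W0_mul hl.1 hx hy, hx' l hl, hy' l hl, add_zero]⟩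
  inv_mem' := by
    rintro x ⟨hx, hx'⟩
    exact ⟨D.inv_mem hx, fun l hl => by rw [W0_inv hl.1 hx, hx' l hl, neg_zero]⟩

structure Good (D : Subgroup M) : Prop where
  norm : D.Normal
  inv : L.Inv D
  closed : IsClosed (D : Set M)
  conn : IsConnected (D : Set M)

variable {L} {D D' : Subgroup M} {l : M → ℝ}

theorem Good.chain (h : L.Good D) : L.Chain D := by
  haveI : ConnectedSpace D := isConnected_iff_connectedSpace.1 h.conn
  exact chain_sub h.inv h.closed (chain_top_of_connected _)

theorem KI_le : L.KI D ≤ D := fun _ hx => hx.1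

theorem comm_mem_D (hn : D.Normal) (x : M) {y : M} (hy : y ∈ D) : ⁅x, y⁆ ∈ D := by
  rw [commutatorElement_def]
  exact D.mul_mem (hn.conj_mem y hy x) (D.inv_mem hy)

theorem WI_comm (hn : D.Normal) (hl : l ∈ L.WI D) (x : M) {y : M} (hy : y ∈ D) : l ⁅x, y⁆ = 0 := by
  rw [commutatorElement_def, W0_mul hl.1 (hn.conj_mem y hy x) (D.inv_mem hy), hl.2 x y hy,
    W0_inv hl.1 hy, add_neg_cancel]

theorem comm_mem_KI (hn : D.Normal) (x : M) {y : M} (hy : y ∈ D) : ⁅x, y⁆ ∈ L.KI D :=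
  ⟨comm_mem_D hn x hy, fun _ hl => WI_comm hn hl x hy⟩

theorem KI_normal (hn : D.Normal) : (L.KI D).Normal :=
  ⟨fun x hx g => ⟨hn.conj_mem x hx.1 g, fun l hl => by rw [hl.2 g x hx.1]; exact hx.2 l hl⟩⟩

theorem W0_sc (hch : L.Chain D) (hi : L.Inv D) (hl : l ∈ L.W0 D) (k : ℤ) :
    (fun x => l (L.sc k x)) ∈ L.W0 D := by
  refine ⟨fun x hx y hy => ?_, ?_, fun x hx => W0_out hl fun h => hx ?_⟩
  · simp only [map_mul]; exact W0_mul hl (hi k x hx) (hi k y hy)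
  · obtain ⟨B, _, hB⟩ := W0_bdd hch hl (lam ^ k)
    refine ⟨B, fun x hx hx1 => hB _ (hi k x hx) ?_⟩
    rw [len_sc]
    have := zpow_pos L.lam_pos k
    nlinarith
  · have := hi (-k) _ h
    rwa [sc_neg_sc] at this

theorem WI_sc (hch : L.Chain D) (hi : L.Inv D) (hl : l ∈ L.WI D) (k : ℤ) :
    (fun x => l (L.sc k x)) ∈ L.WI D := by
  refine ⟨W0_sc hch hi hl.1 k, fun g x hx => ?_⟩
  simp only [map_mul, map_inv]
  exact hl.2 _ _ (hi k x hx)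

theorem KI_inv (hch : L.Chain D) (hi : L.Inv D) : L.Inv (L.KI D) :=
  fun k x hx => ⟨hi k x hx.1, fun _ hl => hx.2 _ (WI_sc hch hi hl k)⟩

theorem KI_closed (hc : IsClosed (D : Set M)) : IsClosed (L.KI D : Set M) := by
  have : (L.KI D : Set M) = ⋂ l : L.WI D, {x | x ∈ (D : Set M) ∧ (l : M → ℝ) x ∈ ({0} : Set ℝ)} := by
    ext x
    simp only [Set.mem_iInter, Set.mem_setOf_eq]
    constructor
    · rintro ⟨h1, h2⟩ ⟨l, hl⟩; exact ⟨h1, h2 l hl⟩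
    · intro h; exact ⟨(h 0).1, fun l hl => (h ⟨l, hl⟩).2⟩
  rw [this]
  exact isClosed_iInter fun l => (W0_contOn l.2.1).preimage_isClosed_of_isClosed hc isClosed_singleton

theorem len_comm_le (x y : M) : L.len ⁅x, y⁆ ≤ 2 * L.len x + 2 * L.len y := by
  rw [commutatorElement_def]
  have h1 := L.len_mul (x * y * x⁻¹) y⁻¹
  have h2 := L.len_conj_le x y
  rw [L.len_inv] at h1; linarith

/-- additivity of the bracket in the first variable -/
theorem br_left (hD : D.Normal) (hl : l ∈ L.WI (L.KI D)) {y : M} (hy : y ∈ D) (x x' : M) :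
    l ⁅x * x', y⁆ = l ⁅x, y⁆ + l ⁅x', y⁆ := by
  have e : ⁅x * x', y⁆ = (x * ⁅x', y⁆ * x⁻¹) * ⁅x, y⁆ := by
    simp only [commutatorElement_def]; group
  have h1 := comm_mem_KI (L := L) hD x hy
  have h2 := comm_mem_KI (L := L) hD x' hy
  rw [e, W0_mul hl.1 ((KI_normal hD).conj_mem _ h2 x) h1, hl.2 _ _ h2, add_comm]

theorem br_right (hD : D.Normal) (hl : l ∈ L.WI (L.KI D)) {y y' : M} (hy : y ∈ D) (hy' : y' ∈ D)
    (x : M) : l ⁅x, y * y'⁆ = l ⁅x, y⁆ + l ⁅x, y'⁆ := by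
  have e : ⁅x, y * y'⁆ = ⁅x, y⁆ * (y * ⁅x, y'⁆ * y⁻¹) := by
    simp only [commutatorElement_def]; group
  have h1 := comm_mem_KI (L := L) hD x hy
  have h2 := comm_mem_KI (L := L) hD x hy'
  rw [e, W0_mul hl.1 h1 ((KI_normal hD).conj_mem _ h2 y), hl.2 _ _ h2]

theorem br_mem_W0 (hD : D.Normal) (hch : L.Chain (L.KI D)) (hl : l ∈ L.WI (L.KI D))
    {y : M} (hy : y ∈ D) : (fun x => l ⁅x, y⁆) ∈ L.W0 ⊤ := by
  refine ⟨fun x _ x' _ => br_left hD hl hy x x', ?_, fun x hx => absurd trivial hx⟩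
  obtain ⟨B, _, hB⟩ := W0_bdd hch hl.1 (2 + 2 * L.len y)
  refine ⟨B, fun x _ hx => hB _ (comm_mem_KI hD x hy) ?_⟩
  have := L.len_comm_le x y
  linarith

open Classical in
theorem br_mem_WI (hD : D.Normal) (hch : L.Chain (L.KI D)) (hl : l ∈ L.WI (L.KI D)) (x : M) :
    (fun y => if y ∈ D then l ⁅x, y⁆ else 0) ∈ L.WI D := by
  refine ⟨⟨fun y hy y' hy' => ?_, ?_, fun y hy => if_neg hy⟩, fun g y hy => ?_⟩
  · simp only [if_pos (D.mul_mem hy hy'), if_pos hy, if_pos hy']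
    exact br_right hD hl hy hy' x
  · obtain ⟨B, _, hB⟩ := W0_bdd hch hl.1 (2 * L.len x + 2)
    refine ⟨B, fun y hy hy1 => ?_⟩
    simp only [if_pos hy]
    refine hB _ (comm_mem_KI hD x hy) ?_
    have := L.len_comm_le x y
    linarith
  · simp only [if_pos (hD.conj_mem y hy g), if_pos hy]
    have e : ⁅x, g * y * g⁻¹⁆ = g * ⁅g⁻¹ * x * g, y⁆ * g⁻¹ := by
      simp only [commutatorElement_def]; group
    rw [e, hl.2 _ _ (comm_mem_KI hD _ hy), br_left hD hl hy, br_left hD hl hy]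
    have h := br_left hD hl hy g⁻¹ g
    have h1 := br_left hD hl hy 1 1
    rw [inv_mul_cancel] at h
    rw [mul_one] at h1
    linarith

variable (L) in
/-- the ladder -/
def Cc : ℕ → Subgroup M
  | 0 => ⊤
  | j + 1 => L.KI (Cc j)

theorem Cc_normal (j : ℕ) : (L.Cc j).Normal := by
  induction j with
  | zero => exact (inferInstance : (⊤ : Subgroup M).Normal)
  | succ j ih => exact KI_normal ih

theorem Cc_anti {i j : ℕ} (h : i ≤ j) : L.Cc j ≤ L.Cc i := by
  induction j, h using Nat.le_induction with
  | base => exact le_rfl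
  | succ j _ ih => exact KI_le.trans ih

variable (L) in
/-- one parameter subgroups -/
def PS : Set (ℝ → M) := {e | (∀ s t, e (s + t) = e s * e t) ∧ Continuous e ∧
  ∃ K, ∀ s, L.len (e s) ≤ K * |s|}

/-- iterated bracket curves -/
def Bs (E : Set (ℝ → M)) : ℕ → Set (ℝ → M)
  | 0 => E
  | j + 1 => {c | ∃ e ∈ E, ∃ b ∈ Bs E j, c = fun s => ⁅e s, b s⁆}

theorem Bs_mono {E E' : Set (ℝ → M)} (h : E ⊆ E') (j : ℕ) : Bs E j ⊆ Bs E' j := by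
  induction j with
  | zero => exact h
  | succ j ih => rintro _ ⟨e, he, b, hb, rfl⟩; exact ⟨e, h he, b, ih hb, rfl⟩

theorem PS_zero {e : ℝ → M} (he : e ∈ L.PS) : e 0 = 1 := by
  have := he.1 0 0
  rw [add_zero] at this
  exact left_eq_mul.1 this

theorem PS_scale {e : ℝ → M} (he : e ∈ L.PS) (c : ℝ) : (fun s => e (c * s)) ∈ L.PS := by
  obtain ⟨h1, h2, K, hK⟩ := he
  refine ⟨fun s t => by simp only [mul_add, h1], by fun_prop, K * |c|, fun s => ?_⟩
  have := hK (c * s)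
  rw [abs_mul] at this; linarith

theorem PS_sc {e : ℝ → M} (he : e ∈ L.PS) (k : ℤ) : (fun s => L.sc k (e s)) ∈ L.PS := by
  obtain ⟨h1, h2, K, hK⟩ := he
  refine ⟨fun s t => by simp only [h1, map_mul], (L.sc_cont k).comp h2, lam ^ k * K, fun s => ?_⟩
  have := hK s
  have := zpow_pos L.lam_pos k
  rw [len_sc, mul_assoc]; gcongr

theorem Bs_scale {b : ℝ → M} {j : ℕ} (hb : b ∈ Bs L.PS j) (c : ℝ) : (fun s => b (c * s)) ∈ Bs L.PS j := by
  induction j generalizing b with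
  | zero => exact PS_scale hb c
  | succ j ih => obtain ⟨e, he, b, hb, rfl⟩ := hb; exact ⟨_, PS_scale he c, _, ih hb, rfl⟩

theorem Bs_sc {b : ℝ → M} {j : ℕ} (hb : b ∈ Bs L.PS j) (k : ℤ) : (fun s => L.sc k (b s)) ∈ Bs L.PS j := by
  induction j generalizing b with
  | zero => exact PS_sc hb k
  | succ j ih =>
    obtain ⟨e, he, b, hb, rfl⟩ := hb
    exact ⟨_, PS_sc he k, _, ih hb, by funext s; rw [map_commutatorElement]⟩

theorem Bs_cont {b : ℝ → M} {j : ℕ} (hb : b ∈ Bs L.PS j) : Continuous b := by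
  induction j generalizing b with
  | zero => exact hb.2.1
  | succ j ih =>
    obtain ⟨e, he, b, hb, rfl⟩ := hb
    have := ih hb
    have := he.2.1
    simp only [commutatorElement_def]; fun_prop

theorem Bs_len {b : ℝ → M} {j : ℕ} (hb : b ∈ Bs L.PS j) : ∃ K, ∀ s, L.len (b s) ≤ K * |s| := by
  induction j generalizing b with
  | zero => exact hb.2.2
  | succ j ih =>
    obtain ⟨e, ⟨_, _, K', hK'⟩, b, hb, rfl⟩ := hb
    obtain ⟨K, hK⟩ := ih hb
    refine ⟨2 * K' + 2 * K, fun s => ?_⟩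
    have := hK s
    have := hK' s
    have := L.len_comm_le (e s) (b s)
    linarith

theorem Bs_mem {b : ℝ → M} {j : ℕ} (hb : b ∈ Bs L.PS j) (s : ℝ) : b s ∈ L.Cc j := by
  cases j with
  | zero => trivial
  | succ j =>
    have key : ∀ j, ∀ b ∈ Bs L.PS j, ∀ s, b s ∈ L.Cc j := by
      intro j
      induction j with
      | zero => intro b _ s; trivial
      | succ j ih =>
        rintro _ ⟨e, he, b, hb, rfl⟩ s
        exact comm_mem_KI (Cc_normal j) _ (ih b hb s)
    exact key _ b hb s

theorem add_lin {φ : ℝ → ℝ} (h : ∀ s t, φ (s + t) = φ s + φ t) (h0 : Tendsto φ (𝓝 0) (𝓝 0)) (s : ℝ) :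
    φ s = s * φ 1 := by
  let F : ℝ →+ ℝ := AddMonoidHom.mk' φ h
  have hF : Continuous F := by
    refine continuous_of_continuousAt_zero F ?_
    have : φ 0 = 0 := by
      have := h 0 0
      rw [add_zero] at this; linarith
    change Tendsto φ (𝓝 0) (𝓝 (φ 0))
    rw [this]; exact h0
  have := map_real_smul F hF s 1
  simpa [F] using this

/-- homogeneity on bracket curves -/
theorem Bs_hom {j : ℕ} (hG : ∀ i ≤ j, L.Good (L.Cc i)) {b : ℝ → M} (hb : b ∈ Bs L.PS j)
    (hl : l ∈ L.WI (L.Cc j)) (s : ℝ) : l (b s) = s ^ (j + 1) * l (b 1) := by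
  induction j generalizing b l with
  | zero =>
    rw [zero_add, pow_one]
    refine add_lin (φ := fun s => l (b s)) (fun s t => ?_) ?_ s
    · simp only [hb.1 s t]; exact W0_mul hl.1 trivial trivial
    · have h1 := (hb.2.1.tendsto 0)
      rw [PS_zero hb] at h1
      have := W0_tendsto' hl.1 (L.Cc 0).one_mem (Eventually.of_forall fun _ => trivial) h1
      rwa [W0_one hl.1] at this
  | succ j ih =>
    classical
    obtain ⟨e, he, b, hb, rfl⟩ := hb
    have hn := Cc_normal (L := L) j
    have hch := (hG (j + 1) le_rfl).chain
    have h1 := ih (fun i hi => hG i (by omega)) hb (br_mem_WI hn hch hl (e s))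
    simp only [if_pos (Bs_mem hb _)] at h1
    have h2 : l ⁅e s, b 1⁆ = s * l ⁅e 1, b 1⁆ := by
      refine add_lin (φ := fun s => l ⁅e s, b 1⁆) (fun s t => ?_) ?_ s
      · simp only [he.1 s t]; exact br_left hn hl (Bs_mem hb _) _ _
      · have h1 := (he.2.1.tendsto 0)
        rw [PS_zero he] at h1
        have h3 := br_mem_W0 hn hch hl (Bs_mem hb 1)
        have := W0_tendsto' h3 (Subgroup.mem_top 1) (Eventually.of_forall fun _ => trivial) h1
        rwa [W0_one h3] at this
    rw [h1, h2]; ring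
end ladder
end LenData

open Filter Topology
open scoped commutatorElement
set_option linter.unusedSectionVars false

theorem exists_dual_list {M : Type*} (V : Submodule ℝ (M → ℝ)) [FiniteDimensional ℝ V] (S : Set M)
    (hS : ∀ v ∈ V, (∀ x ∈ S, v x = 0) → v = 0) :
    ∃ lst : List (M × (M → ℝ)), (∀ p ∈ lst, p.1 ∈ S ∧ p.2 ∈ V) ∧
      ∀ v ∈ V, ∀ x, v x = (lst.map fun p => v p.1 * p.2 x).sum := by
  classical
  let ev : M → Module.Dual ℝ V := fun x =>
    { toFun := fun v => (v : M → ℝ) x, map_add' := fun _ _ => rfl, map_smul' := fun _ _ => rfl }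
  have hspan : Submodule.span ℝ (ev '' S) = ⊤ := by
    rw [← Subspace.dualCoannihilator_dualAnnihilator_eq (W := Submodule.span ℝ (ev '' S))]
    have : (Submodule.span ℝ (ev '' S)).dualCoannihilator = ⊥ := by
      rw [eq_bot_iff]
      rintro ⟨v, hv⟩ h
      rw [Submodule.mem_dualCoannihilator] at h
      refine Subtype.ext (hS v hv fun x hx => ?_)
      exact h (ev x) (Submodule.subset_span ⟨x, hx, rfl⟩)
    rw [this, Submodule.dualAnnihilator_bot]
  obtain ⟨b, hb, hbs, hli⟩ := exists_linearIndependent ℝ (ev '' S)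
  let B : Module.Basis b ℝ (Module.Dual ℝ V) := Module.Basis.mk hli (by
    rw [Subtype.range_coe, hbs, hspan])
  haveI : Fintype b := FiniteDimensional.fintypeBasisIndex B
  choose pt hpt using fun a : b => hb a.2
  let w : b → V := fun a => (Module.evalEquiv ℝ V).symm (B.coord a)
  have hw : ∀ a (φ : Module.Dual ℝ V), φ (w a) = B.repr φ a := by
    intro a φ
    simp [w]
  refine ⟨(Finset.univ : Finset b).toList.map fun a => (pt a, (w a : M → ℝ)), ?_, ?_⟩
  · intro p hp
    obtain ⟨a, _, rfl⟩ := List.mem_map.1 hp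
    exact ⟨(hpt a).1, (w a).2⟩
  · intro v hv x
    rw [List.map_map, Finset.sum_map_toList]
    have h1 := B.sum_repr (ev x)
    have h2 := congrArg (fun φ : Module.Dual ℝ V => φ ⟨v, hv⟩) h1
    change _ = v x at h2
    rw [← h2]
    simp only [LinearMap.sum_apply, LinearMap.smul_apply, smul_eq_mul]
    refine Finset.sum_congr rfl fun a _ => ?_
    have h3 : B a = ev (pt a) := by
      rw [(hpt a).2]; simp [B]
    rw [h3, ← hw a (ev x), mul_comm]
    rfl

namespace LenData
section ladder
variable {M : Type*} [Group M] [TopologicalSpace M] [IsTopologicalGroup M] {lam : ℝ}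
  {L : LenData M lam} {D : Subgroup M} {l : M → ℝ}

theorem mk_comm {Γ : Subgroup M} [Γ.Normal] (h : ∀ x : M, ∀ y ∈ D, ⁅x, y⁆ ∈ Γ) (x : M) {y : M}
    (hy : y ∈ D) : (x : M ⧸ Γ) * (y : M ⧸ Γ) = (y : M ⧸ Γ) * (x : M ⧸ Γ) := by
  have h1 := (QuotientGroup.eq_one_iff _).2 (h x y hy)
  rw [commutatorElement_def] at h1
  simp only [QuotientGroup.mk_mul, QuotientGroup.mk_inv] at h1
  rwa [mul_inv_eq_one, mul_inv_eq_iff_eq_mul] at h1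

/-- quasi multiplicative maps -/
def QM (D : Subgroup M) (s : M → M) : Prop :=
  ContinuousOn s D ∧ (∀ x ∈ D, s x ∈ D) ∧
  ∀ (Γ : Subgroup M) [Γ.Normal], (∀ x : M, ∀ y ∈ D, ⁅x, y⁆ ∈ Γ) → ∀ x ∈ D, ∀ y ∈ D,
    ((s (x * y) : M) : M ⧸ Γ) = (s x : M ⧸ Γ) * (s y : M ⧸ Γ)

theorem QM.mul {s s' : M → M} (h : QM D s) (h' : QM D s') : QM D (fun x => s x * s' x) := by
  refine ⟨h.1.mul h'.1, fun x hx => D.mul_mem (h.2.1 x hx) (h'.2.1 x hx), ?_⟩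
  intro Γ _ hΓ x hx y hy
  simp only [QuotientGroup.mk_mul]
  rw [h.2.2 Γ hΓ x hx y hy, h'.2.2 Γ hΓ x hx y hy]
  have := mk_comm hΓ (s y) (h'.2.1 x hx)
  rw [mul_assoc, mul_assoc, ← mul_assoc (s y : M ⧸ Γ), this, mul_assoc]

theorem QM.inv {s : M → M} (h : QM D s) : QM D (fun x => (s x)⁻¹) := by
  refine ⟨h.1.inv, fun x hx => D.inv_mem (h.2.1 x hx), ?_⟩
  intro Γ _ hΓ x hx y hy
  simp only [QuotientGroup.mk_inv]
  rw [h.2.2 Γ hΓ x hx y hy, mk_comm hΓ _ (h.2.1 y hy), mul_inv_rev]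

theorem QM.id : QM D (fun x => x) :=
  ⟨continuousOn_id, fun _ hx => hx, fun _ _ _ _ _ _ _ => by rw [QuotientGroup.mk_mul]⟩

theorem QM.one : QM D (fun _ => 1) :=
  ⟨continuousOn_const, fun _ _ => D.one_mem, fun _ _ _ _ _ _ _ => by simp⟩

/-- quasi one parameter subgroups -/
def QP (D : Subgroup M) (σ : ℝ → M) : Prop :=
  Continuous σ ∧ (∀ s, σ s ∈ D) ∧ σ 0 = 1 ∧
  ∀ (Γ : Subgroup M) [Γ.Normal], (∀ x : M, ∀ y ∈ D, ⁅x, y⁆ ∈ Γ) → ∀ s t,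
    ((σ (s + t) : M) : M ⧸ Γ) = (σ s : M ⧸ Γ) * (σ t : M ⧸ Γ)

theorem QP.lin (hn : D.Normal) {σ : ℝ → M} (h : QP D σ) (hl : l ∈ L.WI D) (s : ℝ) :
    l (σ s) = s * l (σ 1) := by
  refine add_lin (φ := fun s => l (σ s)) (fun s t => ?_) ?_ s
  · haveI := KI_normal (L := L) hn
    have h1 := h.2.2.2 (L.KI D) (fun x y hy => comm_mem_KI hn x hy) s t
    rw [← QuotientGroup.mk_mul, QuotientGroup.eq] at h1
    have h2 := h1.2 l hl
    have h3 := D.mul_mem (h.2.1 s) (h.2.1 t)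
    rw [W0_mul hl.1 (D.inv_mem (h.2.1 _)) h3, W0_inv hl.1 (h.2.1 _),
      W0_mul hl.1 (h.2.1 s) (h.2.1 t)] at h2
    linarith
  · have h1 := h.1.tendsto 0
    rw [h.2.2.1] at h1
    have := W0_tendsto' hl.1 D.one_mem (Eventually.of_forall fun s => h.2.1 s) h1
    rwa [W0_one hl.1] at this

theorem QP.comp {σ : ℝ → M} (h : QP D σ) (hl : l ∈ L.WI D) : QM D (fun x => σ (l x)) := by
  refine ⟨h.1.comp_continuousOn (W0_contOn hl.1), fun x _ => h.2.1 _, ?_⟩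
  intro Γ _ hΓ x hx y hy
  simp only [W0_mul hl.1 hx hy]
  exact h.2.2.2 Γ hΓ _ _

theorem exists_QP {b : ℝ → M} {j : ℕ} (hb : b ∈ Bs L.PS j) : ∃ σ, QP (L.Cc j) σ ∧ σ 1 = b 1 := by
  cases j with
  | zero =>
    refine ⟨b, ⟨hb.2.1, fun _ => trivial, PS_zero hb, fun Γ _ _ s t => ?_⟩, rfl⟩
    rw [hb.1, QuotientGroup.mk_mul]
  | succ j =>
    obtain ⟨e, he, b, hb, rfl⟩ := hb
    have hn := Cc_normal (L := L) j
    have hy := Bs_mem hb 1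
    refine ⟨fun s => ⁅e s, b 1⁆, ⟨?_, fun s => comm_mem_KI hn _ hy, ?_, fun Γ _ hΓ s t => ?_⟩, rfl⟩
    · have := he.2.1
      simp only [commutatorElement_def]; fun_prop
    · simp [PS_zero he]
    · have e1 : ⁅e s * e t, b 1⁆ = (e s * ⁅e t, b 1⁆ * (e s)⁻¹) * ⁅e s, b 1⁆ := by
        simp only [commutatorElement_def]; group
      have h1 := mk_comm hΓ (e s) (y := ⁅e t, b 1⁆) (comm_mem_KI hn _ hy)
      have h2 := mk_comm hΓ ⁅e t, b 1⁆ (y := ⁅e s, b 1⁆) (comm_mem_KI hn _ hy)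
      simp only [he.1, e1]
      simp only [QuotientGroup.mk_mul, QuotientGroup.mk_inv] at h1 h2 ⊢
      rw [h1, mul_inv_cancel_right, h2]

theorem exists_QM_list (hn : D.Normal) (lst : List (M × (M → ℝ)))
    (h : ∀ p ∈ lst, (∃ σ, QP D σ ∧ σ 1 = p.1) ∧ p.2 ∈ L.WI D) :
    ∃ ρ, QM D ρ ∧ (∀ x, (∀ v ∈ L.WI D, v x = 0) → ρ x = 1) ∧
      ∀ v ∈ L.WI D, ∀ x ∈ D, v (ρ x) = (lst.map fun p => v p.1 * p.2 x).sum := by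
  induction lst with
  | nil => exact ⟨fun _ => 1, QM.one, fun _ _ => rfl, fun v hv x _ => by simp [W0_one hv.1]⟩
  | cons p lst ih =>
    obtain ⟨ρ, h1, h2, h3⟩ := ih fun q hq => h q (List.mem_cons_of_mem _ hq)
    obtain ⟨⟨σ, hσ, hσ1⟩, hp⟩ := h p List.mem_cons_self
    refine ⟨fun x => σ (p.2 x) * ρ x, (hσ.comp hp).mul h1, fun x hx => ?_, fun v hv x hx => ?_⟩
    · simp only
      rw [hx _ hp, hσ.2.2.1, h2 x hx, one_mul]
    · simp only
      rw [W0_mul hv.1 (hσ.2.1 _) (h1.2.1 x hx), hσ.lin hn hv, h3 v hv x hx, hσ1, List.map_cons,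
        List.sum_cons, mul_comm]

variable (L) in
/-- separation at level `j` -/
def Sep (E : Set (ℝ → M)) (j : ℕ) : Prop :=
  ∀ v ∈ L.WI (L.Cc j), (∀ b ∈ Bs E j, v (b 1) = 0) → v = 0

theorem WI_le_W0 (D : Subgroup M) : L.WI D ≤ L.W0 D := fun _ h => h.1

theorem WI_finite (hch : L.Chain D) : FiniteDimensional ℝ (L.WI D) := by
  haveI := W0_finite hch
  exact Submodule.finiteDimensional_of_le (WI_le_W0 D)

theorem exists_ret {E : Set (ℝ → M)} (hE : E ⊆ L.PS) {j : ℕ} (hch : L.Chain (L.Cc j))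
    (hs : L.Sep E j) : ∃ ρ, QM (L.Cc j) ρ ∧ (∀ x ∈ L.Cc j, ρ x ∈ L.Cc (j + 1)) ∧
      ∀ x ∈ L.Cc (j + 1), ρ x = x := by
  haveI := WI_finite hch
  obtain ⟨lst, h1, h2⟩ := exists_dual_list (L.WI (L.Cc j)) {x | ∃ b ∈ Bs E j, x = b 1} (by
    intro v hv h
    exact hs v hv fun b hb => h _ ⟨b, hb, rfl⟩)
  obtain ⟨ρ, h3, h4, h5⟩ := exists_QM_list (Cc_normal j) lst (fun p hp => by
    obtain ⟨⟨b, hb, e⟩, hp2⟩ := h1 p hp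
    rw [e]
    exact ⟨exists_QP (Bs_mono hE j hb), hp2⟩)
  refine ⟨fun x => x * (ρ x)⁻¹, QM.id.mul h3.inv, fun x hx => ?_, fun x hx => ?_⟩
  · have hρ := h3.2.1 x hx
    refine ⟨Subgroup.mul_mem _ hx (Subgroup.inv_mem _ hρ), fun v hv => ?_⟩
    rw [W0_mul hv.1 hx (Subgroup.inv_mem _ hρ), W0_inv hv.1 hρ, h5 v hv x hx, ← h2 v hv x,
      add_neg_cancel]
  · simp only
    rw [h4 x hx.2]; simp

theorem good_succ {E : Set (ℝ → M)} (hE : E ⊆ L.PS) {j : ℕ} (hG : L.Good (L.Cc j))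
    (hs : L.Sep E j) : L.Good (L.Cc (j + 1)) := by
  obtain ⟨ρ, h1, h2, h3⟩ := exists_ret hE hG.chain hs
  refine ⟨Cc_normal _, KI_inv hG.chain hG.inv, KI_closed hG.closed, ?_⟩
  have : (L.Cc (j + 1) : Set M) = ρ '' (L.Cc j : Set M) := by
    ext x
    constructor
    · intro hx; exact ⟨x, KI_le hx, h3 x hx⟩
    · rintro ⟨y, hy, rfl⟩; exact h2 y hy
  rw [this]
  exact hG.conn.image ρ h1.1

theorem sep_succ {E : Set (ℝ → M)} (hE : E ⊆ L.PS) {j : ℕ} (hG : L.Good (L.Cc j))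
    (hs0 : L.Sep E 0) (hs : L.Sep E j) : L.Sep E (j + 1) := by
  classical
  intro l hl hl0
  have hG' := good_succ hE hG hs
  have hn := hG.norm
  have kill1 : ∀ e ∈ E, ∀ y ∈ L.Cc j, l ⁅e 1, y⁆ = 0 := by
    intro e he y hy
    have h1 := hs _ (br_mem_WI hn hG'.chain hl (e 1)) (fun b hb => by
      rw [if_pos (Bs_mem (Bs_mono hE j hb) 1)]
      exact hl0 _ ⟨e, he, b, hb, rfl⟩)
    have := congrFun h1 y
    rwa [if_pos hy] at this
  have kill : ∀ x : M, ∀ y ∈ L.Cc j, l ⁅x, y⁆ = 0 := by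
    intro x y hy
    have h0 := br_mem_W0 hn hG'.chain hl hy
    have h1 : (fun x => l ⁅x, y⁆) ∈ L.WI (L.Cc 0) := by
      refine ⟨h0, fun g x _ => ?_⟩
      have a1 := W0_mul h0 (Subgroup.mem_top (g * x)) (Subgroup.mem_top g⁻¹)
      have a2 := W0_mul h0 (Subgroup.mem_top g) (Subgroup.mem_top x)
      have a3 := W0_inv h0 (Subgroup.mem_top g)
      linarith
    exact congrFun (hs0 _ h1 fun e he => kill1 e he y hy) x
  obtain ⟨ρ, h1, h2, h3⟩ := exists_ret hE hG.chain hs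
  let Γ : Subgroup M :=
    { carrier := {x | x ∈ L.Cc (j + 1) ∧ l x = 0}
      one_mem' := ⟨Subgroup.one_mem _, W0_one hl.1⟩
      mul_mem' := by
        rintro x y ⟨hx, hx'⟩ ⟨hy, hy'⟩
        exact ⟨Subgroup.mul_mem _ hx hy, by rw [W0_mul hl.1 hx hy, hx', hy', add_zero]⟩
      inv_mem' := by
        rintro x ⟨hx, hx'⟩
        exact ⟨Subgroup.inv_mem _ hx, by rw [W0_inv hl.1 hx, hx', neg_zero]⟩ }
  haveI hΓ : Γ.Normal := ⟨fun x hx g => ⟨hG'.norm.conj_mem x hx.1 g, by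
    rw [hl.2 g x hx.1]; exact hx.2⟩⟩
  have hcomm : ∀ x : M, ∀ y ∈ L.Cc j, ⁅x, y⁆ ∈ Γ := fun x y hy => ⟨comm_mem_KI hn x hy, kill x y hy⟩
  have hadd : ∀ x ∈ L.Cc j, ∀ y ∈ L.Cc j, l (ρ (x * y)) = l (ρ x) + l (ρ y) := by
    intro x hx y hy
    have a := h1.2.2 Γ hcomm x hx y hy
    rw [← QuotientGroup.mk_mul, QuotientGroup.eq] at a
    have b := a.2
    have c1 := h2 _ (Subgroup.mul_mem _ hx hy)
    have c2 := h2 x hx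
    have c3 := h2 y hy
    rw [W0_mul hl.1 (Subgroup.inv_mem _ c1) (Subgroup.mul_mem _ c2 c3), W0_inv hl.1 c1,
      W0_mul hl.1 c2 c3] at b
    linarith
  let m : M → ℝ := fun x => if x ∈ L.Cc j then l (ρ x) else 0
  have hmD : ∀ x ∈ L.Cc j, m x = l (ρ x) := fun x hx => if_pos hx
  have hm0 : m ∈ L.W0 (L.Cc j) := by
    refine ⟨fun x hx y hy => ?_, ?_, fun x hx => if_neg hx⟩
    · rw [hmD _ (Subgroup.mul_mem _ hx hy), hmD x hx, hmD y hy, hadd x hx y hy]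
    · have hK : IsCompact ((L.Cc j : Set M) ∩ {x | L.len x ≤ 1}) :=
        (L.len_proper 1).inter_left hG.closed
      have hc : ContinuousOn (fun x => L.len (ρ x)) ((L.Cc j : Set M) ∩ {x | L.len x ≤ 1}) :=
        L.len_cont.comp_continuousOn (h1.1.mono Set.inter_subset_left)
      obtain ⟨R, hR⟩ := (hK.image_of_continuousOn hc).bddAbove
      obtain ⟨B, _, hB⟩ := W0_bdd hG'.chain hl.1 R
      refine ⟨B, fun x hx hx1 => ?_⟩
      rw [hmD x hx]
      exact hB _ (h2 x hx) (hR ⟨x, ⟨hx, hx1⟩, rfl⟩)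
  have hm : m ∈ L.WI (L.Cc j) := by
    refine ⟨hm0, fun g x hx => ?_⟩
    have a := W0_mul hm0 (hn.conj_mem x hx g) (Subgroup.inv_mem _ hx)
    have b : m (g * x * g⁻¹ * x⁻¹) = 0 := by
      have c := comm_mem_KI (L := L) hn g hx
      rw [← commutatorElement_def, hmD _ (KI_le c), h3 _ c]
      exact kill g x hx
    rw [b, W0_inv hm0 hx] at a
    linarith
  funext x
  by_cases hx : x ∈ L.Cc (j + 1)
  · have := hx.2 m hm
    rwa [hmD x (KI_le hx), h3 x hx] at this
  · exact W0_out hl.1 hx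

theorem ladder {E : Set (ℝ → M)} (hE : E ⊆ L.PS) [ConnectedSpace M] (hs0 : L.Sep E 0) (j : ℕ) :
    L.Good (L.Cc j) ∧ L.Sep E j := by
  induction j with
  | zero =>
    refine ⟨⟨Cc_normal 0, fun _ _ _ => trivial, ?_, ?_⟩, hs0⟩
    · exact isClosed_univ
    · exact isConnected_univ
  | succ j ih => exact ⟨good_succ hE ih.1 ih.2, sep_succ hE ih.1 hs0 ih.2⟩

end ladder
end LenData

open Filter Topology
open scoped commutatorElement
set_option linter.unusedSectionVars false

theorem list_sum_bound {α β : Type*} (lst : List α) (F : α → β → ℝ) (g : β → ℝ)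
    (h : ∀ p ∈ lst, ∃ A : ℝ, 0 ≤ A ∧ ∀ y, |F p y| ≤ A * g y) :
    ∃ A : ℝ, 0 ≤ A ∧ ∀ y, |(lst.map fun p => F p y).sum| ≤ A * g y := by
  induction lst with
  | nil => exact ⟨0, le_rfl, by simp⟩
  | cons p lst ih =>
    obtain ⟨A, hA, h1⟩ := ih fun q hq => h q (List.mem_cons_of_mem _ hq)
    obtain ⟨A', hA', h2⟩ := h p List.mem_cons_self
    refine ⟨A' + A, by positivity, fun y => ?_⟩
    rw [List.map_cons, List.sum_cons, add_mul]
    exact (abs_add_le _ _).trans (add_le_add (h2 y) (h1 y))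

namespace LenData
section ladder
variable {M : Type*} [Group M] [TopologicalSpace M] [IsTopologicalGroup M] {lam : ℝ}
  {L : LenData M lam} {D : Subgroup M} {l : M → ℝ}

theorem sep_nhds (hsep : ∀ x, L.len x = 0 → x = 1) {U : Set M} (hU : U ∈ 𝓝 (1 : M)) :
    ∃ ε > 0, ∀ x, L.len x < ε → x ∈ U := by
  obtain ⟨V, hVU, hV, hV1⟩ := mem_nhds_iff.1 hU
  have hK : IsCompact ({x | L.len x ≤ 1} \ V) := (L.len_proper 1).diff hV
  rcases (({x | L.len x ≤ 1} \ V) : Set M).eq_empty_or_nonempty with h | h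
  · refine ⟨1, one_pos, fun x hx => ?_⟩
    by_contra hc
    have : x ∈ ({x | L.len x ≤ 1} \ V) := ⟨hx.le, fun h => hc (hVU h)⟩
    rw [h] at this; exact this
  · obtain ⟨z, hz, hmin⟩ := hK.exists_isMinOn h L.len_cont.continuousOn
    have hz0 : 0 < L.len z := lt_of_le_of_ne (L.len_nonneg z) fun h0 => by
      apply hz.2; rw [hsep z h0.symm]; exact hV1
    refine ⟨min 1 (L.len z), by positivity, fun x hx => ?_⟩
    by_contra hc
    have hx1 : x ∈ ({x | L.len x ≤ 1} \ V) :=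
      ⟨(hx.trans_le (min_le_left _ _)).le, fun h => hc (hVU h)⟩
    have : L.len z ≤ L.len x := hmin hx1
    exact absurd (hx.trans_le (min_le_right _ _)) (not_lt.2 this)

theorem sep_tendsto (hsep : ∀ x, L.len x = 0 → x = 1) {ι : Type*} {F : Filter ι} {u : ι → M}
    (hu : Tendsto (fun i => L.len (u i)) F (𝓝 0)) : Tendsto u F (𝓝 1) := by
  intro U hU
  obtain ⟨ε, hε, h⟩ := sep_nhds hsep hU
  filter_upwards [hu.eventually_lt_const hε] with i hi
  exact h _ hi

theorem sep_tendsto' (hsep : ∀ x, L.len x = 0 → x = 1) {ι : Type*} {F : Filter ι} {u : ι → M} {x : M}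
    (hu : Tendsto (fun i => L.len (x⁻¹ * u i)) F (𝓝 0)) : Tendsto u F (𝓝 x) := by
  have := (sep_tendsto hsep hu).const_mul x
  simpa using this

theorem len_tendsto {ι : Type*} {F : Filter ι} {u : ι → M} {x : M} (hu : Tendsto u F (𝓝 x)) :
    Tendsto (fun i => L.len (x⁻¹ * u i)) F (𝓝 0) := by
  have h : Continuous fun y => L.len (x⁻¹ * y) := L.len_cont.comp (by fun_prop)
  have := (h.tendsto x).comp hu
  simpa [L.len_one, Function.comp_def] using this

theorem sep_sc (hsep : ∀ x, L.len x = 0 → x = 1) {F : Filter ℕ} (hF : F ≤ atTop) (h : M) :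
    Tendsto (fun n : ℕ => L.sc (-n) h) F (𝓝 1) := by
  refine sep_tendsto hsep ?_
  simp only [len_sc]
  have := (L.lam_zpow_tendsto.mono_left hF).mul_const (L.len h)
  simpa using this

theorem weight (hsep : ∀ x, L.len x = 0 → x = 1) [ConnectedSpace M] {E : Set (ℝ → M)}
    (hE : E ⊆ L.PS) (hs0 : L.Sep E 0) {j : ℕ} (hl : l ∈ L.WI (L.Cc j)) :
    ∃ C, 0 ≤ C ∧ ∀ x ∈ L.Cc j, |l x| ≤ C * L.len x ^ (j + 1) := by
  obtain ⟨hG, hs⟩ := ladder hE hs0 j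
  haveI := WI_finite hG.chain
  obtain ⟨lst, h1, h2⟩ := exists_dual_list (L.WI (L.Cc j)) {x | ∃ b ∈ Bs E j, x = b 1} (by
    intro v hv h
    exact hs v hv fun b hb => h _ ⟨b, hb, rfl⟩)
  obtain ⟨A, hA, h3⟩ := list_sum_bound lst
    (fun p (q : {y : M // y ∈ L.Cc j ∧ L.len y ≤ 1} × ℤ) => l (L.sc q.2 p.1) * p.2 q.1)
    (fun q => (lam ^ q.2) ^ (j + 1)) (by
      intro p hp
      obtain ⟨⟨b, hb, e⟩, hp2⟩ := h1 p hp
      have hb' := Bs_mono hE j hb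
      obtain ⟨K, hK⟩ := Bs_len hb'
      obtain ⟨B, hB0, hB⟩ := W0_bdd hG.chain hl.1 K
      obtain ⟨B', hB0', hB'⟩ := W0_bdd hG.chain hp2.1 1
      refine ⟨B * B', by positivity, fun ⟨⟨y, hy, hy1⟩, k⟩ => ?_⟩
      have hk := zpow_pos L.lam_pos k
      have hc := Bs_sc (Bs_scale hb' (lam ^ (-k))) k
      have h4 := Bs_hom (fun i _ => (ladder hE hs0 i).1) hc hl (lam ^ k)
      have h5 : lam ^ (-k) * lam ^ k = 1 := by
        rw [← zpow_add₀ L.lam_pos.ne']; simp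
      rw [h5] at h4
      simp only
      rw [e, h4, abs_mul, abs_mul, abs_of_pos (pow_pos hk _)]
      have h6 : |l (L.sc k (b (lam ^ (-k) * 1)))| ≤ B := by
        refine hB _ (Bs_mem hc 1) ?_
        rw [len_sc]
        have := hK (lam ^ (-k) * 1)
        rw [mul_one, abs_of_pos (zpow_pos L.lam_pos _)] at this
        rw [mul_one]
        have h7 : lam ^ k * (K * lam ^ (-k)) = K := by
          rw [mul_left_comm, mul_comm (lam ^ k), h5, mul_one]
        rw [← h7]; gcongr
      have h7 := hB' y hy hy1
      calc (lam ^ k) ^ (j + 1) * |l (L.sc k (b (lam ^ (-k) * 1)))| * |p.2 y|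
          ≤ (lam ^ k) ^ (j + 1) * B * B' := by gcongr
        _ = _ := by ring)
  have hlam1 : 1 < lam := by linarith [L.two_le]
  refine ⟨A * lam ^ (j + 1), mul_nonneg hA (pow_nonneg L.lam_pos.le _), fun x hx => ?_⟩
  rcases (L.len_nonneg x).eq_or_lt with h0 | h0
  · rw [hsep x h0.symm, W0_one hl.1, L.len_one]; simp
  · obtain ⟨k, hk1, hk2⟩ := exists_mem_Ioc_zpow h0 hlam1
    have hy : L.len (L.sc (-(k + 1)) x) ≤ 1 := by
      rw [len_sc, zpow_neg, inv_mul_le_iff₀ (zpow_pos L.lam_pos _), mul_one]; exact hk2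
    have h4 := h3 ⟨⟨L.sc (-(k + 1)) x, hG.inv _ x hx, hy⟩, k + 1⟩
    have h5 := h2 _ (WI_sc hG.chain hG.inv hl (k + 1)) (L.sc (-(k + 1)) x)
    simp only [sc_sc_neg] at h5 h4
    rw [h5]
    refine h4.trans ?_
    rw [mul_assoc, ← mul_pow, zpow_add_one₀ L.lam_pos.ne', mul_comm (lam ^ k)]
    have := zpow_pos L.lam_pos k
    have := L.lam_pos
    gcongr

variable (L) in
theorem cover : ∃ P : ℕ, ∀ m : ℕ, ∃ F : Finset M, F.card ≤ P ^ m ∧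
    ∀ x, L.len x ≤ lam ^ m → ∃ f ∈ F, L.len (f⁻¹ * x) ≤ 1 := by
  classical
  have hl := L.lam_pos
  obtain ⟨t, _, ht⟩ := (L.len_proper 1).elim_nhds_subcover
    (fun y => {x | L.len (y⁻¹ * x) < lam⁻¹}) (fun y _ => by
      refine IsOpen.mem_nhds (isOpen_lt (L.len_cont.comp (by fun_prop)) continuous_const) ?_
      simp [L.len_one, hl])
  refine ⟨t.card, fun m => ?_⟩
  induction m with
  | zero => exact ⟨{1}, by simp, fun x hx => ⟨1, by simp, by simpa using hx⟩⟩
  | succ m ih =>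
    obtain ⟨F, hF, h⟩ := ih
    refine ⟨(t ×ˢ F).image fun p => L.sc (m + 1) p.1 * p.2, ?_, fun x hx => ?_⟩
    · refine Finset.card_image_le.trans ?_
      rw [Finset.card_product, pow_succ, mul_comm]
      gcongr
    · have h1 : L.len (L.sc (-(m + 1)) x) ≤ 1 := by
        rw [len_sc, zpow_neg, inv_mul_le_iff₀ (zpow_pos L.lam_pos _), mul_one]
        exact_mod_cast hx
      obtain ⟨y, hy, hxy⟩ := Set.mem_iUnion₂.1 (ht h1)
      have hxy' : L.len (y⁻¹ * L.sc (-(m + 1)) x) ≤ lam⁻¹ := le_of_lt hxy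
      have h2 : L.len ((L.sc (m + 1) y)⁻¹ * x) ≤ lam ^ m := by
        have e : (L.sc (m + 1) y)⁻¹ * x = L.sc (m + 1) (y⁻¹ * L.sc (-(m + 1)) x) := by
          rw [map_mul, sc_sc_neg, map_inv]
        rw [e, len_sc]
        calc lam ^ ((m : ℤ) + 1) * _ ≤ lam ^ ((m : ℤ) + 1) * lam⁻¹ := by
              have := zpow_pos hl ((m : ℤ) + 1)
              gcongr
          _ = lam ^ m := by
              rw [zpow_add_one₀ hl.ne', mul_assoc, mul_inv_cancel₀ hl.ne', mul_one, zpow_natCast]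
      obtain ⟨f, hf, hf1⟩ := h _ h2
      refine ⟨_, Finset.mem_image_of_mem _ (Finset.mk_mem_product hy hf), ?_⟩
      simpa [mul_assoc] using hf1

theorem level_bound [ConnectedSpace M] {E : Set (ℝ → M)}
    (hE : E ⊆ L.PS) (hs0 : L.Sep E 0) : ∃ J, ∀ j ≥ J, L.WI (L.Cc j) = ⊥ := by
  obtain ⟨P, hP⟩ := L.cover
  have hlam1 : 1 < lam := by linarith [L.two_le]
  obtain ⟨J, hJ⟩ := pow_unbounded_of_one_lt (P : ℝ) hlam1
  refine ⟨J, fun j hj => ?_⟩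
  obtain ⟨hG, hs⟩ := ladder hE hs0 j
  by_contra hne
  obtain ⟨l, hl, hl0⟩ := Submodule.exists_mem_ne_zero_of_ne_bot hne
  have : ∃ b ∈ Bs E j, l (b 1) ≠ 0 := by
    by_contra hcon
    push Not at hcon
    exact hl0 (hs l hl hcon)
  obtain ⟨b, hb, hb0⟩ := this
  replace hb := Bs_mono hE j hb
  obtain ⟨K, hK⟩ := Bs_len hb
  obtain ⟨c, hc0, hc⟩ := W0_bdd hG.chain hl.1 2
  obtain ⟨a, ha⟩ := pow_unbounded_of_one_lt K hlam1
  set A := |l (b 1)| with hA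
  have hA0 : 0 < A := abs_pos.2 hb0
  have hPJ : (P : ℝ) < lam ^ (j + 1) :=
    hJ.trans_le (pow_le_pow_right₀ hlam1.le (by omega))
  set q := (P : ℝ) / lam ^ (j + 1) with hq
  have hlj : 0 < lam ^ (j + 1) := pow_pos L.lam_pos _
  have hq1 : q < 1 := by rw [hq, div_lt_one hlj]; exact hPJ
  have hq0 : 0 ≤ q := by positivity
  obtain ⟨k, hk⟩ : ∃ k : ℕ, (c + 1) * P ^ a / A * q ^ k < 1 := by
    have := (tendsto_pow_atTop_nhds_zero_of_lt_one hq0 hq1).const_mul ((c + 1) * P ^ a / A)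
    rw [mul_zero] at this
    exact (this.eventually_lt_const one_pos).exists
  have hk' : (c + 1) * (P : ℝ) ^ (k + a) / A ≤ (lam ^ k) ^ (j + 1) := by
    rw [hq, div_pow, ← pow_mul, mul_comm (j + 1), pow_mul, mul_div_assoc', div_lt_one (pow_pos (pow_pos L.lam_pos _) _)] at hk
    rw [pow_add]
    refine le_trans (le_of_eq ?_) hk.le
    ring
  obtain ⟨F, hF, hcov⟩ := hP (k + a)
  let sI : ℕ → ℝ := fun i => ((c + 1) * i / A) ^ (((j + 1 : ℕ) : ℝ)⁻¹)
  have hsI : ∀ i, sI i ^ (j + 1) = (c + 1) * i / A := fun i =>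
    Real.rpow_inv_natCast_pow (by positivity) (by omega)
  have hsI0 : ∀ i, 0 ≤ sI i := fun i => Real.rpow_nonneg (by positivity) _
  have hval : ∀ i, l (b (sI i)) = (c + 1) * i / A * l (b 1) := fun i => by
    rw [Bs_hom (fun i _ => (ladder hE hs0 i).1) hb hl, hsI]
  have hle : ∀ i ≤ P ^ (k + a), L.len (b (sI i)) ≤ lam ^ (k + a) := by
    intro i hi
    have h1 : sI i ≤ lam ^ k := by
      refine le_of_pow_le_pow_left₀ (n := j + 1) (by omega) (pow_nonneg L.lam_pos.le _) ?_
      rw [hsI]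
      refine le_trans ?_ hk'
      have : (i : ℝ) ≤ (P : ℝ) ^ (k + a) := by exact_mod_cast hi
      gcongr
    have h2 := hK (sI i)
    rw [abs_of_nonneg (hsI0 i)] at h2
    refine h2.trans ?_
    rw [pow_add, mul_comm]
    have := hsI0 i
    have := pow_pos L.lam_pos k
    calc sI i * K ≤ sI i * lam ^ a := by gcongr
      _ ≤ _ := by have := pow_pos L.lam_pos a; gcongr
  choose! f hf hf1 using hcov
  obtain ⟨i, hi, i', hi', hne', heq⟩ := Finset.exists_ne_map_eq_of_card_lt_of_maps_to
    (s := Finset.range (P ^ (k + a) + 1)) (t := F) (f := fun i => f (b (sI i)))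
    (by rw [Finset.card_range]; omega)
    (fun i hi => hf _ (hle i (by simpa [Nat.lt_succ_iff] using hi)))
  have hi1 := hle i (by simpa [Nat.lt_succ_iff] using hi)
  have hi2 := hle i' (by simpa [Nat.lt_succ_iff] using hi')
  have a1 := hf1 _ hi1
  have a2 := hf1 _ hi2
  rw [← heq] at a2
  have a3 : L.len ((b (sI i))⁻¹ * b (sI i')) ≤ 2 := by
    have e : (b (sI i))⁻¹ * b (sI i') = ((f (b (sI i)))⁻¹ * b (sI i))⁻¹ * ((f (b (sI i)))⁻¹ * b (sI i')) := by
      group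
    rw [e]
    have := L.len_mul ((f (b (sI i)))⁻¹ * b (sI i))⁻¹ ((f (b (sI i)))⁻¹ * b (sI i'))
    rw [L.len_inv] at this
    linarith
  have m1 := Bs_mem hb (sI i)
  have m2 := Bs_mem hb (sI i')
  have a4 := hc _ (Subgroup.mul_mem _ (Subgroup.inv_mem _ m1) m2) a3
  rw [W0_mul hl.1 (Subgroup.inv_mem _ m1) m2, W0_inv hl.1 m1, hval, hval] at a4
  have e : -((c + 1) * i / A * l (b 1)) + (c + 1) * i' / A * l (b 1)
      = (c + 1) * (((i' : ℤ) - (i : ℤ) : ℤ) : ℝ) * (l (b 1) / A) := by push_cast; ring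
  have e2 : |l (b 1) / A| = 1 := by rw [abs_div, abs_of_pos hA0, ← hA, div_self hA0.ne']
  rw [e, abs_mul, e2, mul_one, abs_mul, abs_of_pos (by linarith : 0 < c + 1)] at a4
  have a5 : (1 : ℝ) ≤ |(((i' : ℤ) - (i : ℤ) : ℤ) : ℝ)| := by
    rw [← Int.cast_abs]
    have a6 : ((i' : ℤ) - (i : ℤ)) ≠ 0 := by omega
    have a7 := Int.one_le_abs a6
    exact_mod_cast a7
  nlinarith

theorem terminate (hsep : ∀ x, L.len x = 0 → x = 1) [ConnectedSpace M] {E : Set (ℝ → M)}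
    (hE : E ⊆ L.PS) (hs0 : L.Sep E 0) : ∃ J, L.Cc J = ⊥ := by
  obtain ⟨J, hJ⟩ := level_bound hE hs0
  refine ⟨J, ?_⟩
  obtain ⟨hG, hs⟩ := ladder hE hs0 J
  by_contra hne
  obtain ⟨⟨z, hz⟩, hz1'⟩ := Subgroup.ne_bot_iff_exists_ne_one.1 hne
  have hz1 : z ≠ 1 := fun h => hz1' (Subtype.ext h)
  have hz0 : L.len z ≠ 0 := fun h => hz1 (hsep z h)
  obtain ⟨p, hp⟩ : ∃ p : Ultrafilter ℕ, (p : Filter ℕ) ≤ atTop := Ultrafilter.exists_le _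
  obtain ⟨_, l, hl, hl0, hinv⟩ := exists_invHom hG.inv hG.closed hG.chain hz hz0 p hp le_rfl
    (fun h _ => sep_sc hsep hp h) (fun g hg => ⟨g, hg, by simp [L.len_one]⟩)
  have hl' : l ∈ L.WI (L.Cc J) :=
    ⟨hl, fun g x hx => hinv g (fun x hx => hG.norm.conj_mem x hx g) (sep_sc hsep hp g) x hx⟩
  rw [hJ J le_rfl] at hl'
  exact hl0 hl'

end ladder
end LenData

open Filter Topology
open scoped commutatorElement
set_option linter.unusedSectionVars false

namespace LenData
section geo
variable {M : Type*} [Group M] [TopologicalSpace M] [IsTopologicalGroup M] {lam : ℝ}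
  {L : LenData M lam} {D : Subgroup M} {l : M → ℝ}

variable (L) in
/-- the length is geodesic -/
def Geo : Prop := ∀ x : M, ∃ γ : ℝ → M, γ 0 = 1 ∧ γ (L.len x) = x ∧
  ∀ s ∈ Set.Icc 0 (L.len x), ∀ t ∈ Set.Icc 0 (L.len x), L.len ((γ s)⁻¹ * γ t) = |s - t|

theorem balance {V : Type*} [NormedAddCommGroup V] [InnerProductSpace ℝ V] (Φ : M → V)
    (hΦ : ∀ x y, Φ (x * y) = Φ x + Φ y) {τ d : ℝ} (hd : ∀ y, L.len y ≤ τ → ‖Φ y‖ ≤ d)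
    (c : ℕ → M) (h0 : c 0 = 1) (hc : ∀ i, L.len ((c i)⁻¹ * c (i + 1)) ≤ τ) (N : ℕ) :
    ∃ h, L.len h ≤ N * τ ∧ ‖(2 : ℝ) • Φ h - Φ (c (2 * N))‖ ^ 2 ≤ N * (2 * d) ^ 2 := by
  have hΦ1 : Φ 1 = 0 := by
    have := hΦ 1 1
    rw [mul_one] at this; exact left_eq_add.1 this
  induction N with
  | zero => exact ⟨1, by simp [L.len_one], by simp [h0, hΦ1]⟩
  | succ N ih =>
    obtain ⟨h, h1, h2⟩ := ih
    set u := (c (2 * N))⁻¹ * c (2 * N + 1) with hu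
    set v := (c (2 * N + 1))⁻¹ * c (2 * N + 2) with hv
    have e : c (2 * (N + 1)) = c (2 * N) * (u * v) := by
      rw [hu, hv, mul_add]; group
    set S := (2 : ℝ) • Φ h - Φ (c (2 * N)) with hS
    have hul := hc (2 * N)
    have hvl := hc (2 * N + 1)
    have hd' : ‖Φ u - Φ v‖ ≤ 2 * d := by
      have := norm_sub_le (Φ u) (Φ v)
      have := hd u hul
      have := hd v hvl
      linarith
    have hdd : ‖Φ u - Φ v‖ ^ 2 ≤ (2 * d) ^ 2 := by gcongr
    by_cases hin : inner ℝ S (Φ u - Φ v) ≤ 0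
    · refine ⟨h * u, ?_, ?_⟩
      · have := L.len_mul h u
        push_cast; linarith
      · have e2 : (2 : ℝ) • Φ (h * u) - Φ (c (2 * (N + 1))) = S + (Φ u - Φ v) := by
          rw [e, hΦ h u, hΦ (c (2 * N)) (u * v), hΦ u v, hS, smul_add, two_smul ℝ (Φ u)]; abel
        rw [e2, norm_add_sq_real]
        push_cast; linarith
    · refine ⟨h * v, ?_, ?_⟩
      · have := L.len_mul h v
        push_cast; linarith
      · have e2 : (2 : ℝ) • Φ (h * v) - Φ (c (2 * (N + 1))) = S - (Φ u - Φ v) := by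
          rw [e, hΦ h v, hΦ (c (2 * N)) (u * v), hΦ u v, hS, smul_add, two_smul ℝ (Φ v)]; abel
        rw [e2, norm_sub_sq_real]
        push_cast; linarith

theorem halving (hgeo : L.Geo) (hch : L.Chain ⊤) (g : M) :
    ∃ h, L.len h ≤ L.len g / 2 ∧ ∀ l ∈ L.W0 ⊤, l h = l g / 2 := by
  haveI := W0_finite hch
  let β := Module.finBasis ℝ (L.W0 ⊤)
  set n := Module.finrank ℝ (L.W0 ⊤)
  let Φ : M → EuclideanSpace ℝ (Fin n) := fun x => WithLp.toLp 2 fun i => (β i : M → ℝ) x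
  have hΦ : ∀ x y, Φ (x * y) = Φ x + Φ y := by
    intro x y; ext i
    exact W0_mul (β i).2 trivial trivial
  choose B hB using fun i => (β i).2.2.1
  let C : ℝ := Real.sqrt (∑ i, (2 * B i) ^ 2)
  have hC : ∀ y, L.len y ≤ 1 → ‖Φ y‖ ≤ C * L.len y := by
    intro y hy
    have h1 : ‖Φ y‖ ^ 2 ≤ (C * L.len y) ^ 2 := by
      rw [EuclideanSpace.norm_sq_eq, mul_pow, Real.sq_sqrt (by positivity), Finset.sum_mul]
      refine Finset.sum_le_sum fun i _ => ?_
      rw [← mul_pow]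
      have := W0_lip (β i).2 one_pos (hB i) (Subgroup.mem_top y) hy
      rw [div_one] at this
      have h3 : ‖Φ y i‖ = |(β i : M → ℝ) y| := rfl
      rw [h3]; gcongr
    exact le_of_sq_le_sq h1 (mul_nonneg (Real.sqrt_nonneg _) (L.len_nonneg _))
  obtain ⟨γ, hγ0, hγ1, hγ⟩ := hgeo g
  set T := L.len g with hT
  have hT0 : 0 ≤ T := L.len_nonneg g
  have key : ∀ N : ℕ, T ≤ 2 * (N + 1) → ∃ h, L.len h ≤ T / 2 ∧
      ‖(2 : ℝ) • Φ h - Φ g‖ ^ 2 ≤ C ^ 2 * T ^ 2 / (N + 1) := by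
    intro N hN
    set τ := T / (2 * (N + 1)) with hτ
    have hN0 : (0 : ℝ) < N + 1 := by positivity
    have hτ0 : 0 ≤ τ := by positivity
    have hτ1 : τ ≤ 1 := by rw [hτ, div_le_one (by positivity)]; exact hN
    have hm : ∀ i : ℕ, min (i * τ) T ∈ Set.Icc 0 T := fun i => ⟨by positivity, min_le_right _ _⟩
    obtain ⟨h, h1, h2⟩ := balance (L := L) Φ hΦ (τ := τ) (d := C * τ) (fun y hy => (hC y (hy.trans hτ1)).trans (by
        have : 0 ≤ C := Real.sqrt_nonneg _
        gcongr)) (fun i => γ (min (i * τ) T))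
      (by simp [hγ0, hT0]) (fun i => by
        rw [hγ _ (hm i) _ (hm (i + 1))]
        refine (abs_min_sub_min_le_max _ _ _ _).trans ?_
        push_cast
        rw [sub_self, abs_zero, show (i : ℝ) * τ - (i + 1) * τ = -τ by ring, abs_neg, abs_of_nonneg hτ0]
        simp [hτ0]) (N + 1)
    refine ⟨h, h1.trans (le_of_eq ?_), ?_⟩
    · rw [hτ]; push_cast; field_simp
    · have e : γ (min (((2 * (N + 1) : ℕ) : ℝ) * τ) T) = g := by
        have : ((2 * (N + 1) : ℕ) : ℝ) * τ = T := by rw [hτ]; push_cast; field_simp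
        rw [this, min_self, hγ1]
      rw [e] at h2
      refine h2.trans (le_of_eq ?_)
      rw [hτ]; push_cast; field_simp
  choose! h hh1 hh2 using key
  obtain ⟨p, hp⟩ : ∃ p : Ultrafilter ℕ, (p : Filter ℕ) ≤ atTop := Ultrafilter.exists_le _
  have hev : ∀ᶠ N : ℕ in (p : Filter ℕ), T ≤ 2 * (N + 1) := by
    refine hp ?_
    obtain ⟨N0, hN0⟩ := exists_nat_ge T
    filter_upwards [eventually_ge_atTop N0] with N hN
    have : (N0 : ℝ) ≤ N := by exact_mod_cast hN
    have : (0 : ℝ) ≤ N := by positivity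
    linarith
  obtain ⟨x, hx, hxt⟩ := exists_ulim (L.len_proper (T / 2)) p h (hev.mono hh1)
  have hβ : ∀ i, (β i : M → ℝ) x = (β i : M → ℝ) g / 2 := by
    intro i
    have h1 := W0_tendsto' (β i).2 (Subgroup.mem_top x) (Eventually.of_forall fun _ => trivial) hxt
    have h2 : Tendsto (fun N => 2 * (β i : M → ℝ) (h N) - (β i : M → ℝ) g) p (𝓝 0) := by
      have h3 : Tendsto (fun N : ℕ => Real.sqrt (C ^ 2 * T ^ 2 / (N + 1))) p (𝓝 0) := by
        have : Tendsto (fun N : ℕ => C ^ 2 * T ^ 2 / ((N : ℝ) + 1)) atTop (𝓝 0) :=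
          tendsto_const_nhds.div_atTop (tendsto_atTop_add_const_right _ _ tendsto_natCast_atTop_atTop)
        have := (Real.continuous_sqrt.tendsto 0).comp this
        rw [Real.sqrt_zero] at this
        exact this.mono_left hp
      refine squeeze_zero_norm' ?_ h3
      filter_upwards [hev] with N hN
      have h4 := hh2 N hN
      have h5 : ‖2 * (β i : M → ℝ) (h N) - (β i : M → ℝ) g‖ ≤ ‖(2 : ℝ) • Φ (h N) - Φ g‖ :=
        PiLp.norm_apply_le ((2 : ℝ) • Φ (h N) - Φ g) i
      exact h5.trans (Real.le_sqrt_of_sq_le h4)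
    have h3 := tendsto_nhds_unique h2 ((h1.const_mul 2).sub_const _)
    linarith
  refine ⟨x, hx, fun l hl => ?_⟩
  have e : ∀ y, l y = ∑ i, β.repr ⟨l, hl⟩ i * (β i : M → ℝ) y := by
    intro y
    have h1 := congrArg (fun v : L.W0 ⊤ => (v : M → ℝ) y) (β.sum_repr ⟨l, hl⟩)
    simp only [] at h1
    rw [← h1, Submodule.coe_sum, Finset.sum_apply]
    rfl
  rw [e x, e g, Finset.sum_div]
  refine Finset.sum_congr rfl fun i _ => ?_
  rw [hβ i]; ring

theorem exists_PS [T2Space M] (hsep : ∀ x, L.len x = 0 → x = 1) (hgeo : L.Geo) (hch : L.Chain ⊤)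
    (g : M) : ∃ e ∈ L.PS, (∀ s, L.len (e s) ≤ |s| * L.len g) ∧ ∀ l ∈ L.W0 ⊤, l (e 1) = l g := by
  choose hf hf1 hf2 using halving hgeo hch
  let x : ℕ → M := fun k => hf^[k] g
  have hx1 : ∀ k, L.len (x k) ≤ L.len g / 2 ^ k := by
    intro k
    induction k with
    | zero => simp [x]
    | succ k ih =>
      simp only [x, Function.iterate_succ_apply'] at ih ⊢
      refine (hf1 _).trans ?_
      rw [pow_succ, ← div_div]; gcongr
  have hx2 : ∀ l ∈ L.W0 ⊤, ∀ k, l (x k) = l g / 2 ^ k := by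
    intro l hl k
    induction k with
    | zero => simp [x]
    | succ k ih =>
      simp only [x, Function.iterate_succ_apply'] at ih ⊢
      rw [hf2 _ l hl, ih, pow_succ, div_div]
  obtain ⟨p, hp⟩ : ∃ p : Ultrafilter ℕ, (p : Filter ℕ) ≤ atTop := Ultrafilter.exists_le _
  let y : ℝ → ℕ → M := fun s k => x k ^ ⌊(2 : ℝ) ^ k * s⌋
  have hy : ∀ s k, L.len (y s k) ≤ (|s| + (1 / 2) ^ k) * L.len g := by
    intro s k
    have h1 := L.len_zpow_le (x k) ⌊(2 : ℝ) ^ k * s⌋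
    have h2 : |((⌊(2 : ℝ) ^ k * s⌋ : ℤ) : ℝ)| ≤ 2 ^ k * |s| + 1 := by
      have a1 := Int.floor_le ((2 : ℝ) ^ k * s)
      have a2 := Int.lt_floor_add_one ((2 : ℝ) ^ k * s)
      have a3 : (2 : ℝ) ^ k * |s| = |(2 : ℝ) ^ k * s| := by rw [abs_mul, abs_of_pos (show (0 : ℝ) < 2 ^ k by positivity)]
      rw [a3, abs_le]
      have a4 := neg_abs_le ((2 : ℝ) ^ k * s)
      have a5 := le_abs_self ((2 : ℝ) ^ k * s)
      constructor <;> linarith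
    refine h1.trans ?_
    calc _ ≤ (2 ^ k * |s| + 1) * (L.len g / 2 ^ k) := by
          have := hx1 k
          have := L.len_nonneg (x k)
          gcongr
      _ = _ := by rw [one_div, inv_pow]; field_simp
  have hlim0 : Tendsto (fun k : ℕ => (1 / 2 : ℝ) ^ k) p (𝓝 0) :=
    (tendsto_pow_atTop_nhds_zero_of_lt_one (by norm_num) (by norm_num)).mono_left hp
  have hex : ∀ s, ∃ z, Tendsto (y s) p (𝓝 z) := by
    intro s
    obtain ⟨z, _, hz⟩ := exists_ulim (L.len_proper ((|s| + 1) * L.len g)) p (y s)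
      (Eventually.of_forall fun k => (hy s k).trans (by
        have := L.len_nonneg g
        have : (1 / 2 : ℝ) ^ k ≤ 1 := pow_le_one₀ (by norm_num) (by norm_num)
        gcongr))
    exact ⟨z, hz⟩
  choose e he using hex
  have hlen : ∀ s, L.len (e s) ≤ |s| * L.len g := by
    intro s
    have h1 := (L.len_cont.tendsto _).comp (he s)
    have h2 : Tendsto (fun k : ℕ => (|s| + (1 / 2) ^ k) * L.len g) p (𝓝 ((|s| + 0) * L.len g)) :=
      (hlim0.const_add _).mul_const _
    rw [add_zero] at h2
    exact le_of_tendsto_of_tendsto' h1 h2 fun k => hy s k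
  have hx0 : Tendsto (fun k => L.len (x k)) p (𝓝 0) := by
    have : Tendsto (fun k : ℕ => L.len g * (1 / 2) ^ k) p (𝓝 (L.len g * 0)) := hlim0.const_mul _
    rw [mul_zero] at this
    refine squeeze_zero (fun k => L.len_nonneg _) (fun k => (hx1 k).trans (le_of_eq ?_)) this
    rw [one_div, inv_pow]; rfl
  have hmul : ∀ s t, e (s + t) = e s * e t := by
    intro s t
    let m : ℕ → ℤ := fun k => ⌊(2 : ℝ) ^ k * (s + t)⌋ - ⌊(2 : ℝ) ^ k * s⌋ - ⌊(2 : ℝ) ^ k * t⌋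
    have h1 : Tendsto (fun k => x k ^ m k) p (𝓝 1) := by
      refine sep_tendsto hsep (squeeze_zero (fun k => L.len_nonneg _) (fun k => ?_) hx0)
      refine (L.len_zpow_le _ _).trans ?_
      have h2 : |((m k : ℤ) : ℝ)| ≤ 1 := by
        rw [← Int.cast_abs]
        have a1 := Int.le_floor_add ((2 : ℝ) ^ k * s) ((2 : ℝ) ^ k * t)
        have a2 := Int.le_floor_add_floor ((2 : ℝ) ^ k * s) ((2 : ℝ) ^ k * t)
        rw [← mul_add] at a1 a2
        have : |m k| ≤ 1 := by
          rw [abs_le]; simp only [m]; constructor <;> omega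
        exact_mod_cast this
      have := L.len_nonneg (x k)
      nlinarith
    have h2 := ((he s).mul (he t)).mul h1
    rw [mul_one] at h2
    refine tendsto_nhds_unique (he (s + t)) (h2.congr fun k => ?_)
    simp only [y, m]
    rw [← zpow_add, ← zpow_add]; congr 1; ring
  have he0 : e 0 = 1 := by
    have := hmul 0 0
    rw [add_zero] at this; exact left_eq_mul.1 this
  refine ⟨e, ⟨hmul, ?_, L.len g, fun s => by rw [mul_comm]; exact hlen s⟩, hlen, fun l hl => ?_⟩
  · rw [continuous_iff_continuousAt]
    intro s
    refine sep_tendsto' hsep ?_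
    have h3 : ∀ t, (e s)⁻¹ * e t = e (t - s) := fun t => by
      rw [inv_mul_eq_iff_eq_mul, ← hmul]; congr 1; ring
    simp only [h3]
    refine squeeze_zero (fun t => L.len_nonneg _) (fun t => hlen (t - s)) ?_
    have : Tendsto (fun t => |t - s| * L.len g) (𝓝 s) (𝓝 (|s - s| * L.len g)) := by
      apply Continuous.tendsto (f := fun t => |t - s| * L.len g); fun_prop
    simpa using this
  · have h1 := W0_tendsto' hl (Subgroup.mem_top (e 1)) (Eventually.of_forall fun _ => trivial) (he 1)
    have h2 : ∀ k, l (y 1 k) = l g := by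
      intro k
      have : ⌊(2 : ℝ) ^ k * 1⌋ = ((2 ^ k : ℕ) : ℤ) := by
        rw [mul_one]
        have : ((2 : ℝ) ^ k) = ((2 ^ k : ℕ) : ℝ) := by push_cast; rfl
        rw [this, Int.floor_natCast]
      simp only [y]
      rw [this, zpow_natCast, W0_pow hl (Subgroup.mem_top _), hx2 l hl]
      push_cast; field_simp
    simp only [h2] at h1
    exact tendsto_nhds_unique h1 tendsto_const_nhds

theorem sep_PS [T2Space M] (hsep : ∀ x, L.len x = 0 → x = 1) (hgeo : L.Geo) (hch : L.Chain ⊤) :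
    L.Sep L.PS 0 := by
  intro v hv h
  funext g
  obtain ⟨e, he, _, h1⟩ := exists_PS hsep hgeo hch g
  rw [← h1 v hv.1]; exact h e he
end geo
end LenData

open Filter Topology
open scoped commutatorElement
set_option linter.unusedSectionVars false

namespace LenData
section corr
variable {M Y : Type*} [Group M] [TopologicalSpace M] [IsTopologicalGroup M]
  [Group Y] [TopologicalSpace Y] [IsTopologicalGroup Y] {lam : ℝ}

/-- abstract correspondence between a group and itself, dilating by `t` -/
structure Corr (L : LenData M lam) (LY : LenData Y lam) (t : ℝ) where
  a : Y →* M
  b : Y →* M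
  a_cont : Continuous a
  b_cont : Continuous b
  len_eq : ∀ y, LY.len y = max (L.len (a y)) (L.len (b y))
  a_sc : ∀ k y, a (LY.sc k y) = L.sc k (a y)
  b_sc : ∀ k y, b (LY.sc k y) = L.sc k (b y)
  E : Set (ℝ → Y)
  hE : E ⊆ LY.PS
  E_a : ∀ e ∈ E, (fun s => a (e s)) ∈ L.PS
  E_b : ∀ e ∈ E, ∀ s, b (e s) = a (e (t * s))
  sep : LY.Sep E 0

variable {L : LenData M lam} {LY : LenData Y lam} {t : ℝ}

theorem Corr.len_a (c : Corr L LY t) (y : Y) : L.len (c.a y) ≤ LY.len y := by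
  rw [c.len_eq]; exact le_max_left _ _
theorem Corr.len_b (c : Corr L LY t) (y : Y) : L.len (c.b y) ≤ LY.len y := by
  rw [c.len_eq]; exact le_max_right _ _

theorem Corr.Bs_a (c : Corr L LY t) {j : ℕ} {β : ℝ → Y} (h : β ∈ Bs c.E j) :
    (fun s => c.a (β s)) ∈ Bs L.PS j ∧ ∀ s, c.b (β s) = c.a (β (t * s)) := by
  induction j generalizing β with
  | zero => exact ⟨c.E_a β h, c.E_b β h⟩
  | succ j ih =>
    obtain ⟨e, he, b, hb, rfl⟩ := h
    obtain ⟨h1, h2⟩ := ih hb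
    refine ⟨⟨_, c.E_a e he, _, h1, by funext s; rw [map_commutatorElement]⟩, fun s => ?_⟩
    simp only [map_commutatorElement, h2, c.E_b e he]

open Classical in
theorem Corr.pull (c : Corr L LY t) {i : ℕ} (hch : L.Chain (L.Cc i))
    (hm : ∀ y ∈ LY.Cc i, c.a y ∈ L.Cc i ∧ c.b y ∈ L.Cc i)
    {l : M → ℝ} (hl : l ∈ L.WI (L.Cc i)) (r s : ℝ) :
    (fun y => if y ∈ LY.Cc i then r * l (c.a y) + s * l (c.b y) else 0) ∈ LY.WI (LY.Cc i) := by
  refine ⟨⟨fun y hy y' hy' => ?_, ?_, fun y hy => if_neg hy⟩, fun g y hy => ?_⟩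
  · simp only [if_pos (mul_mem hy hy'), if_pos hy, if_pos hy', map_mul]
    rw [W0_mul hl.1 (hm y hy).1 (hm y' hy').1, W0_mul hl.1 (hm y hy).2 (hm y' hy').2]; ring
  · obtain ⟨B, hB0, hB⟩ := W0_bdd hch hl.1 1
    refine ⟨|r| * B + |s| * B, fun y hy hy1 => ?_⟩
    simp only [if_pos hy]
    refine (abs_add_le _ _).trans ?_
    rw [abs_mul, abs_mul]
    have h1 := hB _ (hm y hy).1 ((c.len_a y).trans hy1)
    have h2 := hB _ (hm y hy).2 ((c.len_b y).trans hy1)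
    gcongr
  · simp only [if_pos ((Cc_normal i).conj_mem y hy g), if_pos hy, map_mul, map_inv]
    rw [hl.2 _ _ (hm y hy).1, hl.2 _ _ (hm y hy).2]

theorem Corr.proj (c : Corr L LY t) [ConnectedSpace M] [ConnectedSpace Y] (hs0 : L.Sep L.PS 0) (i : ℕ) :
    (∀ y ∈ LY.Cc i, c.a y ∈ L.Cc i ∧ c.b y ∈ L.Cc i) ∧
    ∀ y ∈ LY.Cc i, ∀ l ∈ L.WI (L.Cc i), l (c.b y) = t ^ (i + 1) * l (c.a y) := by
  classical
  have hG := fun i => (ladder subset_rfl hs0 i).1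
  have step : ∀ i, (∀ y ∈ LY.Cc i, c.a y ∈ L.Cc i ∧ c.b y ∈ L.Cc i) →
      ∀ y ∈ LY.Cc i, ∀ l ∈ L.WI (L.Cc i), l (c.b y) = t ^ (i + 1) * l (c.a y) := by
    intro i hm y hy l hl
    have h1 := (ladder c.hE c.sep i).2 _ (c.pull (hG i).chain hm hl (-t ^ (i + 1)) 1) (by
      intro β hβ
      have h2 := c.Bs_a hβ
      have h3 := Bs_hom (fun i _ => hG i) h2.1 hl
      split_ifs
      · rw [h2.2, mul_one]
        have := h3 t
        rw [this]; ring
      · rfl)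
    have h2 := congrFun h1 y
    simp only [if_pos hy, Pi.zero_apply] at h2
    linarith
  refine ⟨?_, ?_⟩
  · induction i with
    | zero => intro y _; exact ⟨trivial, trivial⟩
    | succ i ih =>
      intro y hy
      refine ⟨⟨(ih y hy.1).1, fun l hl => ?_⟩, ⟨(ih y hy.1).2, fun l hl => ?_⟩⟩
      · have := hy.2 _ (c.pull (hG i).chain ih hl 1 0)
        simp only [if_pos hy.1] at this; linarith
      · have := hy.2 _ (c.pull (hG i).chain ih hl 0 1)
        simp only [if_pos hy.1] at this; linarith
  · refine step i ?_
    induction i with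
    | zero => intro y _; exact ⟨trivial, trivial⟩
    | succ i ih =>
      intro y hy
      refine ⟨⟨(ih y hy.1).1, fun l hl => ?_⟩, ⟨(ih y hy.1).2, fun l hl => ?_⟩⟩
      · have := hy.2 _ (c.pull (hG i).chain ih hl 1 0)
        simp only [if_pos hy.1] at this; linarith
      · have := hy.2 _ (c.pull (hG i).chain ih hl 0 1)
        simp only [if_pos hy.1] at this; linarith

theorem growth_contra {a K C2 : ℝ} {i j : ℕ} (hij : i < j) (ha : 0 < a) (hK : 0 ≤ K) (hC2 : 0 ≤ C2)
    (r : ℕ → ℝ) (hr : ∀ n, 0 ≤ r n) (h1 : ∀ n : ℕ, 1 ≤ n → r n ^ (j + 1) ≤ K * n)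
    (h2 : ∀ n : ℕ, n * a ≤ C2 * r n ^ (i + 1)) : False := by
  obtain ⟨n, hn⟩ := exists_nat_gt (C2 ^ (j + 1) * K ^ (i + 1) / a ^ (j + 1))
  have hn0 : (0 : ℝ) < n := lt_of_le_of_lt (by positivity) hn
  have hn1 : 1 ≤ n := by
    have : 0 < n := by exact_mod_cast hn0
    omega
  rw [div_lt_iff₀ (by positivity)] at hn
  have h3 : (n * a) ^ (j + 1) ≤ (C2 * r n ^ (i + 1)) ^ (j + 1) := by
    have := h2 n
    gcongr
  have h4 : (C2 * r n ^ (i + 1)) ^ (j + 1) = C2 ^ (j + 1) * (r n ^ (j + 1)) ^ (i + 1) := by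
    rw [mul_pow, ← pow_mul, ← pow_mul, mul_comm (i + 1)]
  have h5 : (r n ^ (j + 1)) ^ (i + 1) ≤ (K * n) ^ (i + 1) := by
    have := h1 n hn1
    have := hr n
    gcongr
  have h6 : ((n : ℝ)) ^ (i + 1) ≤ n ^ j := by
    have : (1 : ℝ) ≤ n := by exact_mod_cast hn1
    exact pow_le_pow_right₀ this (by omega)
  have h7 : (n * a) ^ (j + 1) ≤ (C2 ^ (j + 1) * K ^ (i + 1)) * n ^ j := by
    calc (n * a) ^ (j + 1) ≤ C2 ^ (j + 1) * (K * n) ^ (i + 1) := by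
          rw [h4] at h3
          refine h3.trans ?_
          gcongr
      _ = (C2 ^ (j + 1) * K ^ (i + 1)) * n ^ (i + 1) := by rw [mul_pow]; ring
      _ ≤ _ := by gcongr
  have h8 : (n * a) ^ (j + 1) = (n * a ^ (j + 1)) * n ^ j := by ring
  rw [h8] at h7
  have := le_of_mul_le_mul_right h7 (by positivity)
  linarith

theorem Corr.inj (c : Corr L LY t) [ConnectedSpace M] [ConnectedSpace Y] [T2Space M]
    (hsep : ∀ x, L.len x = 0 → x = 1) (hY : ∀ y, LY.len y = 0 → y = 1)
    (hs0 : L.Sep L.PS 0) (y : Y) (hy : c.a y = 1) : y = 1 := by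
  have hG := fun i => (ladder subset_rfl hs0 i).1
  have hkb : ∀ y, c.a y = 1 → LY.len y = L.len (c.b y) := by
    intro y h
    rw [c.len_eq, h, L.len_one, max_eq_right (L.len_nonneg _)]
  by_contra hne0
  -- choose the level in the base
  have hex : ∃ j, ∀ u, c.a u = 1 → c.b u ∈ L.Cc (j + 1) → u = 1 := by
    obtain ⟨J, hJ⟩ := terminate hsep subset_rfl hs0
    refine ⟨J, fun u h1 h2 => hY u ?_⟩
    have h3 := Cc_anti (Nat.le_succ J) h2
    rw [hJ, Subgroup.mem_bot] at h3
    rw [hkb u h1, h3, L.len_one]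
  classical
  set j := Nat.find hex with hj
  have hj1 := Nat.find_spec hex
  rw [← hj] at hj1
  obtain ⟨u, hu1, hu2, hu3⟩ : ∃ u, c.a u = 1 ∧ c.b u ∈ L.Cc j ∧ u ≠ 1 := by
    rcases Nat.eq_zero_or_pos j with h | h
    · exact ⟨y, hy, by rw [h]; trivial, hne0⟩
    · have := Nat.find_min hex (m := j - 1) (by omega)
      push Not at this
      rwa [Nat.sub_add_cancel h] at this
  -- choose the level upstairs
  have hexY : ∃ i, u ∉ LY.Cc (i + 1) := by
    obtain ⟨J, hJ⟩ := terminate hY c.hE c.sep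
    refine ⟨J, fun h => hu3 ?_⟩
    have h3 := Cc_anti (Nat.le_succ J) h
    rwa [hJ, Subgroup.mem_bot] at h3
  set i := Nat.find hexY with hi
  have hi1 := Nat.find_spec hexY
  rw [← hi] at hi1
  have hi2 : u ∈ LY.Cc i := by
    rcases Nat.eq_zero_or_pos i with h | h
    · rw [h]; trivial
    · have := Nat.find_min hexY (m := i - 1) (by omega)
      rw [Nat.sub_add_cancel h] at this
      exact not_not.1 this
  obtain ⟨hp1, hp2⟩ := c.proj hs0 i
  have hui : c.b u ∈ L.Cc (i + 1) := by
    refine ⟨(hp1 u hi2).2, fun l hl => ?_⟩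
    rw [hp2 u hi2 l hl, hu1, W0_one hl.1, mul_zero]
  have hij : i < j := by
    by_contra h
    exact hu3 (hj1 u hu1 (Cc_anti (by omega) hui))
  obtain ⟨l', hl', hl'u⟩ : ∃ l' ∈ LY.WI (LY.Cc i), l' u ≠ 0 := by
    by_contra h
    push Not at h
    exact hi1 ⟨hi2, h⟩
  obtain ⟨C2, hC2, hw⟩ := weight hY c.hE c.sep hl'
  -- functionals at level j
  haveI := WI_finite (hG j).chain
  let β := Module.finBasis ℝ (L.WI (L.Cc j))
  let G : Y → ℝ := fun v => ∑ k, |(β k : M → ℝ) (c.b v)|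
  have hGpos : ∀ v, c.a v = 1 → c.b v ∈ L.Cc j → v ≠ 1 → 0 < G v := by
    intro v h1 h2 h3
    have h0 : 0 ≤ G v := Finset.sum_nonneg fun k _ => abs_nonneg _
    refine lt_of_le_of_ne h0 fun h => h3 (hj1 v h1 ⟨h2, fun l hl => ?_⟩)
    have hz : ∀ k, (β k : M → ℝ) (c.b v) = 0 := by
      intro k
      have := (Finset.sum_eq_zero_iff_of_nonneg (fun k _ => abs_nonneg _)).1 h.symm k (Finset.mem_univ k)
      exact abs_eq_zero.1 this
    have h1 := congrArg (fun v' : L.WI (L.Cc j) => (v' : M → ℝ) (c.b v)) (β.sum_repr ⟨l, hl⟩)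
    simp only [] at h1
    rw [← h1, Submodule.coe_sum, Finset.sum_apply]
    refine Finset.sum_eq_zero fun k _ => ?_
    change _ * (β k : M → ℝ) (c.b v) = 0
    rw [hz k, mul_zero]
  let A : Set Y := {v | c.a v = 1 ∧ c.b v ∈ L.Cc j}
  have hA : IsClosed A := by
    refine IsClosed.and (isClosed_singleton.preimage c.a_cont) ((hG j).closed.preimage c.b_cont)
  have hGc : ContinuousOn G A := by
    refine continuousOn_finset_sum _ fun k _ => ContinuousOn.abs ?_
    exact (W0_contOn (β k).2.1).comp c.b_cont.continuousOn fun v hv => hv.2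
  have hlp := L.lam_pos
  obtain ⟨cc, hcc, hshell⟩ : ∃ cc > 0, ∀ v ∈ A, lam⁻¹ ≤ LY.len v → LY.len v ≤ 1 → cc ≤ G v := by
    let S : Set Y := {v | LY.len v ≤ 1} ∩ (A ∩ {v | lam⁻¹ ≤ LY.len v})
    have hS : IsCompact S := (LY.len_proper 1).inter_right
      (hA.inter (isClosed_le continuous_const LY.len_cont))
    rcases S.eq_empty_or_nonempty with h | h
    · refine ⟨1, one_pos, fun v h1 h2 h3 => ?_⟩
      have : v ∈ S := ⟨h3, h1, h2⟩
      rw [h] at this; exact this.elim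
    · obtain ⟨v0, hv0, hmin⟩ := hS.exists_isMinOn h (hGc.mono fun v hv => hv.2.1)
      refine ⟨G v0, hGpos v0 hv0.2.1.1 hv0.2.1.2 ?_, fun v h1 h2 h3 => hmin ⟨h3, h1, h2⟩⟩
      rintro rfl
      have := hv0.2.2
      simp only [Set.mem_setOf_eq, LY.len_one] at this
      have := inv_pos.2 hlp
      linarith
  have hwt : ∃ C, 0 ≤ C ∧ ∀ v ∈ A, G v ≤ C * LY.len v ^ (j + 1) := by
    choose C hC0 hC using fun k => weight hsep subset_rfl hs0 (β k).2
    refine ⟨∑ k, C k, Finset.sum_nonneg fun k _ => hC0 k, fun v hv => ?_⟩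
    rw [Finset.sum_mul]
    refine Finset.sum_le_sum fun k _ => ?_
    rw [hkb v hv.1]; exact hC k _ hv.2
  obtain ⟨C, hC0, hC⟩ := hwt
  have hscA : ∀ v ∈ A, ∀ k, LY.sc k v ∈ A := by
    intro v hv k
    refine ⟨by rw [c.a_sc, hv.1, map_one], ?_⟩
    rw [c.b_sc]; exact (hG j).inv k _ hv.2
  have hGn : ∀ v ∈ A, ∀ n : ℕ, G (v ^ n) = n * G v := by
    intro v hv n
    simp only [G, Finset.mul_sum]
    refine Finset.sum_congr rfl fun k _ => ?_
    rw [map_pow, W0_pow (β k).2.1 hv.2, abs_mul, abs_of_nonneg (Nat.cast_nonneg n)]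
  have huA : u ∈ A := ⟨hu1, hu2⟩
  have hpowA : ∀ v ∈ A, ∀ n : ℕ, v ^ n ∈ A := fun v hv n =>
    ⟨by rw [map_pow, hv.1, one_pow], by rw [map_pow]; exact pow_mem hv.2 n⟩
  refine growth_contra hij (abs_pos.2 hl'u) (K := C * LY.len u ^ (j + 1) / cc)
    (by have := LY.len_nonneg u; positivity) hC2
    (fun n => LY.len (u ^ n)) (fun n => LY.len_nonneg _) ?_ ?_
  · intro n hn
    have hpos : 0 < LY.len (u ^ n) := by
      refine lt_of_le_of_ne (LY.len_nonneg _) fun h => ?_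
      have h1 := hGn u huA n
      rw [hY _ h.symm] at h1
      have h2 : G 1 = 0 := by
        have := hGn u huA 0
        simpa using this
      have h3 := hGpos u hu1 hu2 hu3
      have : (1 : ℝ) ≤ n := by exact_mod_cast hn
      nlinarith
    obtain ⟨m, hm1, hm2⟩ := exists_mem_Ico_zpow hpos (show 1 < lam by linarith [L.two_le])
    set q := lam ^ (-(m + 1)) with hq
    have hq0 : 0 < q := zpow_pos hlp _
    have hqe : q * lam ^ (m + 1) = 1 := by rw [hq, ← zpow_add₀ hlp.ne', neg_add_cancel, zpow_zero]
    have hqe' : q * lam ^ m = lam⁻¹ := by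
      rw [hq, ← zpow_add₀ hlp.ne', show -(m + 1) + m = -1 by ring, zpow_neg_one]
    have hw1 := hshell (LY.sc (-(m + 1)) (u ^ n)) (hscA _ (hpowA u huA n) _) (by
        rw [len_sc, ← hq, ← hqe']; gcongr) (by
        rw [len_sc, ← hq, ← hqe]; gcongr)
    rw [map_pow, hGn _ (hscA u huA _)] at hw1
    have hw2 := hC _ (hscA u huA (-(m + 1)))
    rw [len_sc, ← hq] at hw2
    have hw3 : cc ≤ n * (C * (q * LY.len u) ^ (j + 1)) := hw1.trans (by gcongr)
    have hw4 : q * LY.len (u ^ n) ≤ 1 := by rw [← hqe]; gcongr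
    have hw5 : (q * LY.len (u ^ n)) ^ (j + 1) ≤ 1 := pow_le_one₀ (by positivity) hw4
    have hlu := LY.len_nonneg u
    rw [div_mul_eq_mul_div, le_div_iff₀ hcc]
    calc LY.len (u ^ n) ^ (j + 1) * cc
        ≤ LY.len (u ^ n) ^ (j + 1) * (n * (C * (q * LY.len u) ^ (j + 1))) := by gcongr
      _ = (q * LY.len (u ^ n)) ^ (j + 1) * (C * LY.len u ^ (j + 1) * n) := by
          rw [mul_pow, mul_pow]; ring
      _ ≤ 1 * (C * LY.len u ^ (j + 1) * n) := by gcongr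
      _ = _ := one_mul _
  · intro n
    have h1 := hw (u ^ n) (pow_mem hi2 n)
    rwa [W0_pow hl'.1 hi2, abs_mul, abs_of_nonneg (Nat.cast_nonneg n)] at h1
end corr
end LenData

open Filter Topology
open scoped commutatorElement
set_option linter.unusedSectionVars false

namespace LenData
section graph
variable {M : Type*} [Group M] [TopologicalSpace M] [IsTopologicalGroup M] {lam : ℝ}

/-- product -/
def prd (L : LenData M lam) : LenData (M × M) lam where
  two_le := L.two_le
  len p := max (L.len p.1) (L.len p.2)
  δ := MulEquiv.prodCongr L.δ L.δ
  len_one := by simp [L.len_one]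
  len_inv p := by simp [L.len_inv]
  len_mul p q := by
    refine max_le ?_ ?_
    · exact (L.len_mul _ _).trans (add_le_add (le_max_left _ _) (le_max_left _ _))
    · exact (L.len_mul _ _).trans (add_le_add (le_max_right _ _) (le_max_right _ _))
  len_cont := (L.len_cont.comp continuous_fst).max (L.len_cont.comp continuous_snd)
  len_proper r := by
    have : {p : M × M | max (L.len p.1) (L.len p.2) ≤ r} = {x | L.len x ≤ r} ×ˢ {x | L.len x ≤ r} := by
      ext p; simp
    rw [this]; exact (L.len_proper r).prod (L.len_proper r)
  δ_cont := (L.δ_cont.comp continuous_fst).prodMk (L.δ_cont.comp continuous_snd)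
  δ_symm_cont := (L.δ_symm_cont.comp continuous_fst).prodMk (L.δ_symm_cont.comp continuous_snd)
  len_δ p := by
    change max (L.len (L.δ p.1)) (L.len (L.δ p.2)) = _
    rw [L.len_δ, L.len_δ, mul_max_of_nonneg _ _ L.lam_pos.le]

variable {L : LenData M lam} {t : ℝ}

theorem prd_sc (k : ℤ) (p : M × M) : L.prd.sc k p = (L.sc k p.1, L.sc k p.2) := by
  induction k using Int.induction_on with
  | zero => simp [sc_zero]
  | succ n ih => rw [add_comm, sc_add, sc_add, sc_add, sc_one, sc_one, sc_one, ih]; rfl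
  | pred n ih =>
    rw [sub_eq_add_neg, add_comm, sc_add, sc_add, sc_add, sc_neg_one, sc_neg_one, sc_neg_one, ih]; rfl

variable (L t) in
/-- the closed subgroup generated by the pairs `(e 1, e t)` -/
def Yg : Subgroup (M × M) :=
  (Subgroup.closure {p | ∃ e ∈ L.PS, p = (e 1, e t)}).topologicalClosure

theorem Yg_closed : IsClosed (L.Yg t : Set (M × M)) := Subgroup.isClosed_topologicalClosure _

theorem Yg_gen {e : ℝ → M} (he : e ∈ L.PS) (s : ℝ) : (e s, e (t * s)) ∈ L.Yg t := by
  refine Subgroup.le_topologicalClosure _ (Subgroup.subset_closure ⟨_, PS_scale he s, ?_⟩)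
  rw [mul_one, mul_comm]

theorem Yg_gen1 {e : ℝ → M} (he : e ∈ L.PS) : (e 1, e t) ∈ L.Yg t := by
  have := Yg_gen (t := t) he 1
  rwa [mul_one] at this

theorem Yg_le {H : Subgroup (M × M)} (hc : IsClosed (H : Set (M × M)))
    (h : ∀ e ∈ L.PS, (e 1, e t) ∈ H) : L.Yg t ≤ H := by
  refine Subgroup.topologicalClosure_minimal _ ((Subgroup.closure_le _).2 ?_) hc
  rintro _ ⟨e, he, rfl⟩; exact h e he

theorem Yg_inv : L.prd.Inv (L.Yg t) := by
  intro k
  have : L.Yg t ≤ (L.Yg t).comap (L.prd.sc k).toMonoidHom := by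
    refine Yg_le (Yg_closed.preimage (L.prd.sc_cont k)) fun e he => ?_
    change L.prd.sc k (e 1, e t) ∈ L.Yg t
    rw [prd_sc]
    exact Yg_gen1 (PS_sc he k)
  exact this

theorem Yg_swap (ht : t ≠ 0) {x y : M} (h : (x, y) ∈ L.Yg t) : (y, x) ∈ L.Yg t⁻¹ := by
  have : L.Yg t ≤ (L.Yg t⁻¹).comap (MulEquiv.prodComm : M × M ≃* M × M).toMonoidHom := by
    refine Yg_le (Yg_closed.preimage continuous_swap) fun e he => ?_
    change (e t, e 1) ∈ L.Yg t⁻¹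
    have := Yg_gen (t := t⁻¹) he t
    rwa [inv_mul_cancel₀ ht] at this
  exact this h

theorem Yg_top {C : Subgroup (L.Yg t)} (hC : IsClosed (C : Set (L.Yg t)))
    (h : ∀ e, ∀ he : e ∈ L.PS, (⟨(e 1, e t), Yg_gen1 he⟩ : L.Yg t) ∈ C) (y : L.Yg t) : y ∈ C := by
  have h1 : L.Yg t ≤ C.map (L.Yg t).subtype := by
    refine Yg_le ?_ fun e he => ⟨_, h e he, rfl⟩
    exact (Yg_closed.isClosedEmbedding_subtypeVal).isClosedMap _ hC
  obtain ⟨z, hz, hzy⟩ := h1 y.2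
  have : z = y := Subtype.ext hzy
  rwa [← this]

variable (L t) in
/-- length data on the graph -/
noncomputable def LY : LenData (L.Yg t) lam := L.prd.sub (L.Yg t) Yg_inv Yg_closed

/-- generating curve -/
def gcur {e : ℝ → M} (he : e ∈ L.PS) (t : ℝ) : ℝ → L.Yg t := fun s => ⟨(e s, e (t * s)), Yg_gen he s⟩

theorem gcur_PS {e : ℝ → M} (he : e ∈ L.PS) : gcur he t ∈ (L.LY t).PS := by
  have h2 := PS_scale he t
  refine ⟨fun s s' => ?_, ?_, ?_⟩
  · refine Subtype.ext (Prod.ext (he.1 s s') ?_)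
    exact h2.1 s s'
  · exact Continuous.subtype_mk (he.2.1.prodMk h2.2.1) _
  · obtain ⟨K, hK⟩ := he.2.2
    obtain ⟨K', hK'⟩ := h2.2.2
    refine ⟨max K K', fun s => ?_⟩
    change max (L.len (e s)) (L.len (e (t * s))) ≤ _
    refine max_le ((hK s).trans ?_) ((hK' s).trans ?_)
    · have := le_max_left K K'
      gcongr
    · have := le_max_right K K'
      gcongr

instance Yg_conn : ConnectedSpace (L.Yg t) := by
  have h : ∀ y : L.Yg t, y ∈ Subgroup.connectedComponentOfOne (L.Yg t) := by
    refine Yg_top isClosed_connectedComponent fun e he => ?_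
    have hc : IsPreconnected (Set.range (gcur he t)) := isPreconnected_range (gcur_PS he).2.1
    have h1 : (1 : L.Yg t) ∈ Set.range (gcur he t) := ⟨0, PS_zero (gcur_PS he)⟩
    refine hc.subset_connectedComponent h1 ⟨1, ?_⟩
    simp [gcur]
  refine connectedSpace_iff_connectedComponent.2 ⟨1, Set.eq_univ_of_forall h⟩

/-- the correspondence -/
noncomputable def corr (L : LenData M lam) (t : ℝ) : Corr L (L.LY t) t where
  a := (MonoidHom.fst M M).comp (L.Yg t).subtype
  b := (MonoidHom.snd M M).comp (L.Yg t).subtype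
  a_cont := continuous_fst.comp continuous_subtype_val
  b_cont := continuous_snd.comp continuous_subtype_val
  len_eq y := rfl
  a_sc k y := by
    have := sub_sc (L := L.prd) Yg_inv Yg_closed k y
    rw [prd_sc] at this
    exact congrArg Prod.fst this
  b_sc k y := by
    have := sub_sc (L := L.prd) Yg_inv Yg_closed k y
    rw [prd_sc] at this
    exact congrArg Prod.snd this
  E := {c | ∃ e, ∃ he : e ∈ L.PS, c = gcur he t}
  hE := by rintro _ ⟨e, he, rfl⟩; exact gcur_PS he
  E_a := by rintro _ ⟨e, he, rfl⟩; exact he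
  E_b := by rintro _ ⟨e, he, rfl⟩ s; rfl
  sep := by
    intro v hv h
    funext y
    let C : Subgroup (L.Yg t) :=
      { carrier := {y | v y = 0}
        one_mem' := W0_one hv.1
        mul_mem' := fun {x y} hx hy => by
          have := W0_mul hv.1 (Subgroup.mem_top x) (Subgroup.mem_top y)
          simp only [Set.mem_setOf_eq] at hx hy ⊢
          rw [this, hx, hy, add_zero]
        inv_mem' := fun {x} hx => by
          have := W0_inv hv.1 (Subgroup.mem_top x)
          simp only [Set.mem_setOf_eq] at hx ⊢
          rw [this, hx, neg_zero] }
    have hcont : Continuous v := by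
      have := W0_contOn hv.1
      rw [← continuousOn_univ]; exact this
    refine Yg_top (C := C) (isClosed_singleton.preimage hcont) (fun e he => ?_) y
    have := h _ ⟨e, he, rfl⟩
    simp only [gcur, mul_one] at this
    exact this

theorem Yg_unique [ConnectedSpace M] [T2Space M] (hsep : ∀ x, L.len x = 0 → x = 1)
    (hs0 : L.Sep L.PS 0) {x y y' : M} (h : (x, y) ∈ L.Yg t) (h' : (x, y') ∈ L.Yg t) : y = y' := by
  have h1 : (1, y⁻¹ * y') ∈ L.Yg t := by
    have := mul_mem (inv_mem h) h'
    simpa using this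
  have hY : ∀ z, (L.LY t).len z = 0 → z = 1 := by
    intro z hz
    change max (L.len z.1.1) (L.len z.1.2) = 0 at hz
    have a1 := le_max_left (L.len z.1.1) (L.len z.1.2)
    have a2 := le_max_right (L.len z.1.1) (L.len z.1.2)
    have a3 := L.len_nonneg z.1.1
    have a4 := L.len_nonneg z.1.2
    exact Subtype.ext (Prod.ext (hsep _ (by linarith)) (hsep _ (by linarith)))
  have h2 := (corr L t).inj hsep hY hs0 ⟨_, h1⟩ rfl
  have h3 : y⁻¹ * y' = 1 := congrArg (fun z : L.Yg t => z.1.2) h2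
  exact inv_mul_eq_one.1 h3
end graph
end LenData

open Filter Topology
open scoped commutatorElement
set_option linter.unusedSectionVars false

namespace LenData
section curve
variable {M : Type*} [Group M] [TopologicalSpace M] [IsTopologicalGroup M] {lam : ℝ}
  {L : LenData M lam} {t : ℝ}

theorem quad_const {φ : ℝ → ℝ} {T C : ℝ} (hC : 0 ≤ C) (h0 : φ 0 = 0)
    (h : ∀ s ∈ Set.Icc 0 T, ∀ s' ∈ Set.Icc 0 T, |φ s' - φ s| ≤ C * |s' - s| ^ 2) {s : ℝ}
    (hs : s ∈ Set.Icc 0 T) : φ s = 0 := by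
  have key : ∀ n : ℕ, |φ s| ≤ C * s ^ 2 / (n + 1) := by
    intro n
    have hn : (0 : ℝ) < n + 1 := by positivity
    set d := s / (n + 1) with hd
    have hd0 : 0 ≤ d := div_nonneg hs.1 hn.le
    have hds : (n + 1) * d = s := by rw [hd]; field_simp
    have hmem : ∀ k : ℕ, k ≤ n + 1 → k * d ∈ Set.Icc 0 T := by
      intro k hk
      have : (k : ℝ) ≤ n + 1 := by exact_mod_cast hk
      refine ⟨by positivity, ?_⟩
      have : k * d ≤ (n + 1) * d := by gcongr
      linarith [hs.2]
    have hk : ∀ k : ℕ, k ≤ n + 1 → |φ (k * d)| ≤ k * (C * d ^ 2) := by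
      intro k
      induction k with
      | zero => intro _; simp [h0]
      | succ k ih =>
        intro hk
        have h1 := ih (by omega)
        have h2 := h _ (hmem k (by omega)) _ (hmem (k + 1) hk)
        have h3 : ((k + 1 : ℕ) : ℝ) * d - k * d = d := by push_cast; ring
        rw [h3, sq_abs] at h2
        have h4 := abs_sub_abs_le_abs_sub (φ (((k + 1 : ℕ) : ℝ) * d)) (φ (k * d))
        push_cast at *
        linarith
    have h1 := hk (n + 1) le_rfl
    push_cast at h1
    rw [hds] at h1
    refine h1.trans (le_of_eq ?_)
    rw [hd]; field_simp
  have hlim : Tendsto (fun n : ℕ => C * s ^ 2 / ((n : ℝ) + 1)) atTop (𝓝 0) :=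
    tendsto_const_nhds.div_atTop (tendsto_atTop_add_const_right _ _ tendsto_natCast_atTop_atTop)
  have := ge_of_tendsto' hlim key
  exact abs_eq_zero.1 (le_antisymm this (abs_nonneg _))

theorem curve_unique (hsep : ∀ x, L.len x = 0 → x = 1) [ConnectedSpace M] (hs0 : L.Sep L.PS 0)
    {T : ℝ} (b γ : ℝ → M) (hb0 : b 0 = 1) (hγ0 : γ 0 = 1)
    (hb : ∀ s ∈ Set.Icc 0 T, ∀ s' ∈ Set.Icc 0 T, L.len ((b s)⁻¹ * b s') ≤ |s' - s|)
    (hγ : ∀ s ∈ Set.Icc 0 T, ∀ s' ∈ Set.Icc 0 T, L.len ((γ s)⁻¹ * γ s') ≤ |s' - s|)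
    (hl : ∀ s ∈ Set.Icc 0 T, ∀ l ∈ L.W0 ⊤, l (b s) = l (γ s)) {s : ℝ} (hs : s ∈ Set.Icc 0 T) :
    b s = γ s := by
  have key : ∀ j, ∀ s ∈ Set.Icc 0 T, (b s)⁻¹ * γ s ∈ L.Cc j := by
    intro j
    induction j with
    | zero => intro s _; trivial
    | succ j ih =>
      intro s hs
      refine ⟨ih s hs, fun l hlW => ?_⟩
      rcases Nat.eq_zero_or_pos j with rfl | hj
      · have h1 := W0_mul hlW.1 (Subgroup.mem_top (b s)⁻¹) (Subgroup.mem_top (γ s))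
        have h2 := W0_inv hlW.1 (Subgroup.mem_top (b s))
        have h3 := hl s hs l hlW.1
        rw [h1, h2, h3]; ring
      · obtain ⟨C, hC0, hC⟩ := weight hsep subset_rfl hs0 hlW
        have hT : 0 ≤ T := hs.1.trans hs.2
        refine quad_const (φ := fun s => l ((b s)⁻¹ * γ s)) (T := T) (C := C * (4 * (2 * T) ^ (j - 1)))
          (by positivity) (by simp only [hb0, hγ0, inv_one, mul_one]; exact W0_one hlW.1) ?_ hs
        intro s hs s' hs'
        have hz := ih s hs
        have hz' := ih s' hs'
        set z := (b s)⁻¹ * γ s with hzd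
        set z' := (b s')⁻¹ * γ s' with hzd'
        set p := (b s)⁻¹ * b s' with hpd
        set q := (γ s)⁻¹ * γ s' with hqd
        have hp := hb s hs s' hs'
        have hq := hγ s hs s' hs'
        have e : z⁻¹ * z' = (⁅p⁻¹, z⁻¹⁆)⁻¹ * (p⁻¹ * q) := by
          rw [commutatorElement_def, hpd, hqd, hzd, hzd']; group
        have hcm := comm_mem_D (Cc_normal (L := L) j) p⁻¹ (inv_mem hz)
        have hc0 := WI_comm (Cc_normal (L := L) j) hlW p⁻¹ (inv_mem hz)
        have hpq : p⁻¹ * q ∈ L.Cc j := by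
          have : p⁻¹ * q = ⁅p⁻¹, z⁻¹⁆ * (z⁻¹ * z') := by rw [e]; group
          rw [this]; exact mul_mem hcm (mul_mem (inv_mem hz) hz')
        have h1 : l (z⁻¹ * z') = l (p⁻¹ * q) := by
          rw [e, W0_mul hlW.1 (inv_mem hcm) hpq, W0_inv hlW.1 hcm, hc0]; ring
        rw [W0_mul hlW.1 (inv_mem hz) hz', W0_inv hlW.1 hz] at h1
        have h2 : l z' - l z = l (p⁻¹ * q) := by linarith
        change |l z' - l z| ≤ _
        rw [h2]
        have h3 : L.len (p⁻¹ * q) ≤ 2 * |s' - s| := by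
          have := L.len_mul p⁻¹ q
          rw [L.len_inv] at this; linarith
        have h4 : |s' - s| ≤ T := by
          rw [abs_le]; constructor <;> linarith [hs.1, hs.2, hs'.1, hs'.2]
        calc |l (p⁻¹ * q)| ≤ C * L.len (p⁻¹ * q) ^ (j + 1) := hC _ hpq
          _ ≤ C * (2 * |s' - s|) ^ (j + 1) := by
            have := L.len_nonneg (p⁻¹ * q)
            gcongr
          _ = C * ((2 * |s' - s|) ^ 2 * (2 * |s' - s|) ^ (j - 1)) := by
            rw [← pow_add]; congr 2; omega
          _ ≤ C * ((2 * |s' - s|) ^ 2 * (2 * T) ^ (j - 1)) := by gcongr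
          _ = _ := by ring
  obtain ⟨J, hJ⟩ := terminate hsep subset_rfl hs0
  have := key J s hs
  rw [hJ, Subgroup.mem_bot] at this
  exact inv_mul_eq_one.1 this

/-- polygonal path -/
def path (e : M → ℝ → M) (c : ℕ → M) (s : ℝ) : ℕ → M
  | 0 => 1
  | k + 1 => path e c s k * e ((c k)⁻¹ * c (k + 1)) s

theorem path_len {e : M → ℝ → M} (he : ∀ g s, L.len (e g s) ≤ |s| * L.len g) {c : ℕ → M} {τ : ℝ}
    (hc : ∀ i, L.len ((c i)⁻¹ * c (i + 1)) ≤ τ) (s : ℝ) (k m : ℕ) :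
    L.len ((path e c s k)⁻¹ * path e c s (k + m)) ≤ m * (|s| * τ) := by
  induction m with
  | zero => simp [L.len_one]
  | succ m ih =>
    rw [← add_assoc, path, ← mul_assoc]
    refine (L.len_mul _ _).trans ?_
    have h1 := he ((c (k + m))⁻¹ * c (k + m + 1)) s
    have h2 : |s| * L.len ((c (k + m))⁻¹ * c (k + m + 1)) ≤ |s| * τ := by
      have := hc (k + m)
      gcongr
    push_cast; linarith

theorem path_Y {e : M → ℝ → M} (he : ∀ g, e g ∈ L.PS) (c : ℕ → M) (k : ℕ) :
    (path e c 1 k, path e c t k) ∈ L.Yg t := by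
  induction k with
  | zero => exact one_mem _
  | succ k ih => exact mul_mem ih (Yg_gen1 (he _))

theorem path_l {e : M → ℝ → M} (he : ∀ g, ∀ l ∈ L.W0 ⊤, l (e g 1) = l g) {c : ℕ → M} (h0 : c 0 = 1)
    (k : ℕ) {l : M → ℝ} (hl : l ∈ L.W0 ⊤) : l (path e c 1 k) = l (c k) := by
  induction k with
  | zero => rw [h0, path]
  | succ k ih =>
    rw [path, W0_mul hl trivial trivial, he _ l hl, ih, ← W0_mul hl trivial trivial, mul_inv_cancel_left]

theorem Yg_exists [ConnectedSpace M] [T2Space M] (hsep : ∀ x, L.len x = 0 → x = 1) (hgeo : L.Geo)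
    (ht : 0 ≤ t) (x : M) : ∃ y, (x, y) ∈ L.Yg t ∧ L.len y ≤ t * L.len x := by
  have hch : L.Chain ⊤ := L.chain_top_of_connected
  have hs0 := sep_PS hsep hgeo hch
  choose e he1 he2 he3 using exists_PS hsep hgeo hch
  obtain ⟨γ, hγ0, hγ1, hγ⟩ := hgeo x
  rcases eq_or_lt_of_le (L.len_nonneg x) with h0 | hT
  · refine ⟨1, ?_, by rw [L.len_one, ← h0, mul_zero]⟩
    rw [hsep x h0.symm]; exact one_mem _
  set T := L.len x with hTd
  let τ : ℕ → ℝ := fun n => T / (n + 1)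
  have hτ : ∀ n, 0 < τ n := fun n => by positivity
  have hτn : ∀ n : ℕ, (n + 1) * τ n = T := fun n => by simp only [τ]; field_simp
  let c : ℕ → ℕ → M := fun n i => γ (min (i * τ n) T)
  have hm : ∀ n (i : ℕ), min (i * τ n) T ∈ Set.Icc 0 T := fun n i =>
    ⟨le_min (by have := hτ n; positivity) hT.le, min_le_right _ _⟩
  have hc : ∀ n i, L.len ((c n i)⁻¹ * c n (i + 1)) ≤ τ n := by
    intro n i
    simp only [c]
    rw [hγ _ (hm n i) _ (hm n (i + 1))]
    refine (abs_min_sub_min_le_max _ _ _ _).trans ?_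
    push_cast
    rw [sub_self, abs_zero, show (i : ℝ) * τ n - (i + 1) * τ n = -τ n by ring, abs_neg,
      abs_of_nonneg (hτ n).le]
    simp [(hτ n).le]
  have hc0 : ∀ n, c n 0 = 1 := fun n => by simp [c, hγ0, hT.le]
  let k : ℝ → ℕ → ℕ := fun s n => ⌊s / τ n⌋₊
  have hk1 : ∀ s n, 0 ≤ s → k s n * τ n ≤ s := by
    intro s n hs
    have := Nat.floor_le (div_nonneg hs (hτ n).le)
    rwa [le_div_iff₀ (hτ n)] at this
  have hk2 : ∀ s n, s ≤ k s n * τ n + τ n := by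
    intro s n
    have := (Nat.lt_floor_add_one (s / τ n)).le
    rw [div_le_iff₀ (hτ n)] at this
    linarith
  let bn : ℝ → ℕ → M := fun s n => path e (c n) 1 (k s n)
  obtain ⟨p, hp⟩ : ∃ p : Ultrafilter ℕ, (p : Filter ℕ) ≤ atTop := Ultrafilter.exists_le _
  have hτ0 : Tendsto τ p (𝓝 0) := by
    have : Tendsto (fun n : ℕ => T / ((n : ℝ) + 1)) atTop (𝓝 0) :=
      tendsto_const_nhds.div_atTop (tendsto_atTop_add_const_right _ _ tendsto_natCast_atTop_atTop)
    exact this.mono_left hp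
  have hlen0 : ∀ s n m, L.len (path e (c n) s m) ≤ m * (|s| * τ n) := by
    intro s n m
    have := path_len he2 (hc n) s 0 m
    simpa [path] using this
  have hex : ∀ s, ∃ z, s ∈ Set.Icc 0 T → Tendsto (bn s) p (𝓝 z) := by
    intro s
    by_cases hs : s ∈ Set.Icc 0 T
    · obtain ⟨z, _, hz⟩ := exists_ulim (L.len_proper T) p (bn s) (Eventually.of_forall fun n => by
        refine (hlen0 1 n _).trans ?_
        rw [abs_one, one_mul]
        exact (hk1 s n hs.1).trans hs.2)
      exact ⟨z, fun _ => hz⟩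
    · exact ⟨1, fun h => absurd h hs⟩
  choose b hb using hex
  have hblen : ∀ s ∈ Set.Icc 0 T, ∀ s' ∈ Set.Icc 0 T, s ≤ s' → L.len ((b s)⁻¹ * b s') ≤ s' - s := by
    intro s hs s' hs' hss
    have h1 := (L.len_cont.tendsto _).comp ((hb s hs).inv.mul (hb s' hs'))
    have h2 : Tendsto (fun n => s' - s + τ n) p (𝓝 (s' - s + 0)) := hτ0.const_add _
    rw [add_zero] at h2
    refine le_of_tendsto_of_tendsto' h1 h2 fun n => ?_
    have hkk : k s n ≤ k s' n := Nat.floor_le_floor (by have := hτ n; gcongr)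
    obtain ⟨m, hmm⟩ := Nat.exists_eq_add_of_le hkk
    have h3 := path_len he2 (hc n) 1 (k s n) m
    rw [← hmm, abs_one, one_mul] at h3
    refine h3.trans ?_
    have h4 := hk1 s' n hs'.1
    have h5 := hk2 s n
    rw [hmm] at h4
    push_cast at h4
    linarith
  have hblen' : ∀ s ∈ Set.Icc 0 T, ∀ s' ∈ Set.Icc 0 T, L.len ((b s)⁻¹ * b s') ≤ |s' - s| := by
    intro s hs s' hs'
    rcases le_total s s' with h | h
    · rw [abs_of_nonneg (by linarith)]; exact hblen s hs s' hs' h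
    · rw [abs_sub_comm, abs_of_nonneg (by linarith), ← L.len_inv, mul_inv_rev, inv_inv]
      exact hblen s' hs' s hs h
  have h0mem : (0 : ℝ) ∈ Set.Icc 0 T := ⟨le_rfl, hT.le⟩
  have hTmem : T ∈ Set.Icc 0 T := ⟨hT.le, le_rfl⟩
  have hb0 : b 0 = 1 := by
    have h1 := hb 0 h0mem
    have h2 : bn 0 = fun _ => 1 := by funext n; simp [bn, k, path]
    rw [h2] at h1
    exact tendsto_nhds_unique h1 tendsto_const_nhds
  have hbl : ∀ s ∈ Set.Icc 0 T, ∀ l ∈ L.W0 ⊤, l (b s) = l (γ s) := by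
    intro s hs l hl
    have h1 := W0_tendsto' hl (Subgroup.mem_top (b s)) (Eventually.of_forall fun _ => trivial) (hb s hs)
    have h2 : Tendsto (fun n => l (c n (k s n))) p (𝓝 (l (γ s))) := by
      refine W0_tendsto hl trivial (Eventually.of_forall fun _ => trivial) ?_
      refine squeeze_zero (fun n => L.len_nonneg _) (fun n => ?_) hτ0
      simp only [c]
      rw [hγ _ hs _ (hm n _)]
      have a1 := hk1 s n hs.1
      have a2 := hk2 s n
      rw [min_eq_left (a1.trans hs.2), abs_of_nonneg (by linarith)]
      linarith
    refine tendsto_nhds_unique h1 (h2.congr fun n => ?_)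
    exact (path_l he3 (hc0 n) _ hl).symm
  have hbT : b T = x := by
    rw [← hγ1]
    exact curve_unique hsep hs0 b γ hb0 hγ0 hblen' (fun s hs s' hs' => by
      rw [hγ s hs s' hs', abs_sub_comm]) hbl hTmem
  have hkT : ∀ n, k T n = n + 1 := by
    intro n
    have : T / τ n = ((n + 1 : ℕ) : ℝ) := by
      rw [div_eq_iff (hτ n).ne']; push_cast; exact (hτn n).symm
    simp only [k]
    rw [this, Nat.floor_natCast]
  obtain ⟨y, hy1, hy2⟩ := exists_ulim (L.len_proper (t * T)) p (fun n => path e (c n) t (k T n))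
    (Eventually.of_forall fun n => by
      refine (hlen0 t n _).trans (le_of_eq ?_)
      rw [abs_of_nonneg ht, hkT, ← hτn n]; push_cast; ring)
  refine ⟨y, ?_, hy1⟩
  have h1 := hb T hTmem
  rw [hbT] at h1
  exact Yg_closed.mem_of_tendsto (h1.prodMk_nhds hy2) (Eventually.of_forall fun n => path_Y he1 _ _)

theorem exists_theta [ConnectedSpace M] [T2Space M] (hsep : ∀ x, L.len x = 0 → x = 1) (hgeo : L.Geo)
    (ht : 0 < t) : ∃ θ : M → M, Function.Bijective θ ∧
      ∀ x y, L.len ((θ x)⁻¹ * θ y) = t * L.len (x⁻¹ * y) := by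
  have hs0 := sep_PS hsep hgeo L.chain_top_of_connected
  have uniq := fun t => @Yg_unique M _ _ _ lam L t _ _ hsep hs0
  choose θ h1 h2 using Yg_exists (t := t) hsep hgeo ht.le
  have hlen : ∀ x, L.len (θ x) = t * L.len x := by
    intro x
    refine le_antisymm (h2 x) ?_
    obtain ⟨z, hz1, hz2⟩ := Yg_exists (t := t⁻¹) hsep hgeo (inv_nonneg.2 ht.le) (θ x)
    have := uniq _ hz1 (Yg_swap ht.ne' (h1 x))
    rw [this, inv_mul_eq_div, le_div_iff₀ ht] at hz2
    linarith
  have hmul : ∀ x y, (θ x)⁻¹ * θ y = θ (x⁻¹ * y) := fun x y =>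
    uniq _ (mul_mem (inv_mem (h1 x)) (h1 y)) (h1 (x⁻¹ * y))
  have hd : ∀ x y, L.len ((θ x)⁻¹ * θ y) = t * L.len (x⁻¹ * y) := fun x y => by rw [hmul, hlen]
  refine ⟨θ, ⟨fun x y hxy => ?_, fun y => ?_⟩, hd⟩
  · have := hd x y
    rw [hxy, inv_mul_cancel, L.len_one] at this
    rcases mul_eq_zero.1 this.symm with h | h
    · exact absurd h ht.ne'
    · exact inv_mul_eq_one.1 (hsep _ h)
  · obtain ⟨x, hx, _⟩ := Yg_exists (t := t⁻¹) hsep hgeo (inv_nonneg.2 ht.le) y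
    have := Yg_swap (inv_ne_zero ht.ne') hx
    rw [inv_inv] at this
    exact ⟨x, uniq _ (h1 x) this⟩
end curve
end LenData

open Filter Topology
open scoped commutatorElement
set_option linter.unusedSectionVars false

theorem exists_idem_ultra : ∃ p : Ultrafilter ℕ, (p : Filter ℕ) ≤ atTop ∧ ∀ P : ℕ → Prop,
    (∀ᶠ k in (p : Filter ℕ), P k) → ∀ᶠ n in (p : Filter ℕ), ∀ᶠ m in (p : Filter ℕ), P (n + m) := by
  letI := @Ultrafilter.addSemigroup ℕ _
  obtain ⟨U, hU, hU2⟩ := Hindman.exists_idempotent_ultrafilter_le_FS (M := ℕ) (fun _ => 1)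
  have key : ∀ P : ℕ → Prop, (∀ᶠ k in (U : Filter ℕ), P k) →
      ∀ᶠ n in (U : Filter ℕ), ∀ᶠ m in (U : Filter ℕ), P (n + m) := by
    intro P hP
    rw [← hU] at hP
    exact (Ultrafilter.eventually_add U U P).1 hP
  refine ⟨U, ?_, key⟩
  have hpos : ∀ a : Stream' ℕ, ∀ m, Hindman.FS a m → (∀ i, 0 < a.get i) → 0 < m := by
    intro a m h
    induction h with
    | head' a => intro h; exact h 0
    | tail' a m _ ih => intro h; exact ih fun i => h (i + 1)
    | cons' a m _ ih => intro h; exact Nat.add_pos_left (h 0) _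
  have h0 : ∀ᶠ m in (U : Filter ℕ), 0 < m := hU2.mono fun m hm => hpos _ m hm fun i => Nat.one_pos
  rw [← Nat.cofinite_eq_atTop]
  rcases U.le_cofinite_or_eq_pure with h | ⟨a, rfl⟩
  · exact h
  · exfalso
    have h1 := key (fun k => k = a) (by simp)
    simp at h1 h0
    omega

namespace LenData
section phase
variable {M : Type*} [Group M] [TopologicalSpace M] [IsTopologicalGroup M] {lam : ℝ}
  (L : LenData M lam)

/-- transitivity modulo the length -/
def Tr (G : Subgroup M) : Prop := ∀ g : M, ∃ h ∈ G, L.len (h⁻¹ * g) = 0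

variable {L}

theorem len_left {k : M} (hk : L.len k = 0) (x : M) : L.len (k * x) = L.len x := by
  have h1 := L.len_mul k x
  have h2 := L.len_mul k⁻¹ (k * x)
  rw [inv_mul_cancel_left, L.len_inv] at h2
  linarith

theorem len_right {k : M} (hk : L.len k = 0) (x : M) : L.len (x * k) = L.len x := by
  have h1 := L.len_mul x k
  have h2 := L.len_mul (x * k) k⁻¹
  rw [mul_inv_cancel_right, L.len_inv] at h2
  linarith

theorem Tr_iInf {ι : Type*} [Nonempty ι] {H : ι → Subgroup M} (hd : Directed (· ≥ ·) H)
    (hc : ∀ i, IsClosed (H i : Set M)) (ht : ∀ i, L.Tr (H i)) : L.Tr (⨅ i, H i) := by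
  intro g
  have hcl : IsClosed {h : M | L.len (h⁻¹ * g) = 0} :=
    isClosed_eq (L.len_cont.comp (by fun_prop)) continuous_const
  have hK : IsCompact {h : M | L.len (h⁻¹ * g) = 0} := by
    refine (L.len_proper (L.len g)).of_isClosed_subset hcl fun h hh => ?_
    have := len_right (L := L) (k := (h⁻¹ * g)⁻¹) (by rw [L.len_inv]; exact hh) g
    rw [mul_inv_rev, inv_inv, mul_inv_cancel_left] at this
    exact this.le
  obtain ⟨h, hh⟩ := IsCompact.nonempty_iInter_of_directed_nonempty_isCompact_isClosed
    (fun i => {h : M | L.len (h⁻¹ * g) = 0} ∩ (H i : Set M))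
    (by
      intro i j
      obtain ⟨k, h1, h2⟩ := hd i j
      exact ⟨k, fun x hx => ⟨hx.1, h1 hx.2⟩, fun x hx => ⟨hx.1, h2 hx.2⟩⟩)
    (fun i => by obtain ⟨h, h1, h2⟩ := ht i g; exact ⟨h, h2, h1⟩)
    (fun i => hK.inter_right (hc i)) (fun i => hcl.inter (hc i))
  rw [Set.mem_iInter] at hh
  exact ⟨h, Subgroup.mem_iInf.2 fun i => (hh i).2, (hh (Classical.arbitrary ι)).1⟩

theorem Tr_mono {H H' : Subgroup M} (h : H ≤ H') (ht : L.Tr H) : L.Tr H' := fun g => by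
  obtain ⟨x, hx, h1⟩ := ht g
  exact ⟨x, h hx, h1⟩

/-- geodesics modulo length zero -/
def Geo' (L : LenData M lam) : Prop := ∀ x : M, ∃ γ : ℝ → M, L.len (γ 0) = 0 ∧
  L.len ((γ (L.len x))⁻¹ * x) = 0 ∧ ∀ s ∈ Set.Icc 0 (L.len x), ∀ t ∈ Set.Icc 0 (L.len x),
    L.len ((γ s)⁻¹ * γ t) = |s - t|

theorem Geo'.geo (h : L.Geo') (hsep : ∀ x, L.len x = 0 → x = 1) : L.Geo := by
  intro x
  obtain ⟨γ, h0, h1, h2⟩ := h x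
  exact ⟨γ, hsep _ h0, inv_mul_eq_one.1 (hsep _ h1), h2⟩

/-- open subgroups are transitive -/
theorem Tr_open (hgeo : L.Geo') {V : Subgroup M} (hV : IsOpen (V : Set M)) : L.Tr V := by
  let W : Set M := {g | ∃ h ∈ V, L.len (h⁻¹ * g) = 0}
  have hW : IsOpen W := by
    have : W = ⋃ k ∈ {k : M | L.len k = 0}, (fun g => g * k⁻¹) ⁻¹' (V : Set M) := by
      ext g
      simp only [Set.mem_iUnion, Set.mem_preimage, Set.mem_setOf_eq, W, exists_prop]
      constructor
      · rintro ⟨h, h1, h2⟩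
        exact ⟨h⁻¹ * g, h2, by simpa using h1⟩
      · rintro ⟨k, h1, h2⟩
        exact ⟨g * k⁻¹, h2, by simpa using h1⟩
    rw [this]
    exact isOpen_biUnion fun k _ => hV.preimage (by fun_prop)
  have hε : ∃ ε > 0, ∀ h, L.len h < ε → h ∈ W := by
    have hK : IsCompact ({x | L.len x ≤ 1} \ W) := (L.len_proper 1).diff hW
    rcases (({x | L.len x ≤ 1} \ W) : Set M).eq_empty_or_nonempty with h | h
    · refine ⟨1, one_pos, fun x hx => ?_⟩
      by_contra hc
      have : x ∈ ({x | L.len x ≤ 1} \ W) := ⟨hx.le, hc⟩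
      rw [h] at this; exact this.elim
    · obtain ⟨x0, hx0, hmin⟩ := hK.exists_isMinOn h L.len_cont.continuousOn
      have hpos : 0 < L.len x0 := by
        refine lt_of_le_of_ne (L.len_nonneg _) fun h0 => hx0.2 ⟨1, V.one_mem, ?_⟩
        rw [inv_one, one_mul, ← h0]
      refine ⟨min 1 (L.len x0), lt_min one_pos hpos, fun x hx => ?_⟩
      by_contra hc
      have h1 : x ∈ ({x | L.len x ≤ 1} \ W) := ⟨(hx.trans_le (min_le_left _ _)).le, hc⟩
      have h2 : L.len x0 ≤ L.len x := hmin h1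
      exact absurd (hx.trans_le (min_le_right _ _)) (not_lt.2 h2)
  obtain ⟨ε, hε0, hε⟩ := hε
  have step : ∀ g ∈ W, ∀ h, L.len (g⁻¹ * h) < ε → h ∈ W := by
    rintro g ⟨v, hv, hvg⟩ h hh
    have h1 : L.len (v⁻¹ * h) < ε := by
      have := len_left (L := L) hvg (g⁻¹ * h)
      rw [mul_assoc, mul_inv_cancel_left] at this
      rwa [this]
    obtain ⟨v', hv', h2⟩ := hε _ h1
    exact ⟨v * v', V.mul_mem hv hv', by rwa [mul_inv_rev, mul_assoc]⟩
  intro g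
  obtain ⟨γ, h0, h1, hγ⟩ := hgeo g
  set T := L.len g
  have hT : 0 ≤ T := L.len_nonneg g
  obtain ⟨n, hn⟩ := exists_nat_gt (T / ε)
  rw [div_lt_iff₀ hε0] at hn
  have hn0 : (0 : ℝ) < n := by
    by_contra h
    have : (n : ℝ) * ε ≤ 0 := mul_nonpos_of_nonpos_of_nonneg (not_lt.1 h) hε0.le
    linarith
  have hm : ∀ k : ℕ, k ≤ n → (k : ℝ) * (T / n) ∈ Set.Icc 0 T := by
    intro k hk
    have : (k : ℝ) ≤ n := by exact_mod_cast hk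
    refine ⟨by positivity, ?_⟩
    calc (k : ℝ) * (T / n) ≤ n * (T / n) := by gcongr
      _ = T := by field_simp
  have hk : ∀ k : ℕ, k ≤ n → γ (k * (T / n)) ∈ W := by
    intro k
    induction k with
    | zero =>
      intro _
      refine ⟨1, V.one_mem, ?_⟩
      simp [h0]
    | succ k ih =>
      intro hk
      refine step _ (ih (by omega)) _ ?_
      rw [hγ _ (hm k (by omega)) _ (hm _ hk)]
      have : (k : ℝ) * (T / n) - ((k + 1 : ℕ) : ℝ) * (T / n) = -(T / n) := by push_cast; ring
      rw [this, abs_neg, abs_of_nonneg (by positivity), div_lt_iff₀ hn0]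
      linarith
  have := hk n le_rfl
  rw [mul_div_cancel₀ _ hn0.ne'] at this
  obtain ⟨h, hh, h2⟩ := this
  refine ⟨h, hh, ?_⟩
  have h3 := len_left (L := L) h2 ((γ T)⁻¹ * g)
  rw [mul_assoc, mul_inv_cancel_left, h1] at h3
  exact h3

/-- minimality -/
def Mini (L : LenData M lam) : Prop := ∀ H : Subgroup M, IsClosed (H : Set M) → L.Inv H → L.Tr H → H = ⊤

theorem no_open (hgeo : L.Geo') (hmin : L.Mini) {V : Subgroup M} (hV : IsOpen (V : Set M)) : V = ⊤ := by
  haveI : Nonempty {V : Subgroup M // IsOpen (V : Set M)} := ⟨⟨⊤, isOpen_univ⟩⟩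
  let H : {V : Subgroup M // IsOpen (V : Set M)} → Subgroup M := fun V => V.1
  have h := hmin (⨅ V, H V) ?_ ?_ ?_
  · have h1 : (⨅ V, H V) ≤ V := iInf_le H ⟨V, hV⟩
    rw [h] at h1
    exact top_le_iff.1 h1
  · rw [Subgroup.coe_iInf]
    exact isClosed_iInter fun V => Subgroup.isClosed_of_isOpen V.1 V.2
  · intro k x hx
    rw [Subgroup.mem_iInf] at hx ⊢
    intro V
    exact hx ⟨V.1.comap (L.sc k).toMonoidHom, V.2.preimage (L.sc_cont k)⟩
  · refine Tr_iInf ?_ (fun V => Subgroup.isClosed_of_isOpen V.1 V.2) (fun V => Tr_open hgeo V.2)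
    intro V V'
    exact ⟨⟨V.1 ⊓ V'.1, V.2.inter V'.2⟩, inf_le_left, inf_le_right⟩
end phase
end LenData

open Filter Topology
open scoped commutatorElement
set_option linter.unusedSectionVars false

namespace LenData
section phase1
variable {M : Type*} [Group M] [TopologicalSpace M] [IsTopologicalGroup M] {lam : ℝ}
  {L : LenData M lam}

/-- the contracted subgroup along an ultrafilter -/
def NN (L : LenData M lam) (p : Ultrafilter ℕ) : Subgroup M where
  carrier := {g | Tendsto (fun n : ℕ => L.sc (-n) g) p (𝓝 1)}
  one_mem' := by simp [tendsto_const_nhds]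
  mul_mem' := by
    intro a b ha hb
    have := Tendsto.mul (show Tendsto (fun n : ℕ => L.sc (-n) a) p (𝓝 1) from ha)
      (show Tendsto (fun n : ℕ => L.sc (-n) b) p (𝓝 1) from hb)
    simpa using this
  inv_mem' := by
    intro a ha
    have := Tendsto.inv (show Tendsto (fun n : ℕ => L.sc (-n) a) p (𝓝 1) from ha)
    simpa using this

theorem mem_NN {p : Ultrafilter ℕ} {g : M} :
    g ∈ L.NN p ↔ Tendsto (fun n : ℕ => L.sc (-n) g) p (𝓝 1) := Iff.rfl

theorem exists_kappa (p : Ultrafilter ℕ) (hp : (p : Filter ℕ) ≤ atTop) (g : M) :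
    ∃ κ, Tendsto (fun n : ℕ => L.sc (-n) g) p (𝓝 κ) ∧ L.len κ = 0 := by
  obtain ⟨κ, _, h⟩ := exists_ulim (L.len_proper (L.len g)) p (fun n : ℕ => L.sc (-n) g) (by
    refine Eventually.of_forall fun n => ?_
    show L.len _ ≤ _
    rw [len_sc]
    have h1 : lam ^ (-(n : ℤ)) ≤ 1 := zpow_le_one_of_nonpos₀ (by linarith [L.two_le]) (by simp)
    nlinarith [L.len_nonneg g])
  refine ⟨κ, h, ?_⟩
  have h1 := (L.len_cont.tendsto κ).comp h
  have h2 : Tendsto (fun n : ℕ => L.len (L.sc (-n) g)) p (𝓝 (0 * L.len g)) := by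
    simp only [len_sc]
    exact (L.lam_zpow_tendsto.mono_left hp).mul_const _
  rw [zero_mul] at h2
  exact tendsto_nhds_unique h1 h2

theorem NN_normal (p : Ultrafilter ℕ) (hp : (p : Filter ℕ) ≤ atTop) : (L.NN p).Normal := by
  refine ⟨fun g hg h => ?_⟩
  obtain ⟨κ, hκ, _⟩ := exists_kappa (L := L) p hp h
  have := (hκ.mul (mem_NN.1 hg)).mul hκ.inv
  rw [mul_one, mul_inv_cancel] at this
  rw [mem_NN]
  refine this.congr fun n => ?_
  simp

theorem NN_inv (p : Ultrafilter ℕ) : L.Inv (L.NN p) := by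
  intro k x hx
  rw [mem_NN] at hx ⊢
  have := ((L.sc_cont k).tendsto 1).comp hx
  rw [map_one] at this
  refine this.congr fun n => ?_
  simp only [Function.comp]
  rw [← sc_add, ← sc_add, add_comm]

theorem NN_N2 (p : Ultrafilter ℕ) (hp : (p : Filter ℕ) ≤ atTop)
    (hid : ∀ P : ℕ → Prop, (∀ᶠ k in (p : Filter ℕ), P k) →
      ∀ᶠ n in (p : Filter ℕ), ∀ᶠ m in (p : Filter ℕ), P (n + m))
    {D : Subgroup M} (hD : L.Inv D) (hDc : IsClosed (D : Set M)) (g : M) (hg : g ∈ D) :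
    ∃ h ∈ L.NN p ⊓ D, L.len (h⁻¹ * g) = 0 := by
  obtain ⟨κ, hκ, hl⟩ := exists_kappa (L := L) p hp g
  have hκD : κ ∈ D := hDc.mem_of_tendsto hκ (Eventually.of_forall fun n => hD _ _ hg)
  have hκ2 : Tendsto (fun n : ℕ => L.sc (-n) κ) p (𝓝 κ) := by
    intro U hU
    obtain ⟨C, hC, hCc, hCU⟩ := exists_mem_nhds_isClosed_subset hU
    have h1 := hid _ (hκ.eventually hC)
    refine Filter.mem_map.2 ?_
    filter_upwards [h1] with n hn
    apply hCU
    refine hCc.mem_of_tendsto (((L.sc_cont (-n)).tendsto κ).comp hκ) ?_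
    filter_upwards [hn] with m hm
    simp only [Function.comp]
    rw [← sc_add]
    have : (-(n : ℤ) + -(m : ℤ)) = -((n + m : ℕ) : ℤ) := by push_cast; ring
    rw [this]
    exact hm
  refine ⟨g * κ⁻¹, ⟨?_, D.mul_mem hg (D.inv_mem hκD)⟩, ?_⟩
  · show Tendsto (fun n : ℕ => L.sc (-n) (g * κ⁻¹)) p (𝓝 1)
    have := hκ.mul hκ2.inv
    rw [mul_inv_cancel] at this
    refine this.congr fun n => ?_
    simp
  · rw [mul_inv_rev, inv_inv, mul_assoc, inv_mul_cancel, mul_one, hl]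

theorem Inv_closure {D : Subgroup M} (hD : L.Inv D) : L.Inv D.topologicalClosure := by
  intro k x hx
  have : D.topologicalClosure ≤ D.topologicalClosure.comap (L.sc k).toMonoidHom := by
    refine D.topologicalClosure_minimal (fun y hy => D.le_topologicalClosure (hD k y hy)) ?_
    exact D.isClosed_topologicalClosure.preimage (L.sc_cont k)
  exact this hx

/-- chain condition for commutator subgroups -/
theorem chain_comm (hgeo : L.Geo') (hmin : L.Mini) (P : Subgroup M) [P.Normal] :
    L.Chain (⁅(⊤ : Subgroup M), P⁆).topologicalClosure := by
  set C : Subgroup M := ⁅(⊤ : Subgroup M), P⁆ with hC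
  set Q := C.topologicalClosure with hQ
  haveI hQn : Q.Normal := Subgroup.is_normal_topologicalClosure C
  have hCQ : C ≤ Q := C.le_topologicalClosure
  let O : Subgroup M :=
    { carrier := {x | ∃ n, x ∈ L.BP Q 1 n}
      one_mem' := ⟨0, rfl⟩
      mul_mem' := by rintro x y ⟨m, hm⟩ ⟨n, hn⟩; exact ⟨m + n, L.BP_mul hm hn⟩
      inv_mem' := by rintro x ⟨n, hn⟩; exact ⟨n, L.BP_inv hn⟩ }
  have hOs : ∀ x ∈ Q, L.len x ≤ 1 → x ∈ O := fun x hx h => ⟨1, L.BP_single hx h⟩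
  obtain ⟨U, hU, hconj⟩ := L.conj_small (r := 1) (η := 1 / 2) (by norm_num)
  have h1 : ∀ x : M, x⁻¹ ∈ U → L.len x < 1 / 2 → ∀ o ∈ O, x * o * x⁻¹ ∈ O := by
    rintro x hx hx2 o ⟨n, hn⟩
    induction n generalizing o with
    | zero =>
      rw [BP, Set.mem_singleton_iff] at hn
      rw [hn]; simp [O.one_mem]
    | succ n ih =>
      obtain ⟨y, hy, g, hg, hgr, rfl⟩ := hn
      have e : x * (y * g) * x⁻¹ = (x * y * x⁻¹) * ((x * g * x⁻¹ * g⁻¹) * g) := by group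
      rw [e]
      refine O.mul_mem (ih y hy) (O.mul_mem (hOs _ ?_ ?_) (hOs g hg hgr))
      · exact Q.mul_mem (hQn.conj_mem g hg x) (Q.inv_mem hg)
      · have h2 := hconj _ hx g⁻¹ (by rwa [L.len_inv])
        rw [inv_inv] at h2
        have h3 := L.len_mul x (g * x⁻¹ * g⁻¹)
        have e2 : x * g * x⁻¹ * g⁻¹ = x * (g * x⁻¹ * g⁻¹) := by group
        rw [e2]; linarith
  have hnorm : Subgroup.normalizer (O : Set M) = ⊤ := by
    refine no_open hgeo hmin (Subgroup.isOpen_of_mem_nhds _ (g := 1) ?_)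
    have hU' : {x : M | x⁻¹ ∈ U} ∈ 𝓝 (1 : M) := by
      have : Tendsto (fun x : M => x⁻¹) (𝓝 1) (𝓝 1) := by
        have := (continuous_inv (G := M)).tendsto 1
        rwa [inv_one] at this
      exact this hU
    filter_upwards [hU, hU', L.ball_mem_nhds (r := 1 / 2) (by norm_num)] with x hx hx' hx2
    show x ∈ Subgroup.normalizer (O : Set M)
    rw [Subgroup.mem_normalizer_iff]
    intro o
    refine ⟨fun ho => h1 x hx' hx2 o ho, fun ho => ?_⟩
    have := h1 x⁻¹ (by rwa [inv_inv]) (by rw [L.len_inv]; exact hx2) _ ho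
    simpa [mul_assoc] using this
  haveI hOn : O.Normal := Subgroup.normalizer_eq_top_iff.1 hnorm
  have hCO : C ≤ O := by
    rw [hC, Subgroup.commutator_le]
    intro x _ y hy
    let V : Subgroup M :=
      { carrier := {x | ⁅x, y⁆ ∈ O}
        one_mem' := by simp [O.one_mem]
        mul_mem' := by
          intro a b ha hb
          have e : ⁅a * b, y⁆ = (a * ⁅b, y⁆ * a⁻¹) * ⁅a, y⁆ := by
            simp only [commutatorElement_def]; group
          show ⁅a * b, y⁆ ∈ O
          rw [e]
          exact O.mul_mem (hOn.conj_mem _ hb a) ha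
        inv_mem' := by
          intro a ha
          have e : ⁅a⁻¹, y⁆ = a⁻¹ * ⁅a, y⁆⁻¹ * a⁻¹⁻¹ := by
            simp only [commutatorElement_def]; group
          show ⁅a⁻¹, y⁆ ∈ O
          rw [e]
          exact hOn.conj_mem _ (O.inv_mem ha) a⁻¹ }
    have hV : V = ⊤ := by
      refine no_open hgeo hmin (Subgroup.isOpen_of_mem_nhds _ (g := 1) ?_)
      have hc : Continuous fun x : M => L.len ⁅x, y⁆ :=
        L.len_cont.comp (by simp only [commutatorElement_def]; fun_prop)
      have := hc.tendsto 1
      rw [commutatorElement_one_left, L.len_one] at this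
      filter_upwards [this.eventually_le_const one_pos] with a ha
      exact hOs _ (hCQ (Subgroup.commutator_mem_commutator trivial hy)) ha
    have : x ∈ V := by rw [hV]; trivial
    exact this
  have hQO : ∀ q ∈ Q, ∃ n, q ∈ L.BP Q 1 n := by
    intro q hq
    have hq' : q ∈ closure (C : Set M) := hq
    have hc : Continuous fun x : M => L.len (x⁻¹ * q) := L.len_cont.comp (by fun_prop)
    obtain ⟨o, ho1, ho2⟩ := mem_closure_iff.1 hq' {x | L.len (x⁻¹ * q) < 1}
      (isOpen_lt hc continuous_const) (by simp [L.len_one])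
    have : o * (o⁻¹ * q) ∈ O :=
      O.mul_mem (hCO ho2) (hOs _ (Q.mul_mem (Q.inv_mem (hCQ ho2)) hq) (le_of_lt ho1))
    rw [mul_inv_cancel_left] at this
    exact this
  intro R
  let W : ℕ → Set M := fun n => {x | ∃ y ∈ L.BP Q 1 n, L.len (y⁻¹ * x) < 1}
  have hW : ∀ n, IsOpen (W n) := by
    intro n
    have : W n = ⋃ y ∈ L.BP Q 1 n, {x | L.len (y⁻¹ * x) < 1} := by
      ext x; simp [W]
    rw [this]
    refine isOpen_biUnion fun y _ => ?_
    exact _root_.isOpen_lt (L.len_cont.comp (continuous_const.mul continuous_id)) continuous_const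
  have hmono : Monotone W := by
    intro m n hmn x hx
    obtain ⟨y, hy, h⟩ := hx
    exact ⟨y, L.BP_mono zero_le_one hmn hy, h⟩
  have hK : IsCompact ({x | L.len x ≤ R} ∩ (Q : Set M)) :=
    (L.len_proper R).inter_right C.isClosed_topologicalClosure
  obtain ⟨n, hn⟩ := hK.elim_directed_cover W hW (by
    intro x hx
    obtain ⟨n, hn⟩ := hQO x hx.2
    exact Set.mem_iUnion.2 ⟨n, x, hn, by simp [L.len_one]⟩) hmono.directed_le
  refine ⟨n + 1, fun x hxQ hx => ?_⟩
  obtain ⟨y, hy, h⟩ := hn ⟨hx, hxQ⟩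
  exact ⟨y, hy, y⁻¹ * x, Q.mul_mem (Q.inv_mem (L.BP_mem hy)) hxQ, h.le, by simp⟩

theorem phase1_min (hgeo : L.Geo') (hmin : L.Mini)
    (heff : ∀ k : M, (∀ g, L.len (g⁻¹ * k * g) = 0) → k = 1) (x : M) (hx : L.len x = 0) : x = 1 := by
  obtain ⟨p, hp, hid⟩ := exists_idem_ultra
  set N := L.NN p with hN
  haveI hNn : N.Normal := NN_normal p hp
  have hTopInv : L.Inv (⊤ : Subgroup M) := fun _ _ _ => trivial
  have hNtop : N.topologicalClosure = ⊤ := by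
    refine hmin _ N.isClosed_topologicalClosure (Inv_closure (NN_inv p)) ?_
    refine Tr_mono N.le_topologicalClosure fun g => ?_
    obtain ⟨h, h1, h2⟩ := NN_N2 (L := L) p hp hid hTopInv isClosed_univ g trivial
    exact ⟨h, h1.1, h2⟩
  have hNd : ∀ g : M, g ∈ closure (N : Set M) := by
    intro g
    have : g ∈ N.topologicalClosure := by rw [hNtop]; trivial
    exact this
  set P := Subgroup.normalClosure {k : M | L.len k = 0} with hP
  have hPinv : L.Inv P := by
    intro k y hy
    have : P ≤ P.comap (L.sc k).toMonoidHom := by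
      refine Subgroup.normalClosure_le_normal fun a ha => ?_
      have ha' : L.len a = 0 := ha
      refine Subgroup.subset_normalClosure ?_
      show L.len (L.sc k a) = 0
      rw [len_sc, ha', mul_zero]
    exact this hy
  set C : Subgroup M := ⁅(⊤ : Subgroup M), P⁆ with hC
  set Q := C.topologicalClosure with hQ
  have hCQ : C ≤ Q := C.le_topologicalClosure
  haveI hQn : Q.Normal := Subgroup.is_normal_topologicalClosure C
  have hQc : IsClosed (Q : Set M) := C.isClosed_topologicalClosure
  have hCinv : L.Inv C := by
    intro k y hy
    have : C ≤ C.comap (L.sc k).toMonoidHom := by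
      rw [hC, Subgroup.commutator_le]
      intro a _ b hb
      show L.sc k ⁅a, b⁆ ∈ C
      rw [map_commutatorElement]
      exact Subgroup.commutator_mem_commutator trivial (hPinv k b hb)
    exact this hy
  have hQinv : L.Inv Q := Inv_closure hCinv
  have hQch : L.Chain Q := chain_comm hgeo hmin P
  have hQ0 : ∀ z ∈ Q, L.len z = 0 := by
    by_contra hcon
    push Not at hcon
    obtain ⟨z, hzQ, hz⟩ := hcon
    obtain ⟨hHch, l, hl, hl0, hlinv⟩ := exists_invHom (H := N ⊓ Q) hQinv hQc hQch hzQ hz p hp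
      inf_le_right (fun h hh => hh.1) (fun g hg => NN_N2 (L := L) p hp hid hQinv hQc g hg)
    set H := N ⊓ Q with hH
    have hHn : ∀ g : M, ∀ a ∈ H, g * a * g⁻¹ ∈ H := fun g a ha =>
      ⟨hNn.conj_mem a ha.1 g, hQn.conj_mem a ha.2 g⟩
    have hinv : ∀ g : M, ∀ a ∈ H, l (g * a * g⁻¹) = l a := by
      intro g a ha
      haveI : (𝓝[(N : Set M)] g).NeBot := mem_closure_iff_nhdsWithin_neBot.1 (hNd g)
      have hc : Continuous fun u : M => u * a * u⁻¹ := by fun_prop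
      have t1 := W0_tendsto' (F := 𝓝[(N : Set M)] g) hl (hHn g a ha)
        (u := fun u => u * a * u⁻¹) (Eventually.of_forall fun u => hHn u a ha)
        ((hc.tendsto g).mono_left nhdsWithin_le_nhds)
      have t2 : Tendsto (fun u => l (u * a * u⁻¹)) (𝓝[(N : Set M)] g) (𝓝 (l a)) := by
        refine tendsto_const_nhds.congr' ?_
        filter_upwards [self_mem_nhdsWithin] with u hu
        exact (hlinv u (hHn u) hu a ha).symm
      exact tendsto_nhds_unique t1 t2
    have hmem : ∀ a ∈ N, ∀ y ∈ P, ⁅a, y⁆ ∈ H := by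
      intro a ha y hy
      refine ⟨?_, hCQ (Subgroup.commutator_mem_commutator trivial hy)⟩
      have := N.mul_mem ha (hNn.conj_mem _ (N.inv_mem ha) y)
      rw [commutatorElement_def]
      simpa [mul_assoc] using this
    have hadd : ∀ a ∈ N, ∀ y ∈ P, ∀ y' ∈ P, l ⁅a, y * y'⁆ = l ⁅a, y⁆ + l ⁅a, y'⁆ := by
      intro a ha y hy y' hy'
      have e : ⁅a, y * y'⁆ = ⁅a, y⁆ * (y * ⁅a, y'⁆ * y⁻¹) := by
        simp only [commutatorElement_def]; group
      rw [e, W0_mul hl (hmem a ha y hy) (hHn y _ (hmem a ha y' hy')),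
        hinv y _ (hmem a ha y' hy')]
    have hzero : ∀ a ∈ N, ∀ y ∈ P, l ⁅a, y⁆ = 0 := by
      intro a ha y hy
      have hy' : y ∈ Subgroup.closure (Group.conjugatesOfSet {k : M | L.len k = 0}) := hy
      refine Subgroup.closure_induction (p := fun y _ => l ⁅a, y⁆ = 0) ?_ ?_ ?_ ?_ hy'
      · intro w hw
        have hwP : w ∈ P := Subgroup.subset_closure hw
        obtain ⟨k, hk, hkw⟩ := Group.mem_conjugatesOfSet_iff.1 hw
        obtain ⟨g, rfl⟩ := isConj_iff.1 hkw
        have hk' : L.len k = 0 := hk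
        set w := g * k * g⁻¹
        have hpow : ∀ n : ℕ, l ⁅a, w ^ n⁆ = n * l ⁅a, w⁆ := by
          intro n
          induction n with
          | zero => simp [W0_one hl]
          | succ n ih =>
            rw [pow_succ, hadd a ha _ (P.pow_mem hwP n) _ hwP, ih]; push_cast; ring
        have hlen : ∀ n : ℕ, L.len (w ^ n) ≤ 2 * L.len g := by
          intro n
          have e : w ^ n = g * k ^ n * g⁻¹ := conj_pow
          have h1 := L.len_pow_le k n
          rw [hk', mul_zero] at h1
          rw [e]
          have := L.len_conj_le g (k ^ n)
          linarith
        obtain ⟨B, hB0, hB⟩ := W0_bdd hHch hl (2 * L.len a + 2 * (2 * L.len g))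
        by_contra hne
        have hpos : 0 < |l ⁅a, w⁆| := abs_pos.2 hne
        obtain ⟨n, hn⟩ := exists_nat_gt (B / |l ⁅a, w⁆|)
        rw [div_lt_iff₀ hpos] at hn
        have h3 := hB _ (hmem a ha _ (P.pow_mem hwP n)) (by
          have := L.len_comm_le a (w ^ n)
          have := hlen n
          linarith)
        rw [hpow, abs_mul, abs_of_nonneg (Nat.cast_nonneg n)] at h3
        linarith
      · simp [W0_one hl]
      · intro u v hu hv h1 h2
        rw [hadd a ha u hu v hv, h1, h2, add_zero]
      · intro u hu h1
        have := hadd a ha u hu u⁻¹ (P.inv_mem hu)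
        rw [mul_inv_cancel, commutatorElement_one_right, W0_one hl, h1, zero_add] at this
        exact this.symm
    set R : Subgroup M := ⁅N, P⁆ with hR
    have hRH : R ≤ H := by
      rw [hR, Subgroup.commutator_le]
      exact hmem
    have hR0 : ∀ r ∈ R, l r = 0 := by
      intro r hr
      have hle : R ≤ Subgroup.closure {g | ∃ a ∈ N, ∃ y ∈ P, ⁅a, y⁆ = g} := by
        rw [hR, Subgroup.commutator_le]
        intro a ha y hy
        exact Subgroup.subset_closure ⟨a, ha, y, hy, rfl⟩
      have hcl : ∀ w ∈ Subgroup.closure {g | ∃ a ∈ N, ∃ y ∈ P, ⁅a, y⁆ = g}, w ∈ H := by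
        have : Subgroup.closure {g | ∃ a ∈ N, ∃ y ∈ P, ⁅a, y⁆ = g} ≤ H := by
          rw [Subgroup.closure_le]
          rintro _ ⟨a, ha, y, hy, rfl⟩
          exact hmem a ha y hy
        exact this
      refine Subgroup.closure_induction (p := fun y _ => l y = 0) ?_ ?_ ?_ ?_ (hle hr)
      · rintro _ ⟨a, ha, y, hy, rfl⟩; exact hzero a ha y hy
      · exact W0_one hl
      · intro u v hu hv h1 h2
        rw [W0_mul hl (hcl u hu) (hcl v hv), h1, h2, add_zero]
      · intro u hu h1
        rw [W0_inv hl (hcl u hu), h1, neg_zero]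
    have hQR : Q ≤ R.topologicalClosure := by
      refine C.topologicalClosure_minimal ?_ R.isClosed_topologicalClosure
      rw [hC, Subgroup.commutator_le]
      intro g _ y hy
      have hc : Continuous fun u : M => ⁅u, y⁆ := by
        simp only [commutatorElement_def]; fun_prop
      have : g ∈ closure (N : Set M) := hNd g
      exact map_mem_closure (f := fun u : M => ⁅u, y⁆) hc this fun a ha => Subgroup.commutator_mem_commutator ha hy
    apply hl0
    funext q
    show l q = 0
    by_cases hq : q ∈ H
    · have hqc : q ∈ closure (R : Set M) := hQR hq.2
      haveI : (𝓝[(R : Set M)] q).NeBot := mem_closure_iff_nhdsWithin_neBot.1 hqc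
      have t1 := W0_tendsto' (F := 𝓝[(R : Set M)] q) hl hq (u := fun u => u)
        (by filter_upwards [self_mem_nhdsWithin] with u hu; exact hRH hu)
        (tendsto_id.mono_left nhdsWithin_le_nhds)
      have t2 : Tendsto (fun u => l u) (𝓝[(R : Set M)] q) (𝓝 0) := by
        refine tendsto_const_nhds.congr' ?_
        filter_upwards [self_mem_nhdsWithin] with u hu
        exact (hR0 u hu).symm
      exact tendsto_nhds_unique t1 t2
    · exact W0_out hl hq
  have hQ1 : ∀ q ∈ Q, q = 1 := by
    intro q hq
    refine heff q fun g => hQ0 _ ?_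
    have := hQn.conj_mem q hq g⁻¹
    rwa [inv_inv] at this
  refine heff x fun g => ?_
  have h1 : ⁅g, x⁆ = 1 := hQ1 _ (hCQ (Subgroup.commutator_mem_commutator trivial
    (Subgroup.subset_normalClosure hx)))
  have h2 := commutatorElement_eq_one_iff_mul_comm.1 h1
  have h3 : g⁻¹ * x * g = x := by rw [mul_assoc, ← h2, inv_mul_cancel_left]
  rw [h3, hx]
end phase1
end LenData

open Filter Topology
set_option linter.unusedSectionVars false

namespace LenData
section phase16
variable {M : Type*} [Group M] [TopologicalSpace M] [IsTopologicalGroup M] {lam : ℝ}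
  {L : LenData M lam}

theorem exists_minimal_sub (L : LenData M lam) : ∃ G : Subgroup M, IsClosed (G : Set M) ∧ L.Inv G ∧ L.Tr G ∧
    ∀ H : Subgroup M, IsClosed (H : Set M) → L.Inv H → L.Tr H → H ≤ G → H = G := by
  obtain ⟨m, hm⟩ := zorn_le₀ (α := (Subgroup M)ᵒᵈ)
    {H | IsClosed ((OrderDual.ofDual H : Subgroup M) : Set M) ∧ L.Inv (OrderDual.ofDual H) ∧
      L.Tr (OrderDual.ofDual H)} (by
    intro c hc hch
    rcases c.eq_empty_or_nonempty with rfl | hne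
    · refine ⟨OrderDual.toDual ⊤, ⟨isClosed_univ, fun _ _ _ => trivial, fun g => ⟨g, trivial, ?_⟩⟩, by simp⟩
      rw [inv_mul_cancel, L.len_one]
    · haveI : Nonempty c := hne.to_subtype
      let H : c → Subgroup M := fun i => OrderDual.ofDual i.1
      refine ⟨OrderDual.toDual (⨅ i, H i), ⟨?_, ?_, ?_⟩, ?_⟩
      · show IsClosed ((⨅ i, H i : Subgroup M) : Set M)
        rw [Subgroup.coe_iInf]
        exact isClosed_iInter fun i => (hc i.2).1
      · intro k x hx
        have hx' : x ∈ ⨅ i, H i := hx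
        show L.sc k x ∈ ⨅ i, H i
        rw [Subgroup.mem_iInf] at hx' ⊢
        exact fun i => (hc i.2).2.1 k x (hx' i)
      · refine Tr_iInf (H := H) ?_ (fun i => (hc i.2).1) (fun i => (hc i.2).2.2)
        intro i j
        rcases hch.total i.2 j.2 with h | h
        · exact ⟨j, h, le_refl (H j)⟩
        · exact ⟨i, le_refl (H i), h⟩
      · intro z hz
        exact iInf_le H ⟨z, hz⟩)
  refine ⟨OrderDual.ofDual m, hm.prop.1, hm.prop.2.1, hm.prop.2.2, fun H h1 h2 h3 h4 => ?_⟩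
  have := hm.le_of_ge (y := OrderDual.toDual H) ⟨h1, h2, h3⟩ h4
  exact le_antisymm h4 this

theorem phase1 [T2Space M] (hgeo : L.Geo')
    (heff : ∀ k : M, (∀ g, L.len (g⁻¹ * k * g) = 0) → k = 1) :
    ∃ G : Subgroup M, L.Tr G ∧ (∀ x ∈ G, L.len x = 0 → x = 1) ∧
      ∀ t : ℝ, 0 < t → ∃ θ : G → G, Function.Bijective θ ∧
        ∀ x y : G, L.len (((θ x)⁻¹ * θ y : G) : M) = t * L.len ((x⁻¹ * y : G) : M) := by
  obtain ⟨G, hGc, hGi, hGt, hGm⟩ := L.exists_minimal_sub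
  set LG := L.sub G hGi hGc with hLG
  have hlen : ∀ x : G, LG.len x = L.len (x : M) := fun x => rfl
  have geoG : LG.Geo' := by
    intro x
    obtain ⟨γ, h0, h1, h2⟩ := hgeo (x : M)
    choose h hh hh0 using hGt
    have e : ∀ s t, L.len ((h (γ s))⁻¹ * h (γ t)) = L.len ((γ s)⁻¹ * γ t) := by
      intro s t
      have e1 : (h (γ s))⁻¹ * h (γ t) = ((h (γ s))⁻¹ * γ s) * (((γ s)⁻¹ * γ t) * ((h (γ t))⁻¹ * γ t)⁻¹) := by
        group
      rw [e1, len_left (hh0 _), len_right (by rw [L.len_inv]; exact hh0 _)]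
    refine ⟨fun s => ⟨h (γ s), hh _⟩, ?_, ?_, ?_⟩
    · show L.len (h (γ 0)) = 0
      have := len_left (L := L) (hh0 (γ 0)) (γ 0)⁻¹
      rw [mul_inv_cancel_right, L.len_inv, L.len_inv, h0] at this
      exact this
    · show L.len ((h (γ (L.len (x : M))))⁻¹ * (x : M)) = 0
      have := len_left (L := L) (hh0 (γ (L.len (x : M)))) ((γ (L.len (x : M)))⁻¹ * x)
      rw [mul_assoc, mul_inv_cancel_left, h1] at this
      exact this
    · intro s hs t ht
      show L.len ((h (γ s))⁻¹ * h (γ t)) = _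
      rw [e]
      exact h2 s hs t ht
  have effG : ∀ k : G, (∀ g, LG.len (g⁻¹ * k * g) = 0) → k = 1 := by
    intro k hk
    refine Subtype.ext (heff k fun g => ?_)
    obtain ⟨h, hh, hh0⟩ := hGt g
    have h1 : L.len (h⁻¹ * (k : M) * h) = 0 := hk ⟨h, hh⟩
    have e : g⁻¹ * (k : M) * g = (h⁻¹ * g)⁻¹ * ((h⁻¹ * k * h) * (h⁻¹ * g)) := by group
    rw [e, len_left (by rw [L.len_inv]; exact hh0), len_right hh0, h1]
  have minG : LG.Mini := by
    intro H hc hi ht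
    have h1 := hGm (H.map G.subtype) ?_ ?_ ?_ ?_
    · rw [eq_top_iff]
      intro x _
      have : (x : M) ∈ H.map G.subtype := by rw [h1]; exact x.2
      obtain ⟨y, hy, hyx⟩ := this
      have : y = x := Subtype.ext hyx
      rwa [← this]
    · rw [Subgroup.coe_map]
      exact hGc.isClosedEmbedding_subtypeVal.isClosedMap _ hc
    · rintro k _ ⟨y, hy, rfl⟩
      refine ⟨LG.sc k y, hi k y hy, ?_⟩
      exact sub_sc hGi hGc k y
    · intro g
      obtain ⟨h, hh, hh0⟩ := hGt g
      obtain ⟨h', hh', hh0'⟩ := ht ⟨h, hh⟩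
      refine ⟨h', ⟨h', hh', rfl⟩, ?_⟩
      have h3 : L.len ((h' : M)⁻¹ * h) = 0 := hh0'
      have := len_left (L := L) h3 (h⁻¹ * g)
      rw [mul_assoc, mul_inv_cancel_left, hh0] at this
      exact this
    · rintro _ ⟨y, _, rfl⟩; exact y.2
  have sepG : ∀ x : G, LG.len x = 0 → x = 1 := phase1_min geoG minG effG
  have geoG' := geoG.geo sepG
  haveI : ConnectedSpace G := by
    have hpre : IsPreconnected (Set.univ : Set G) := by
      refine isPreconnected_of_forall (1 : G) fun x _ => ?_
      obtain ⟨γ, h0, h1, h2⟩ := geoG' x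
      refine ⟨γ '' Set.Icc 0 (LG.len x), Set.subset_univ _, ⟨0, ⟨le_rfl, LG.len_nonneg x⟩, h0⟩,
        ⟨_, ⟨LG.len_nonneg x, le_rfl⟩, h1⟩, ?_⟩
      refine isPreconnected_Icc.image _ ?_
      intro s hs
      refine sep_tendsto' sepG ?_
      have : Tendsto (fun t : ℝ => |s - t|) (𝓝[Set.Icc 0 (LG.len x)] s) (𝓝 0) := by
        have hc : Continuous fun t : ℝ => |s - t| := by fun_prop
        have := hc.tendsto s
        rw [sub_self, abs_zero] at this
        exact this.mono_left nhdsWithin_le_nhds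
      refine this.congr' ?_
      filter_upwards [self_mem_nhdsWithin] with t ht
      exact (h2 s hs t ht).symm
    exact { isPreconnected_univ := hpre, toNonempty := ⟨1⟩ }
  refine ⟨G, hGt, fun x hx h => ?_, fun t ht => ?_⟩
  · have := sepG ⟨x, hx⟩ h
    exact congrArg Subtype.val this
  · exact exists_theta sepG geoG' ht
end phase16
end LenData

open Filter Topology
set_option linter.unusedSectionVars false

section iso
variable {X : Type*} [MetricSpace X]

/-- topology of pointwise convergence -/
@[reducible] def isoTop (X : Type*) [MetricSpace X] : TopologicalSpace (X ≃ᵢ X) :=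
  TopologicalSpace.induced (fun g : X ≃ᵢ X => (fun x => g x : X → X)) inferInstance

attribute [local instance] isoTop

theorem iso_eval (x : X) : Continuous fun g : X ≃ᵢ X => g x :=
  (continuous_apply x).comp continuous_induced_dom

theorem iso_cont {Y : Type*} [TopologicalSpace Y] {F : Y → (X ≃ᵢ X)}
    (h : ∀ x, Continuous fun y => F y x) : Continuous F :=
  continuous_induced_rng.2 (continuous_pi h)

theorem iso_topgroup : IsTopologicalGroup (X ≃ᵢ X) where
  continuous_mul := by
    refine iso_cont fun x => continuous_iff_continuousAt.2 ?_
    rintro ⟨g, h⟩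
    rw [ContinuousAt, tendsto_iff_dist_tendsto_zero]
    have h1 : Continuous fun p : (X ≃ᵢ X) × (X ≃ᵢ X) => dist (p.2 x) (h x) + dist (p.1 (h x)) (g (h x)) :=
      (((iso_eval x).comp continuous_snd).dist continuous_const).add
        (((iso_eval (h x)).comp continuous_fst).dist continuous_const)
    have h2 := h1.tendsto (g, h)
    simp only [dist_self, add_zero] at h2
    refine squeeze_zero (fun _ => dist_nonneg) (fun p => ?_) h2
    show dist (p.1 (p.2 x)) (g (h x)) ≤ _
    refine (dist_triangle _ (p.1 (h x)) _).trans ?_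
    rw [p.1.isometry.dist_eq]
  continuous_inv := by
    refine iso_cont fun x => continuous_iff_continuousAt.2 ?_
    intro g
    rw [ContinuousAt, tendsto_iff_dist_tendsto_zero]
    have h1 : Continuous fun p : (X ≃ᵢ X) => dist (g (g⁻¹ x)) (p (g⁻¹ x)) :=
      continuous_const.dist (iso_eval _)
    have h2 := h1.tendsto g
    simp only [dist_self] at h2
    refine h2.congr fun p => ?_
    have e1 : g (g⁻¹ x) = x := g.apply_symm_apply x
    have e2 : p (p⁻¹ x) = x := p.apply_symm_apply x
    rw [← p.isometry.dist_eq (p⁻¹ x), e2]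
    exact congrArg (fun z => dist z (p (g⁻¹ x))) e1

theorem iso_t2 : T2Space (X ≃ᵢ X) := by
  refine T2Space.of_injective_continuous (f := fun g : X ≃ᵢ X => (fun x => g x : X → X)) ?_
    continuous_induced_dom
  intro g h hgh
  ext x
  exact congrFun hgh x

theorem iso_compact [ProperSpace X] (o : X) (r : ℝ) : IsCompact {g : X ≃ᵢ X | dist (g o) o ≤ r} := by
  rw [isCompact_iff_ultrafilter_le_nhds]
  intro U hU
  have hU' : ∀ᶠ g in (U : Filter (X ≃ᵢ X)), dist (g o) o ≤ r := by
    rw [Filter.le_principal_iff] at hU; exact hU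
  have h1 : ∀ x, ∃ y, Tendsto (fun g : X ≃ᵢ X => g x) U (𝓝 y) := by
    intro x
    obtain ⟨y, _, h⟩ := exists_ulim (isCompact_closedBall o (dist x o + r)) U (fun g : X ≃ᵢ X => g x)
      (by
        filter_upwards [hU'] with g hg
        rw [Metric.mem_closedBall]
        refine (dist_triangle _ (g o) _).trans ?_
        rw [g.isometry.dist_eq]; linarith)
    exact ⟨y, h⟩
  have h2 : ∀ x, ∃ y, Tendsto (fun g : X ≃ᵢ X => g.symm x) U (𝓝 y) := by
    intro x
    obtain ⟨y, _, h⟩ := exists_ulim (isCompact_closedBall o (dist x o + r)) U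
      (fun g : X ≃ᵢ X => g.symm x)
      (by
        filter_upwards [hU'] with g hg
        rw [Metric.mem_closedBall, ← g.isometry.dist_eq, g.apply_symm_apply]
        refine (dist_triangle _ o _).trans ?_
        rw [dist_comm o]; linarith)
    exact ⟨y, h⟩
  choose φ hφ using h1
  choose ψ hψ using h2
  have hiso : Isometry φ := by
    refine Isometry.of_dist_eq fun x y => ?_
    have t := (hφ x).dist (hφ y)
    refine tendsto_nhds_unique t (tendsto_const_nhds.congr fun g => ?_)
    exact (g.isometry.dist_eq x y).symm
  have hr : ∀ x, φ (ψ x) = x := by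
    intro x
    refine tendsto_nhds_unique (hφ (ψ x)) ?_
    rw [tendsto_iff_dist_tendsto_zero]
    have := (tendsto_iff_dist_tendsto_zero.1 (hψ x))
    refine this.congr fun g => ?_
    rw [← g.isometry.dist_eq, g.apply_symm_apply, dist_comm]
  have hl : ∀ x, ψ (φ x) = x := fun x => hiso.injective (hr (φ x))
  let Φ : X ≃ᵢ X := IsometryEquiv.mk ⟨φ, ψ, hl, hr⟩ hiso
  refine ⟨Φ, ?_, ?_⟩
  · have t := (hφ o).dist (tendsto_const_nhds (x := o))
    exact le_of_tendsto t hU'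
  · rw [nhds_induced, ← Filter.tendsto_iff_comap]
    exact tendsto_pi_nhds.2 hφ

/-- conjugation by a similarity -/
def simConj (d : X ≃ X) (c : ℝ) (hc : c ≠ 0) (hd : ∀ x y, dist (d x) (d y) = c * dist x y)
    (g : X ≃ᵢ X) : X ≃ᵢ X :=
  IsometryEquiv.mk (d.symm.trans (g.toEquiv.trans d)) (by
    refine Isometry.of_dist_eq fun x y => ?_
    show dist (d (g (d.symm x))) (d (g (d.symm y))) = _
    rw [hd, g.isometry.dist_eq, ← hd, d.apply_symm_apply, d.apply_symm_apply])

theorem sim_symm {d : X ≃ X} {c : ℝ} (hc : c ≠ 0) (hd : ∀ x y, dist (d x) (d y) = c * dist x y) :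
    ∀ x y, dist (d.symm x) (d.symm y) = c⁻¹ * dist x y := by
  intro x y
  rw [← d.apply_symm_apply x, ← d.apply_symm_apply y, hd]
  simp [hc]

theorem sim_cont {d : X → X} {c : ℝ} (hd : ∀ x y, dist (d x) (d y) = c * dist x y) : Continuous d := by
  refine continuous_iff_continuousAt.2 fun x => ?_
  rw [ContinuousAt, tendsto_iff_dist_tendsto_zero]
  have : Continuous fun y => c * dist y x := by fun_prop
  have := this.tendsto x
  simp only [dist_self, mul_zero] at this
  exact this.congr fun y => (hd y x).symm

/-- the length data on the isometry group -/
noncomputable def isoLen [ProperSpace X] (o : X) (d : X ≃ X) (c : ℝ) (h2 : 2 ≤ c)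
    (hd : ∀ x y, dist (d x) (d y) = c * dist x y) (ho : d o = o) : LenData (X ≃ᵢ X) c where
  two_le := h2
  len g := dist (g o) o
  δ :=
    { toFun := simConj d c (by linarith) hd
      invFun := simConj d.symm c⁻¹ (inv_ne_zero (by linarith)) (sim_symm (by linarith) hd)
      left_inv := fun g => by ext x; simp [simConj]
      right_inv := fun g => by ext x; simp [simConj]
      map_mul' := fun g h => by ext x; simp [simConj] }
  len_one := dist_self o
  len_inv g := by
    have : g (g⁻¹ o) = o := g.apply_symm_apply o
    rw [← g.isometry.dist_eq, this, dist_comm]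
  len_mul g h := by
    show dist (g (h o)) o ≤ _
    refine (dist_triangle _ (g o) _).trans ?_
    rw [g.isometry.dist_eq]; linarith
  len_cont := (iso_eval o).dist continuous_const
  len_proper r := iso_compact o r
  δ_cont := iso_cont fun x => (sim_cont hd).comp (iso_eval (d.symm x))
  δ_symm_cont := iso_cont fun x =>
    (sim_cont (sim_symm (by linarith) hd)).comp (iso_eval (d.symm.symm x))
  len_δ g := by
    have : d.symm o = o := by rw [Equiv.symm_apply_eq, ho]
    show dist (d (g (d.symm o))) o = _
    rw [this]
    nth_rw 2 [← ho]
    rw [hd]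

theorem main_iso [ProperSpace X] (o : X) (d : X ≃ X) (c : ℝ) (h2 : 2 ≤ c)
    (hd : ∀ x y, dist (d x) (d y) = c * dist x y) (ho : d o = o)
    (hgeo : ∀ q : X, ∃ T : ℝ, 0 ≤ T ∧ ∃ γ : ℝ → X, (∀ s ∈ Set.Icc 0 T, ∀ t ∈ Set.Icc 0 T,
      dist (γ s) (γ t) = dist s t) ∧ γ 0 = o ∧ γ T = q)
    (hhom : ∀ q : X, ∃ g : X ≃ᵢ X, g o = q) (mu : ℝ) (hmu : 0 < mu) :
    ∃ F : X → X, Function.Bijective F ∧ ∀ x y, dist (F x) (F y) = mu * dist x y := by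
  haveI := iso_topgroup (X := X)
  haveI := iso_t2 (X := X)
  let L := isoLen o d c h2 hd ho
  have hlen : ∀ g h : X ≃ᵢ X, L.len (g⁻¹ * h) = dist (g o) (h o) := by
    intro g h
    show dist (g⁻¹ (h o)) o = _
    have : g (g⁻¹ (h o)) = h o := g.apply_symm_apply _
    rw [← g.isometry.dist_eq, this, dist_comm]
  have hl0 : ∀ g : X ≃ᵢ X, L.len g = dist (g o) o := fun g => rfl
  have geo : L.Geo' := by
    intro x
    obtain ⟨T, hT, γ, h1, h3, h4⟩ := hgeo (x o)
    have hTx : L.len x = T := by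
      rw [hl0, ← h4, ← h3, h1 T ⟨hT, le_rfl⟩ 0 ⟨le_rfl, hT⟩, Real.dist_eq, sub_zero, abs_of_nonneg hT]
    choose φ hφ using fun s => hhom (γ s)
    refine ⟨φ, ?_, ?_, ?_⟩
    · rw [hl0, hφ, h3, dist_self]
    · rw [hlen, hTx, hφ, h4, dist_self]
    · intro s hs t ht
      rw [hTx] at hs ht
      rw [hlen, hφ, hφ, h1 s hs t ht, Real.dist_eq]
  have heff : ∀ k : X ≃ᵢ X, (∀ g, L.len (g⁻¹ * k * g) = 0) → k = 1 := by
    intro k hk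
    ext x
    obtain ⟨g, rfl⟩ := hhom x
    have := hk g
    rw [mul_assoc, hlen] at this
    exact (dist_eq_zero.1 this).symm
  obtain ⟨G, hGt, hsep, hθ⟩ := L.phase1 geo heff
  obtain ⟨θ, hθb, hθd⟩ := hθ mu hmu
  let e : G → X := fun g => (g : X ≃ᵢ X) o
  have he : Function.Bijective e := by
    constructor
    · intro g h hgh
      have h1 : L.len ((g : X ≃ᵢ X)⁻¹ * h) = 0 := by
        rw [hlen]; exact dist_eq_zero.2 hgh
      exact Subtype.ext (inv_mul_eq_one.1 (hsep _ (G.mul_mem (G.inv_mem g.2) h.2) h1))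
    · intro x
      obtain ⟨m, rfl⟩ := hhom x
      obtain ⟨h, hh, hm⟩ := hGt m
      rw [hlen] at hm
      exact ⟨⟨h, hh⟩, dist_eq_zero.1 hm⟩
  have hed : ∀ g h : G, dist (e g) (e h) = L.len ((g⁻¹ * h : G) : X ≃ᵢ X) := fun g h => (hlen _ _).symm
  let E := Equiv.ofBijective e he
  refine ⟨fun x => e (θ (E.symm x)), he.comp (hθb.comp E.symm.bijective), fun x y => ?_⟩
  have hE : ∀ x, e (E.symm x) = x := fun x => E.apply_symm_apply x
  show dist (e _) (e _) = _
  rw [hed, hθd, ← hed, hE, hE]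

theorem proper_of_dil [LocallyCompactSpace X] (o : X)
    (hhom : ∀ q : X, ∃ g : X ≃ᵢ X, g o = q) (d : X ≃ X) (c : ℝ) (h2 : 2 ≤ c)
    (hd : ∀ x y, dist (d x) (d y) = c * dist x y) (ho : d o = o) : ProperSpace X := by
  have hdc := sim_cont hd
  obtain ⟨r, hr, hK⟩ : ∃ r > 0, IsCompact (Metric.closedBall o r) := by
    obtain ⟨K, hK, hKo⟩ := exists_compact_mem_nhds o
    obtain ⟨r, hr, h⟩ := Metric.nhds_basis_closedBall.mem_iff.1 hKo
    exact ⟨r, hr, hK.of_isClosed_subset Metric.isClosed_closedBall h⟩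
  have hn : ∀ n : ℕ, IsCompact (Metric.closedBall o (c ^ n * r)) := by
    intro n
    induction n with
    | zero => simpa using hK
    | succ n ih =>
      refine (ih.image hdc).of_isClosed_subset Metric.isClosed_closedBall fun x hx => ?_
      refine ⟨d.symm x, ?_, d.apply_symm_apply x⟩
      rw [Metric.mem_closedBall] at hx ⊢
      have := hd (d.symm x) o
      rw [d.apply_symm_apply, ho] at this
      rw [this, pow_succ] at hx
      have hc : 0 < c := by linarith
      have : c * dist (d.symm x) o ≤ c * (c ^ n * r) := by linarith
      exact le_of_mul_le_mul_left this hc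
  refine ⟨fun x R => ?_⟩
  obtain ⟨g, rfl⟩ := hhom x
  obtain ⟨n, hn'⟩ := pow_unbounded_of_one_lt (R / r) (show 1 < c by linarith)
  rw [div_lt_iff₀ hr] at hn'
  refine ((hn n).image g.continuous).of_isClosed_subset Metric.isClosed_closedBall fun y hy => ?_
  refine ⟨g.symm y, ?_, g.apply_symm_apply y⟩
  rw [Metric.mem_closedBall] at hy ⊢
  rw [← g.isometry.dist_eq, g.apply_symm_apply]
  linarith
end iso

theorem dilations_of_all_factors
    (X : Type*) [MetricSpace X] [Nonempty X] [LocallyCompactSpace X]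
    (hgeo : IsGeodesicSpace X) (hhom : IsometricallyHomogeneous X)
    (lam : ℝ) (hlam : 1 < lam) (f : X ≃ₜ X) (hf : IsDilation f lam) :
    ∀ mu : ℝ, 0 < mu → ∃ g : X ≃ₜ X, IsDilation g mu := by
  intro mu hmu
  obtain ⟨o⟩ := ‹Nonempty X›
  have hiso : ∀ p q : X, ∃ g : X ≃ᵢ X, g p = q := by
    intro p q
    obtain ⟨g, h1, h2, h3⟩ := hhom p q
    exact ⟨IsometryEquiv.mk (Equiv.ofBijective g ⟨h1.injective, h2⟩) h1, h3⟩
  have hpow : ∀ n : ℕ, ∃ d : X ≃ X, ∀ x y, dist (d x) (d y) = lam ^ n * dist x y := by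
    intro n
    induction n with
    | zero => exact ⟨Equiv.refl X, by simp⟩
    | succ n ih =>
      obtain ⟨d, hd⟩ := ih
      refine ⟨d.trans f.toEquiv, fun x y => ?_⟩
      have := hf (d x) (d y)
      rw [hd] at this
      rw [pow_succ, mul_comm (lam ^ n), mul_assoc]
      exact this
  obtain ⟨n, hn⟩ := pow_unbounded_of_one_lt 2 hlam
  obtain ⟨d, hd⟩ := hpow n
  obtain ⟨i, hi⟩ := hiso (d o) o
  have hd' : ∀ x y, dist ((d.trans i.toEquiv) x) ((d.trans i.toEquiv) y) = lam ^ n * dist x y := by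
    intro x y
    rw [← hd]
    exact i.isometry.dist_eq _ _
  haveI := proper_of_dil o (hiso o) (d.trans i.toEquiv) (lam ^ n) hn.le hd' hi
  obtain ⟨F, hF, hFd⟩ := main_iso o (d.trans i.toEquiv) (lam ^ n) hn.le hd' hi (hgeo o) (hiso o) mu hmu
  let E := Equiv.ofBijective F hF
  have hE : ∀ x y, dist (E x) (E y) = mu * dist x y := hFd
  exact ⟨⟨E, sim_cont hE, sim_cont (sim_symm hmu.ne' hE)⟩, hE⟩
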